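/- For every integer n ≥ 36, both N2(3,9,n) < N2(0,9,n) and N2(4,9,n) < N2(2,9,n) < N2(1,9,n) hold. -/

import Mathlib

open scoped Classical

/-- The M2-rank of a partition: ⌈ℓ/2⌉ − s, where ℓ is the largest part
(0 for the empty partition) and s is the number of parts. -/
def m2Rank {n : ℕ} (P : n.Partition) : ℤ :=
  (((P.parts.sup + 1) / 2 : ℕ) : ℤ) - (Multiset.card P.parts : ℤ)

/-- A partition has no repeated odd parts. -/
def NoRepeatedOddParts {n : ℕ} (P : n.Partition) : Prop :=
  ∀ j : ℕ, Odd j → P.parts.count j ≤ 1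

/-- `N2 r m n` is the number of partitions of `n` without repeated odd parts whose
M2-rank is congruent to `r` modulo `m`. -/
noncomputable def N2 (r : ℤ) (m n : ℕ) : ℕ :=
  Nat.card {P : n.Partition // NoRepeatedOddParts P ∧ m2Rank P ≡ r [ZMOD (m : ℤ)]}


/-- Positive parts, with no repeated odd part. -/
def VV (M : Multiset ℕ) : Prop := (∀ x ∈ M, 0 < x) ∧ ∀ j, Odd j → M.count j ≤ 1

/-- The rank of a multiset. -/
def rk (M : Multiset ℕ) : ℤ := (((M.sup + 1) / 2 : ℕ) : ℤ) - (Multiset.card M : ℤ)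

/-- Assemble a partition from inner parts, number of twos, presence of one. -/
def asm (K : Multiset ℕ) (c : ℕ) (e : Bool) : Multiset ℕ :=
  K.map (· + 2) + Multiset.replicate c 2 + (if e then {1} else 0)

lemma asm_card (K : Multiset ℕ) (c : ℕ) (e : Bool) :
    Multiset.card (asm K c e) = Multiset.card K + c + (if e then 1 else 0) := by
  cases e <;> simp [asm]

lemma asm_sum (K : Multiset ℕ) (c : ℕ) (e : Bool) :
    (asm K c e).sum = K.sum + 2 * Multiset.card K + 2 * c + (if e then 1 else 0) := by
  have : (K.map (· + 2)).sum = K.sum + 2 * Multiset.card K := by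
    induction K using Multiset.induction_on with
    | empty => simp
    | cons a s ih => simp [ih]; ring
  cases e <;> simp [asm, this] <;> ring

lemma asm_one_mem (K : Multiset ℕ) (c : ℕ) (e : Bool) : 1 ∈ asm K c e ↔ e = true := by
  cases e <;> simp [asm, Multiset.mem_replicate]

lemma asm_mem (K : Multiset ℕ) (c : ℕ) (e : Bool) (x : ℕ) (hx : x ∈ asm K c e) :
    (∃ y ∈ K, x = y + 2) ∨ (x = 2 ∧ 0 < c) ∨ (x = 1 ∧ e = true) := by
  cases e <;> simp [asm, Multiset.mem_replicate] at hx
  · rcases hx with ⟨a, ha, rfl⟩ | ⟨h1, rfl⟩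
    · exact Or.inl ⟨a, ha, rfl⟩
    · exact Or.inr (Or.inl ⟨rfl, Nat.pos_of_ne_zero h1⟩)
  · rcases hx with (⟨a, ha, rfl⟩ | ⟨h1, rfl⟩) | rfl
    · exact Or.inl ⟨a, ha, rfl⟩
    · exact Or.inr (Or.inl ⟨rfl, Nat.pos_of_ne_zero h1⟩)
    · exact Or.inr (Or.inr ⟨rfl, rfl⟩)

lemma asm_inner (K : Multiset ℕ) (hK : ∀ x ∈ K, 0 < x) (c : ℕ) (e : Bool) :
    ((asm K c e).filter (2 < ·)).map (· - 2) = K := by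
  have h1 : (K.map (· + 2)).filter (2 < ·) = K.map (· + 2) := by
    rw [Multiset.filter_eq_self]
    intro x hx
    obtain ⟨y, hy, rfl⟩ := Multiset.mem_map.1 hx
    have := hK y hy
    omega
  have h2 : (Multiset.replicate c 2).filter (2 < ·) = 0 := by
    rw [Multiset.filter_eq_nil]
    intro x hx
    have := Multiset.eq_of_mem_replicate hx
    omega
  have h3 : ((if e then {1} else 0 : Multiset ℕ)).filter (2 < ·) = 0 := by
    cases e <;> simp [Multiset.filter_singleton]
  rw [asm, Multiset.filter_add, Multiset.filter_add, h1, h2, h3]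
  simp

lemma asm_count_odd (K : Multiset ℕ) (c : ℕ) (e : Bool) (j : ℕ) (hj : Odd j) :
    (asm K c e).count j = if j = 1 then (if e then 1 else 0) else K.count (j - 2) := by
  have h2 : (Multiset.replicate c 2).count j = 0 := by
    rw [Multiset.count_eq_zero]
    intro hx
    have := Multiset.eq_of_mem_replicate hx
    subst this
    exact absurd hj (by decide)
  rw [asm, Multiset.count_add, Multiset.count_add, h2]
  by_cases h1 : j = 1
  · subst h1
    have : (K.map (· + 2)).count 1 = 0 := by
      rw [Multiset.count_eq_zero]; simp
    rw [this]
    cases e <;> simp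
  · have h3 : 3 ≤ j := by
      rcases hj with ⟨m, rfl⟩; omega
    obtain ⟨i, rfl⟩ : ∃ i, j = i + 2 := ⟨j - 2, by omega⟩
    have h5 : (K.map (· + 2)).count (i + 2) = K.count i :=
      Multiset.count_map_eq_count' (· + 2) K (fun a b h => by simpa using h) i
    rw [h5]
    simp only [h1, if_false, Nat.add_sub_cancel]
    cases e <;> simp

lemma asm_VV (K : Multiset ℕ) (c : ℕ) (e : Bool) (hK : VV K) : VV (asm K c e) := by
  refine ⟨?_, ?_⟩
  · intro x hx
    rcases asm_mem K c e x hx with ⟨y, _, rfl⟩ | ⟨rfl, _⟩ | ⟨rfl, _⟩ <;> omega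
  · intro j hj
    rw [asm_count_odd K c e j hj]
    split_ifs with h1
    · exact le_rfl
    · omega
    · apply hK.2
      rcases hj with ⟨m, rfl⟩
      exact ⟨m - 1, by omega⟩

/-- Every admissible multiset is assembled. -/
lemma asm_surj (W : Multiset ℕ) (hW : VV W) :
    ∃ K c e, VV K ∧ W = asm K c e := by
  refine ⟨(W.filter (2 < ·)).map (· - 2), W.count 2, decide (1 ∈ W), ⟨?_, ?_⟩, ?_⟩
  · intro x hx
    obtain ⟨y, hy, rfl⟩ := Multiset.mem_map.1 hx
    have := (Multiset.mem_filter.1 hy).2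
    omega
  · intro j hj
    have h1 : ((W.filter (2 < ·)).map (· - 2)).count j = (W.filter (2 < ·)).count (j + 2) := by
      rw [Multiset.count_map]
      rw [Multiset.count, Multiset.countP_eq_card_filter]
      congr 1
      apply Multiset.filter_congr
      intro x hx
      have := (Multiset.mem_filter.1 hx).2
      omega
    rw [h1]
    refine le_trans (Multiset.count_le_of_le _ (Multiset.filter_le _ _)) (hW.2 _ ?_)
    rcases hj with ⟨m, rfl⟩
    exact ⟨m + 1, by ring⟩
  · ext j
    rw [asm, Multiset.count_add, Multiset.count_add, Multiset.map_map]
    have h1 : (W.filter (2 < ·)).map ((· + 2) ∘ (· - 2)) = W.filter (2 < ·) := by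
      conv_rhs => rw [← Multiset.map_id (W.filter (2 < ·))]
      apply Multiset.map_congr rfl
      intro x hx
      have := (Multiset.mem_filter.1 hx).2
      simp; omega
    rw [h1, Multiset.count_filter, Multiset.count_replicate]
    have hz : W.count 0 = 0 := by
      rw [Multiset.count_eq_zero]; intro h; exact absurd (hW.1 0 h) (by simp)
    have ho := hW.2 1 (by decide)
    by_cases hj2 : 2 < j
    · have : j ≠ 1 := by omega
      have h2 : (2:ℕ) ≠ j := by omega
      by_cases hm : 1 ∈ W <;> simp [hj2, hm, this, h2]
    · have : j = 0 ∨ j = 1 ∨ j = 2 := by omega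
      rcases this with rfl | rfl | rfl
      · by_cases hm : 1 ∈ W <;> simp [hm, hz]
      · by_cases hm : 1 ∈ W
        · have := Multiset.one_le_count_iff_mem.2 hm
          simp [hm]; omega
        · simp [hm]
      · by_cases hm : 1 ∈ W <;> simp [hm]

lemma sup_mem_of_ne (M : Multiset ℕ) (h : M ≠ 0) : M.sup ∈ M := by
  induction M using Multiset.induction_on with
  | empty => simp at h
  | cons a s ih =>
    by_cases hs : s = 0
    · subst hs; simp
    · rw [Multiset.sup_cons]
      rcases le_total a s.sup with h1 | h1
      · rw [sup_eq_right.2 h1]; exact Multiset.mem_cons_of_mem (ih hs)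
      · rw [sup_eq_left.2 h1]; simp

lemma VV_mono {K M : Multiset ℕ} (h : K ≤ M) (hM : VV M) : VV K :=
  ⟨fun x hx => hM.1 x (Multiset.mem_of_le h hx),
   fun j hj => le_trans (Multiset.count_le_of_le j h) (hM.2 j hj)⟩

lemma VV_cons {l : ℕ} {K : Multiset ℕ} (hl : 0 < l) (hK : VV K)
    (hlt : Odd l → ∀ x ∈ K, x < l) : VV (l ::ₘ K) := by
  refine ⟨?_, ?_⟩
  · intro x hx
    rcases Multiset.mem_cons.1 hx with rfl | h
    · exact hl
    · exact hK.1 x h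
  · intro j hj
    rw [Multiset.count_cons]
    split_ifs with h
    · subst h
      have : K.count j = 0 := by
        rw [Multiset.count_eq_zero]; intro hm; exact absurd (hlt hj j hm) (lt_irrefl _)
      omega
    · simpa using hK.2 j hj

lemma VV_lt {l : ℕ} {K : Multiset ℕ} (h : VV (l ::ₘ K)) (hs : ∀ x ∈ K, x ≤ l) (ho : Odd l) :
    ∀ x ∈ K, x < l := by
  intro x hx
  refine lt_of_le_of_ne (hs x hx) ?_
  rintro rfl
  have := h.2 x ho
  rw [Multiset.count_cons_self] at this
  have := Multiset.one_le_count_iff_mem.2 hx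
  omega

lemma sup_cons_eq {l : ℕ} {K : Multiset ℕ} (hs : ∀ x ∈ K, x ≤ l) : (l ::ₘ K).sup = l := by
  rw [Multiset.sup_cons, sup_eq_left]
  exact Multiset.sup_le.2 hs

def fwd (ρ : ℤ) (M : Multiset ℕ) : Multiset ℕ :=
  asm (M.erase M.sup)
    ((((M.sup + 1) / 2 : ℕ) : ℤ) + ρ - Multiset.card (M.erase M.sup)).toNat (decide (Even M.sup))

noncomputable def bwd (ρ : ℤ) (W : Multiset ℕ) : Multiset ℕ :=
  let l : ℕ := if 1 ∈ W then (2 * ((Multiset.card W : ℤ) - 1 - ρ)).toNat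
    else (2 * ((Multiset.card W : ℤ) - ρ) - 1).toNat
  if l = 0 then (W.filter (2 < ·)).map (· - 2) else l ::ₘ (W.filter (2 < ·)).map (· - 2)

def domA (ρ : ℤ) (n : ℕ) : Set (Multiset ℕ) :=
  {M | VV M ∧ M.sum = n ∧ -ρ - 1 ≤ rk M ∧ (M ≠ 0 ∨ 0 ≤ ρ)}

def domB (ρ : ℤ) (n : ℕ) : Set (Multiset ℕ) :=
  {M | VV M ∧ M.sum = n ∧ rk M ≤ -ρ ∧ (M ≠ 0 ∨ ρ < 0)}

lemma fwd_zero (ρ : ℤ) : fwd ρ 0 = asm 0 ρ.toNat true := by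
  simp [fwd]

lemma fwd_cons (ρ : ℤ) (l : ℕ) (K : Multiset ℕ) (hs : ∀ x ∈ K, x ≤ l) :
    fwd ρ (l ::ₘ K) = asm K ((((l + 1) / 2 : ℕ) : ℤ) + ρ - Multiset.card K).toNat
      (decide (Even l)) := by
  rw [fwd, sup_cons_eq hs]; simp

lemma sup_asm_le (K : Multiset ℕ) (c : ℕ) (e : Bool) (b : ℕ) (hs : ∀ x ∈ K, x ≤ b) :
    (asm K c e).sup ≤ b + 2 := by
  apply Multiset.sup_le.2
  intro x hx
  rcases asm_mem K c e x hx with ⟨y, hy, rfl⟩ | ⟨rfl, _⟩ | ⟨rfl, _⟩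
  · have := hs y hy; omega
  · omega
  · omega

lemma decomp (M : Multiset ℕ) (hM : VV M) (h0 : M ≠ 0) :
    ∃ l K, M = l ::ₘ K ∧ 0 < l ∧ VV K ∧ (∀ x ∈ K, x ≤ l) ∧ (Odd l → ∀ x ∈ K, x < l) := by
  have h1 := sup_mem_of_ne M h0
  have h2 : M = M.sup ::ₘ M.erase M.sup := (Multiset.cons_erase h1).symm
  have h3 : ∀ x ∈ M.erase M.sup, x ≤ M.sup := fun x hx =>
    Multiset.le_sup (Multiset.mem_of_mem_erase hx)
  refine ⟨M.sup, M.erase M.sup, h2, hM.1 _ h1, VV_mono (Multiset.erase_le _ _) hM, h3, ?_⟩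
  intro ho
  exact VV_lt (by rw [← h2]; exact hM) h3 ho

lemma rk_cons {l : ℕ} {K : Multiset ℕ} (hs : ∀ x ∈ K, x ≤ l) :
    rk (l ::ₘ K) = (((l + 1) / 2 : ℕ) : ℤ) - (Multiset.card K + 1) := by
  rw [rk, sup_cons_eq hs]; simp

lemma fwd_spec (ρ : ℤ) (n m : ℕ) (hnm : (m : ℤ) = n + 2 * ρ + 1) (M : Multiset ℕ)
    (hM : M ∈ domA ρ n) : fwd ρ M ∈ domB ρ m ∧ bwd ρ (fwd ρ M) = M := by
  obtain ⟨hV, hsum, hr, hne⟩ := hM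
  by_cases h0 : M = 0
  · subst h0
    have hρ : 0 ≤ ρ := by simpa using hne
    have hn0 : n = 0 := by simpa using hsum.symm
    obtain ⟨r, rfl⟩ := Int.eq_ofNat_of_zero_le hρ
    rw [fwd_zero]
    refine ⟨⟨asm_VV _ _ _ ⟨by simp, by simp⟩, ?_, ?_, ?_⟩, ?_⟩
    · rw [asm_sum]; simp; omega
    · rw [rk, asm_card]
      have : (asm 0 r true).sup ≤ 2 := by
        simpa using sup_asm_le 0 r true 0 (by simp)
      have h1 : r = 0 → (asm 0 r true).sup ≤ 2 := fun _ => this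
      simp only [Int.toNat_natCast, Multiset.card_zero, if_true]
      push_cast
      omega
    · left; intro h
      have := congrArg Multiset.card h
      rw [asm_card] at this
      simp at this
    · have h1 : 1 ∈ asm 0 r true := (asm_one_mem _ _ _).2 rfl
      simp only [bwd, Int.toNat_natCast, h1, if_true, asm_card]
      rw [asm_inner _ (by simp)]
      simp
  · obtain ⟨l, K, rfl, hl, hK, hs, hlt⟩ := decomp M hV h0
    rw [rk_cons hs] at hr
    rw [fwd_cons ρ l K hs]
    set c : ℤ := (((l + 1) / 2 : ℕ) : ℤ) + ρ - Multiset.card K with hc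
    have hc0 : 0 ≤ c := by omega
    obtain ⟨d, hd⟩ := Int.eq_ofNat_of_zero_le hc0
    rw [hd, Int.toNat_natCast]
    rw [Multiset.sum_cons] at hsum
    rcases Nat.even_or_odd l with hev | hod
    · have hno : ¬ Odd l := Nat.not_odd_iff_even.2 hev
      obtain ⟨a, ha⟩ := hev
      have hde : decide (Even l) = true := by simp [ha]
      rw [hde]
      refine ⟨⟨asm_VV _ _ _ hK, ?_, ?_, ?_⟩, ?_⟩
      · rw [asm_sum]; simp; omega
      · rw [rk, asm_card]
        have := sup_asm_le K d true l hs
        simp only [if_true]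
        push_cast
        omega
      · left; intro h
        have := congrArg Multiset.card h
        rw [asm_card] at this
        simp at this
      · have h1 : 1 ∈ asm K d true := (asm_one_mem _ _ _).2 rfl
        simp only [bwd, h1, if_true, asm_card]
        rw [asm_inner _ hK.1]
        have h2 : (2 * (((Multiset.card K + d + 1 : ℕ) : ℤ) - 1 - ρ)).toNat = l := by
          push_cast; omega
        rw [h2, if_neg (by omega)]
    · have hev : ¬ Even l := Nat.not_even_iff_odd.2 hod
      have hlt' := hlt hod
      obtain ⟨a, ha⟩ := hod
      have hde : decide (Even l) = false := by simp [hev]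
      rw [hde]
      have hb : ∀ x ∈ K, x ≤ 2 * a := fun x hx => by have := hlt' x hx; omega
      refine ⟨⟨asm_VV _ _ _ hK, ?_, ?_, ?_⟩, ?_⟩
      · rw [asm_sum]; simp; omega
      · rw [rk, asm_card]
        have := sup_asm_le K d false (2 * a) hb
        push_cast
        simp
        omega
      · by_cases hρ : ρ < 0
        · exact Or.inr hρ
        · left; intro h
          have := congrArg Multiset.card h
          rw [asm_card, Multiset.card_zero] at this
          omega
      · have h1 : 1 ∉ asm K d false := by rw [asm_one_mem]; simp
        simp only [bwd, h1, if_false, asm_card]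
        rw [asm_inner _ hK.1]
        have h2 : (2 * (((Multiset.card K + d + (if false = true then 1 else 0) : ℕ) : ℤ) - ρ) - 1).toNat = l := by
          simp; omega
        rw [h2, if_neg (by omega)]

lemma bwd_asm_true (ρ : ℤ) (K : Multiset ℕ) (hK : VV K) (c : ℕ) :
    bwd ρ (asm K c true) = if (2 * ((Multiset.card K + c : ℕ) - ρ)).toNat = 0 then K else
      (2 * ((Multiset.card K + c : ℕ) - ρ)).toNat ::ₘ K := by
  have h1 : 1 ∈ asm K c true := (asm_one_mem _ _ _).2 rfl
  simp only [bwd, h1, if_true, asm_card]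
  rw [asm_inner _ hK.1]
  have : (2 * (((Multiset.card K + c + 1 : ℕ) : ℤ) - 1 - ρ)) =
     (2 * ((Multiset.card K + c : ℕ) - ρ)) := by push_cast; ring
  rw [this]

lemma bwd_asm_false (ρ : ℤ) (K : Multiset ℕ) (hK : VV K) (c : ℕ) :
    bwd ρ (asm K c false) = if (2 * ((Multiset.card K + c : ℕ) - ρ) - 1).toNat = 0 then K else
      (2 * ((Multiset.card K + c : ℕ) - ρ) - 1).toNat ::ₘ K := by
  have h1 : 1 ∉ asm K c false := by rw [asm_one_mem]; simp
  simp only [bwd, h1, if_false, asm_card]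
  rw [asm_inner _ hK.1]
  simp

lemma le_sup_asm (K : Multiset ℕ) (c : ℕ) (e : Bool) : ∀ x ∈ K, x + 2 ≤ (asm K c e).sup := by
  intro x hx
  apply Multiset.le_sup
  simp only [asm, Multiset.mem_add, Multiset.mem_map]
  exact Or.inl (Or.inl ⟨x, hx, rfl⟩)

lemma bwd_spec (ρ : ℤ) (n m : ℕ) (hnm : (m : ℤ) = n + 2 * ρ + 1) (W : Multiset ℕ)
    (hW : W ∈ domB ρ m) : bwd ρ W ∈ domA ρ n ∧ fwd ρ (bwd ρ W) = W := by
  obtain ⟨hV, hsum, hr, hne⟩ := hW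
  obtain ⟨K, c, e, hK, rfl⟩ := asm_surj W hV
  rw [asm_sum] at hsum
  rw [rk, asm_card] at hr
  have hle := le_sup_asm K c e
  cases e with
  | true =>
    rw [bwd_asm_true ρ K hK]
    have hs1 : 1 ≤ (asm K c true).sup := Multiset.le_sup ((asm_one_mem _ _ _).2 rfl)
    simp only [if_true] at hr hsum
    push_cast at hr
    have h0 : 0 ≤ ((Multiset.card K + c : ℕ) : ℤ) - ρ := by push_cast; omega
    obtain ⟨a, ha⟩ := Int.eq_ofNat_of_zero_le h0
    rw [ha]
    have h2 : (2 * (a : ℤ)).toNat = 2 * a := by omega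
    simp only [h2]
    push_cast at ha
    by_cases ha0 : a = 0
    · subst ha0
      simp only [mul_zero, if_true]
      have hK0 : K = 0 := by
        by_contra hKn
        obtain ⟨x, hx⟩ := Multiset.exists_mem_of_ne_zero hKn
        have h3 := hle x hx
        have h4 := hK.1 x hx
        omega
      subst hK0
      have hc : ρ = c := by simp at ha; omega
      subst hc
      refine ⟨⟨hK, ?_, ?_, Or.inr (by omega)⟩, ?_⟩
      · simp; simp at hsum; omega
      · simp [rk]
      · rw [fwd_zero]; simp
    · rw [if_neg (by omega)]
      have hs : ∀ x ∈ K, x ≤ 2 * a := by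
        intro x hx
        have h3 := hle x hx
        omega
      have hno : ¬ Odd (2 * a) := by simp
      refine ⟨⟨VV_cons (by omega) hK (fun h => absurd h hno), ?_, ?_, Or.inl (by simp)⟩, ?_⟩
      · rw [Multiset.sum_cons]; omega
      · rw [rk_cons hs]; omega
      · rw [fwd_cons ρ _ K hs]
        have h3 : decide (Even (2 * a)) = true := by simp
        have h4 : ((((2 * a + 1) / 2 : ℕ) : ℤ) + ρ - Multiset.card K).toNat = c := by omega
        rw [h3, h4]
  | false =>
    rw [bwd_asm_false ρ K hK]
    simp only [Bool.false_eq_true, if_false] at hr hsum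
    push_cast at hr
    have hs1 : 0 < Multiset.card K + c → 2 ≤ (asm K c false).sup := by
      intro h
      by_cases hK0 : K = 0
      · subst hK0
        simp at h
        apply Multiset.le_sup
        simp [asm, Multiset.mem_replicate, h.ne']
      · obtain ⟨x, hx⟩ := Multiset.exists_mem_of_ne_zero hK0
        have := hle x hx
        omega
    have h0 : 1 ≤ ((Multiset.card K + c : ℕ) : ℤ) - ρ := by
      rcases Nat.eq_zero_or_pos (Multiset.card K + c) with h | h
      · have : asm K c false = 0 := by
          rw [← Multiset.card_eq_zero, asm_card]; simpa using h
        rcases hne with h' | h'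
        · exact absurd this h'
        · omega
      · have := hs1 h
        push_cast; omega
    obtain ⟨a, ha⟩ := Int.eq_ofNat_of_zero_le (show 0 ≤ ((Multiset.card K + c : ℕ) : ℤ) - ρ - 1 by omega)
    have h2 : (2 * (((Multiset.card K + c : ℕ) : ℤ) - ρ) - 1).toNat = 2 * a + 1 := by omega
    rw [h2, if_neg (by omega)]
    push_cast at ha
    have hs' : ∀ x ∈ K, x < 2 * a + 1 := by
      intro x hx
      have h3 := hle x hx
      omega
    have hs : ∀ x ∈ K, x ≤ 2 * a + 1 := fun x hx => (hs' x hx).le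
    refine ⟨⟨VV_cons (by omega) hK (fun _ => hs'), ?_, ?_, Or.inl (by simp)⟩, ?_⟩
    · rw [Multiset.sum_cons]; omega
    · rw [rk_cons hs]; omega
    · rw [fwd_cons ρ _ K hs]
      have h3 : decide (Even (2 * a + 1)) = false := by simp
      have h4 : ((((2 * a + 1 + 1) / 2 : ℕ) : ℤ) + ρ - Multiset.card K).toNat = c := by omega
      rw [h3, h4]

theorem dom_card (ρ : ℤ) (n m : ℕ) (hnm : (m : ℤ) = n + 2 * ρ + 1) :
    Nat.card (domA ρ n) = Nat.card (domB ρ m) := by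
  refine Nat.card_congr
    { toFun := fun M => ⟨fwd ρ M.1, (fwd_spec ρ n m hnm M.1 M.2).1⟩
      invFun := fun W => ⟨bwd ρ W.1, (bwd_spec ρ n m hnm W.1 W.2).1⟩
      left_inv := fun M => Subtype.ext (fwd_spec ρ n m hnm M.1 M.2).2
      right_inv := fun W => Subtype.ext (bwd_spec ρ n m hnm W.1 W.2).2 }

/-- All admissible multisets of sum `n`. -/
noncomputable def SS (n : ℕ) : Finset (Multiset ℕ) :=
  ((Finset.univ : Finset n.Partition).image (fun P => P.parts)).filter VV

lemma mem_SS (n : ℕ) (M : Multiset ℕ) : M ∈ SS n ↔ VV M ∧ M.sum = n := by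
  simp only [SS, Finset.mem_filter, Finset.mem_image, Finset.mem_univ, true_and]
  constructor
  · rintro ⟨⟨P, rfl⟩, h⟩
    exact ⟨h, P.parts_sum⟩
  · rintro ⟨h, hs⟩
    exact ⟨⟨⟨M, fun {i} hi => h.1 i hi, hs⟩, rfl⟩, h⟩

noncomputable def p2 (n : ℕ) : ℕ := (SS n).card
noncomputable def cge (n : ℕ) (r : ℤ) : ℕ := ((SS n).filter (fun M => r ≤ rk M)).card
noncomputable def cle (n : ℕ) (r : ℤ) : ℕ := ((SS n).filter (fun M => rk M ≤ r)).card
noncomputable def ceq (n : ℕ) (r : ℤ) : ℕ := ((SS n).filter (fun M => rk M = r)).card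

lemma N2_eq (r : ℤ) (m n : ℕ) :
    N2 r m n = ((SS n).filter (fun M => rk M ≡ r [ZMOD (m : ℤ)])).card := by
  rw [N2, ← Nat.card_eq_finsetCard]
  refine Nat.card_congr
    { toFun := fun P => ⟨P.1.parts, ?_⟩
      invFun := fun M => ⟨⟨M.1, fun {i} hi => ?_, ?_⟩, ?_⟩
      left_inv := fun P => ?_
      right_inv := fun M => ?_ }
  · rw [Finset.mem_filter, mem_SS]
    exact ⟨⟨⟨fun x hx => P.1.parts_pos hx, P.2.1⟩, P.1.parts_sum⟩, P.2.2⟩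
  · have := M.2
    rw [Finset.mem_filter, mem_SS] at this
    exact this.1.1.1 i hi
  · have := M.2
    rw [Finset.mem_filter, mem_SS] at this
    exact this.1.2
  · have := M.2
    rw [Finset.mem_filter, mem_SS] at this
    exact ⟨this.1.1.2, this.2⟩
  · rfl
  · rfl

lemma cge_add (n : ℕ) (r : ℤ) : cge n r + cle n (r - 1) = p2 n := by
  rw [cge, cle, p2, ← Finset.card_filter_add_card_filter_not (s := SS n) (fun M => r ≤ rk M)]
  congr 2
  apply Finset.filter_congr
  intro x _
  omega

lemma cge_ceq (n : ℕ) (r : ℤ) : cge n r = ceq n r + cge n (r + 1) := by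
  rw [cge, ceq, cge, ← Finset.card_union_of_disjoint]
  · congr 1
    ext M
    simp only [Finset.mem_filter, Finset.mem_union, ← and_or_left, and_congr_right_iff]
    intro _; omega
  · rw [Finset.disjoint_filter]; intro M _ h; omega

lemma cle_ceq (n : ℕ) (r : ℤ) : cle n r = ceq n r + cle n (r - 1) := by
  rw [cle, ceq, cle, ← Finset.card_union_of_disjoint]
  · congr 1
    ext M
    simp only [Finset.mem_filter, Finset.mem_union, ← and_or_left, and_congr_right_iff]
    intro _; omega
  · rw [Finset.disjoint_filter]; intro M _ h; omega

lemma SS_zero : SS 0 = {0} := by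
  ext M
  rw [mem_SS, Finset.mem_singleton]
  constructor
  · rintro ⟨h, hs⟩
    by_contra h0
    obtain ⟨x, hx⟩ := Multiset.exists_mem_of_ne_zero h0
    have := h.1 x hx
    have := Multiset.le_sum_of_mem hx
    omega
  · rintro rfl
    exact ⟨⟨by simp, by simp⟩, by simp⟩

lemma SS_ne {n : ℕ} (hn : 1 ≤ n) {M : Multiset ℕ} (h : M ∈ SS n) : M ≠ 0 := by
  rintro rfl
  rw [mem_SS] at h
  simp at h; omega

lemma rk_zero : rk 0 = 0 := by simp [rk]

lemma dom_card' (ρ : ℤ) (n m : ℕ) (hnm : (m : ℤ) = n + 2 * ρ + 1) :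
    ((SS n).filter (fun M => -ρ - 1 ≤ rk M ∧ (M ≠ 0 ∨ 0 ≤ ρ))).card =
    ((SS m).filter (fun M => rk M ≤ -ρ ∧ (M ≠ 0 ∨ ρ < 0))).card := by
  have := dom_card ρ n m hnm
  have hA : domA ρ n = ((SS n).filter (fun M => -ρ - 1 ≤ rk M ∧ (M ≠ 0 ∨ 0 ≤ ρ)) : Finset _) := by
    ext M; simp only [domA, Set.mem_ofPred_eq, Finset.coe_filter, mem_SS, and_assoc]
  have hB : domB ρ m = ((SS m).filter (fun M => rk M ≤ -ρ ∧ (M ≠ 0 ∨ ρ < 0)) : Finset _) := by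
    ext M; simp only [domB, Set.mem_ofPred_eq, Finset.coe_filter, mem_SS, and_assoc]
  rw [hA, hB] at this
  simpa using this

lemma cge_rec (n : ℕ) (r : ℕ) (m : ℕ) (h : n = m + 2 * r + 1) :
    cge n r + cge m (r + 2) = p2 m := by
  have h1 := dom_card' (-r - 1) n m (by omega)
  have h2 : cge n r = ((SS n).filter (fun M => -(-(r:ℤ) - 1) - 1 ≤ rk M ∧ (M ≠ 0 ∨ 0 ≤ -(r:ℤ) - 1))).card := by
    rw [cge]
    congr 1
    apply Finset.filter_congr
    intro M hM
    have := SS_ne (by omega) hM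
    simp [this]
  have h3 : cle m (r + 1) = ((SS m).filter (fun M => rk M ≤ -(-(r:ℤ) - 1) ∧ (M ≠ 0 ∨ -(r:ℤ) - 1 < 0))).card := by
    rw [cle]
    congr 1
    apply Finset.filter_congr
    intro M hM
    have h5 : -(r:ℤ) - 1 < 0 := by omega
    have h6 : -(-(r:ℤ) - 1) = r + 1 := by ring
    simp [h5, h6]
  have h4 := cge_add m (r + 2)
  have h5 : (r : ℤ) + 2 - 1 = r + 1 := by ring
  rw [h5] at h4
  omega

lemma cle_rec (n : ℕ) (r : ℕ) (m : ℕ) (h : n = m + 2 * r + 1) :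
    cle n (-r) + cle m (-(r + 2 : ℕ)) = p2 m := by
  have h1 := dom_card' r m n (by omega)
  have h2 : cle n (-r) = ((SS n).filter (fun M => rk M ≤ -(r:ℤ) ∧ (M ≠ 0 ∨ (r:ℤ) < 0))).card := by
    rw [cle]
    congr 1
    apply Finset.filter_congr
    intro M hM
    have := SS_ne (by omega) hM
    simp [this]
  have h3 : cge m (-r - 1) = ((SS m).filter (fun M => -(r:ℤ) - 1 ≤ rk M ∧ (M ≠ 0 ∨ 0 ≤ (r:ℤ)))).card := by
    rw [cge]
    congr 1
    apply Finset.filter_congr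
    intro M hM
    simp
  have h4 := cge_add m (-r - 1)
  have h5 : -(r : ℤ) - 1 - 1 = -(r + 2 : ℕ) := by push_cast; ring
  rw [h5] at h4
  omega

lemma cge_small (n : ℕ) (hn : 1 ≤ n) (r : ℕ) (h : n < 2 * r + 1) : cge n r = 0 := by
  rw [cge, Finset.card_eq_zero, Finset.filter_eq_empty_iff]
  intro M hM hr
  have h0 := SS_ne hn hM
  rw [mem_SS] at hM
  have h1 := Multiset.le_sum_of_mem (sup_mem_of_ne M h0)
  have h2 := Multiset.card_pos.2 h0
  rw [rk] at hr
  omega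

lemma cle_small (n : ℕ) (hn : 1 ≤ n) (r : ℕ) (h : n < 2 * r + 1) : cle n (-r) = 0 := by
  rw [cle, Finset.card_eq_zero, Finset.filter_eq_empty_iff]
  intro M hM hr
  have h0 := SS_ne hn hM
  rw [mem_SS] at hM
  obtain ⟨hV, hs⟩ := hM
  have h1 := hV.1 _ (sup_mem_of_ne M h0)
  rw [rk] at hr
  obtain ⟨K, c, e, hK, h3⟩ := asm_surj M hV
  have h4 := asm_sum K c e
  have h5 := asm_card K c e
  rw [← h3] at h4 h5
  cases e <;> simp at h4 h5 <;> omega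

lemma c_zero (r : ℕ) : cge 0 (r + 2) = 0 ∧ cle 0 (-(r + 2 : ℕ)) = 0 := by
  constructor
  · rw [cge, SS_zero, Finset.card_eq_zero, Finset.filter_eq_empty_iff]
    intro M hM
    rw [Finset.mem_singleton.1 hM, rk_zero]; omega
  · rw [cle, SS_zero, Finset.card_eq_zero, Finset.filter_eq_empty_iff]
    intro M hM
    rw [Finset.mem_singleton.1 hM, rk_zero]; push_cast; omega

lemma c_symm (n : ℕ) : ∀ (_ : 1 ≤ n) (r : ℕ), cge n r = cle n (-r) := by
  induction n using Nat.strong_induction_on with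
  | _ n ih =>
    intro hn r
    by_cases h : n < 2 * r + 1
    · rw [cge_small n hn r h, cle_small n hn r h]
    · obtain ⟨m, hm⟩ : ∃ m, n = m + 2 * r + 1 := ⟨n - (2 * r + 1), by omega⟩
      have h1 := cge_rec n r m hm
      have h2 := cle_rec n r m hm
      rcases Nat.eq_zero_or_pos m with h0 | h0
      · subst h0
        have := c_zero r
        omega
      · have h3 := ih m (by omega) h0 (r + 2)
        push_cast at h2 h3
        omega

lemma p2_eq (n : ℕ) (hn : 1 ≤ n) : p2 n = cge n (0 : ℕ) + cge n (1 : ℕ) := by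
  have h1 := cge_add n (0 : ℕ)
  have h2 := c_symm n hn 1
  have h3 : ((0 : ℕ) : ℤ) - 1 = -(1 : ℕ) := by norm_num
  rw [h3] at h1
  omega

lemma ceq_symm (n : ℕ) (hn : 1 ≤ n) (r : ℕ) : ceq n (-r) = ceq n r := by
  have h1 := cge_ceq n r
  have h2 := cle_ceq n (-r)
  have h3 := c_symm n hn r
  have h4 := c_symm n hn (r + 1)
  have h5 : -(r : ℤ) - 1 = -(r + 1 : ℕ) := by push_cast; ring
  rw [h5] at h2
  push_cast at h4 h2 ⊢
  omega

lemma rk_bound (n : ℕ) (M : Multiset ℕ) (hM : M ∈ SS n) : -(n : ℤ) ≤ rk M ∧ rk M ≤ n := by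
  rw [mem_SS] at hM
  by_cases h0 : M = 0
  · subst h0; rw [rk_zero]; omega
  · have h1 := Multiset.le_sum_of_mem (sup_mem_of_ne M h0)
    have h2 : Multiset.card M ≤ M.sum := by
      have := Multiset.card_nsmul_le_sum (s := M) (a := 1) (fun x hx => hM.1.1 x hx)
      simpa using this
    rw [rk]; omega

lemma N2_sum (n : ℕ) (hn : 1 ≤ n) (ρ : ℕ) (hρ : ρ ≤ 8) :
    N2 ρ 9 n = ∑ j ∈ Finset.range (n + 1), (ceq n (ρ + 9 * j : ℕ) + ceq n (9 - ρ + 9 * j : ℕ)) := by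
  rw [N2_eq]
  have h1 : ∀ j : ℕ, ceq n (9 - ρ + 9 * j : ℕ) = ceq n (-(9 - ρ + 9 * j : ℕ)) := fun j =>
    (ceq_symm n hn _).symm
  simp only [h1]
  rw [Finset.sum_add_distrib]
  have h2 : ∀ f : ℕ → ℤ, Function.Injective f → ∑ j ∈ Finset.range (n + 1), ceq n (f j) =
      ((SS n).filter (fun M => ∃ j ∈ Finset.range (n + 1), rk M = f j)).card := by
    intro f hf
    simp only [ceq]
    rw [← Finset.card_biUnion]
    · congr 1
      ext M
      simp only [Finset.mem_biUnion, Finset.mem_filter]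
      constructor
      · rintro ⟨j, hj, hM, h⟩; exact ⟨hM, j, hj, h⟩
      · rintro ⟨hM, j, hj, h⟩; exact ⟨j, hj, hM, h⟩
    · intro i _ j _ hij
      show Disjoint (Finset.filter _ _) (Finset.filter _ _)
      rw [Finset.disjoint_filter]
      intro M _ h3 h4
      exact hij (hf (h3.symm.trans h4))
  rw [h2 (fun j => ((ρ + 9 * j : ℕ) : ℤ)) (fun a b h => by simp only at h; omega),
    h2 (fun j => (-(9 - ρ + 9 * j : ℕ) : ℤ)) (fun a b h => by simp only at h; omega),
    ← Finset.card_union_of_disjoint]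
  · congr 1
    ext M
    simp only [Finset.mem_filter, Finset.mem_union, ← and_or_left, and_congr_right_iff]
    intro hM
    have hb := rk_bound n M hM
    constructor
    · intro h
      have h3 : rk M % 9 = ρ % 9 := h
      by_cases h4 : 0 ≤ rk M
      · left
        refine ⟨((rk M - ρ) / 9).toNat, ?_, ?_⟩
        · rw [Finset.mem_range]; omega
        · omega
      · right
        refine ⟨((-rk M - (9 - ρ)) / 9).toNat, ?_, ?_⟩
        · rw [Finset.mem_range]; omega
        · omega
    · rintro (⟨j, _, h⟩ | ⟨j, _, h⟩)
      · show rk M % 9 = ρ % 9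
        omega
      · show rk M % 9 = ρ % 9
        omega
  · rw [Finset.disjoint_left]
    intro M hM hM'
    simp only [Finset.mem_filter] at hM hM'
    obtain ⟨_, i, _, h3⟩ := hM
    obtain ⟨_, j, _, h4⟩ := hM'
    omega

/-- exponents -/
def ex (k r : ℕ) : ℕ := 2 * k ^ 2 + 3 * k + 1 + 2 * r * k + 2 * r

lemma ex_zero (r : ℕ) : ex 0 r = 2 * r + 1 := by simp [ex]; ring
lemma ex_succ (k r : ℕ) : ex (k + 1) r = ex k (r + 2) + (2 * r + 1) := by simp only [ex]; ring
lemma ex_gt (k r : ℕ) : k < ex k r := by simp only [ex]; nlinarith [sq_nonneg k]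
lemma ex_ge (k r : ℕ) : 2 * r + 1 ≤ ex k r := by
  simp only [ex]; have := Nat.zero_le (2 * k ^ 2 + 3 * k); have := Nat.zero_le (2 * r * k); omega

noncomputable def Th (r : ℕ) : PowerSeries ℤ :=
  PowerSeries.mk fun n => ∑ k ∈ Finset.range n, if ex k r = n then (-1) ^ k else 0

lemma Th_coeff (r n K : ℕ) (h : n ≤ K) :
    PowerSeries.coeff n (Th r) = ∑ k ∈ Finset.range K, if ex k r = n then (-1 : ℤ) ^ k else 0 := by
  rw [Th, PowerSeries.coeff_mk]
  apply Finset.sum_subset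
  · intro x hx; simp at hx ⊢; omega
  · intro x _ hx
    simp at hx
    have := ex_gt x r
    rw [if_neg (by omega)]

lemma Th_coeff_small (r n : ℕ) (h : n < 2 * r + 1) : PowerSeries.coeff n (Th r) = 0 := by
  rw [Th, PowerSeries.coeff_mk]
  apply Finset.sum_eq_zero
  intro k _
  have := ex_ge k r
  rw [if_neg (by omega)]

lemma Th_rec (r : ℕ) : Th r = PowerSeries.X ^ (2 * r + 1) * (1 - Th (r + 2)) := by
  ext n
  rw [PowerSeries.coeff_X_pow_mul']
  split_ifs with h
  · obtain ⟨m, rfl⟩ : ∃ m, n = m + (2 * r + 1) := ⟨n - (2 * r + 1), by omega⟩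
    rw [Nat.add_sub_cancel, map_sub, Th_coeff r _ (m + 2 * r + 1) (by omega),
      Th_coeff (r + 2) m (m + 2 * r) (by omega), Finset.sum_range_succ', PowerSeries.coeff_one]
    simp only [ex_succ, ex_zero, pow_zero, Nat.add_right_cancel_iff]
    have : (2 * r + 1 = m + (2 * r + 1)) ↔ m = 0 := by omega
    simp only [this, pow_succ, mul_neg, mul_one]
    rw [sub_eq_add_neg, ← Finset.sum_neg_distrib, add_comm]
    congr 1
    apply Finset.sum_congr rfl
    intro k _
    split_ifs <;> simp
  · exact Th_coeff_small r n (by omega)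

noncomputable def PP : PowerSeries ℤ := PowerSeries.mk fun n => (p2 n : ℤ)
noncomputable def Gt (r : ℕ) : PowerSeries ℤ :=
  PowerSeries.mk fun n => if n = 0 then 0 else (cge n r : ℤ)

lemma Gt_rec (r : ℕ) : Gt r = PowerSeries.X ^ (2 * r + 1) * (PP - Gt (r + 2)) := by
  ext n
  rw [PowerSeries.coeff_X_pow_mul']
  split_ifs with h
  · obtain ⟨m, rfl⟩ : ∃ m, n = m + (2 * r + 1) := ⟨n - (2 * r + 1), by omega⟩
    rw [Nat.add_sub_cancel, map_sub, Gt, Gt, PP, PowerSeries.coeff_mk, PowerSeries.coeff_mk,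
      PowerSeries.coeff_mk, if_neg (by omega)]
    have h1 := cge_rec (m + (2 * r + 1)) r m (by ring)
    split_ifs with h0
    · subst h0
      rw [(c_zero r).1] at h1
      rw [← h1]; simp
    · rw [← h1]; push_cast; ring
  · rw [Gt, PowerSeries.coeff_mk]
    split_ifs with h0
    · rfl
    · rw [cge_small n (by omega) r (by omega)]; rfl

lemma Gt_eq (r : ℕ) : Gt r = PP * Th r := by
  have key : ∀ n r, PowerSeries.coeff n (Gt r - PP * Th r) = 0 := by
    intro n
    induction n using Nat.strong_induction_on with
    | _ n ih =>
      intro r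
      have h1 : Gt r - PP * Th r =
          PowerSeries.X ^ (2 * r + 1) * (-(Gt (r + 2) - PP * Th (r + 2))) := by
        conv_lhs => rw [Gt_rec r, Th_rec r]
        ring
      rw [h1, PowerSeries.coeff_X_pow_mul']
      split_ifs with h
      · rw [map_neg, ih (n - (2 * r + 1)) (by omega), neg_zero]
      · rfl
  rw [← sub_eq_zero]
  ext n
  rw [key]; simp

lemma p2_zero : p2 0 = 1 := by rw [p2, SS_zero]; rfl

lemma PP_psi : PP * (1 - Th 0 - Th 1) = 1 := by
  have h : PP = 1 + Gt 0 + Gt 1 := by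
    ext n
    rw [map_add, map_add, PP, Gt, Gt, PowerSeries.coeff_mk, PowerSeries.coeff_mk,
      PowerSeries.coeff_mk, PowerSeries.coeff_one]
    by_cases h0 : n = 0
    · subst h0; simp [p2_zero]
    · simp only [h0, if_false, zero_add]
      rw [p2_eq n (by omega)]; push_cast; rfl
  rw [Gt_eq, Gt_eq] at h
  linear_combination h

noncomputable def UU (a : ℕ) : PowerSeries ℤ :=
  PowerSeries.mk fun n => ∑ j ∈ Finset.range (n + 1), PowerSeries.coeff n (Th (a + 9 * j))

lemma UU_coeff (a n J : ℕ) (h : n + 1 ≤ J) :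
    PowerSeries.coeff n (UU a) = ∑ j ∈ Finset.range J, PowerSeries.coeff n (Th (a + 9 * j)) := by
  rw [UU, PowerSeries.coeff_mk]
  apply Finset.sum_subset
  · intro x hx; simp at hx ⊢; omega
  · intro x _ hx
    simp at hx
    apply Th_coeff_small
    omega

lemma PP_UU (a n : ℕ) : PowerSeries.coeff n (PP * UU a) =
    ∑ j ∈ Finset.range (n + 1), PowerSeries.coeff n (Gt (a + 9 * j)) := by
  simp only [Gt_eq, PowerSeries.coeff_mul]
  rw [Finset.sum_comm]
  apply Finset.sum_congr rfl
  intro x hx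
  rw [UU_coeff a x.2 (n + 1) (by have := Finset.HasAntidiagonal.mem_antidiagonal.1 hx; omega), Finset.mul_sum]

noncomputable def LL (ρ σ : ℕ) : PowerSeries ℤ :=
  (UU ρ - UU (ρ + 1) + UU (9 - ρ) - UU (10 - ρ)) - (UU σ - UU (σ + 1) + UU (9 - σ) - UU (10 - σ))

lemma N2_coeff (n : ℕ) (hn : 1 ≤ n) (ρ : ℕ) (hρ : ρ ≤ 8) :
    (N2 ρ 9 n : ℤ) = PowerSeries.coeff n (PP * (UU ρ - UU (ρ + 1) + UU (9 - ρ) - UU (10 - ρ))) := by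
  rw [mul_sub, mul_add, mul_sub, map_sub, map_add, map_sub, PP_UU, PP_UU, PP_UU, PP_UU,
    N2_sum n hn ρ hρ, ← Finset.sum_sub_distrib, ← Finset.sum_add_distrib, ← Finset.sum_sub_distrib]
  push_cast
  apply Finset.sum_congr rfl
  intro j _
  simp only [Gt, PowerSeries.coeff_mk, if_neg (show n ≠ 0 by omega)]
  have h1 := cge_ceq n (ρ + 9 * j : ℕ)
  have h2 := cge_ceq n (9 - ρ + 9 * j : ℕ)
  have e1 : ((ρ + 9 * j : ℕ) : ℤ) + 1 = (ρ + 1 + 9 * j : ℕ) := by push_cast; ring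
  have e2 : ((9 - ρ + 9 * j : ℕ) : ℤ) + 1 = (10 - ρ + 9 * j : ℕ) := by omega
  rw [e1] at h1
  rw [e2] at h2
  rw [h1, h2]; push_cast; ring

lemma N2_diff (n : ℕ) (hn : 1 ≤ n) (ρ σ : ℕ) (hρ : ρ ≤ 8) (hσ : σ ≤ 8) :
    (N2 ρ 9 n : ℤ) - N2 σ 9 n = PowerSeries.coeff n (PP * LL ρ σ) := by
  rw [N2_coeff n hn ρ hρ, N2_coeff n hn σ hσ, LL, ← map_sub, ← mul_sub]

/-- force evaluation of a natural number before continuing -/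
def forceN {α : Type} (n : ℕ) (f : ℕ → α) : α :=
  match n with
  | 0 => f 0
  | m + 1 => f (m + 1)

lemma forceN_eq {α : Type} (n : ℕ) (f : ℕ → α) : forceN n f = f n := by cases n <;> rfl

def mskN (B N : ℕ) : ℕ := 1 <<< (B * N) - 1
def negN (B N z : ℕ) : ℕ := mskN B N - (z &&& mskN B N) + 1
def shN (B N g e : ℕ) : ℕ := bif Nat.blt e N then g <<< (e * B) else 0
def geoN (s : ℕ) : ℕ → ℕ
  | 0 => 1
  | i + 1 => forceN (geoN s i) fun g => g + g <<< (s * 2 ^ i)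
def smN (f : ℕ → ℕ) : ℕ → ℕ
  | 0 => 0
  | K + 1 => smN f K + f K
def sgN (B N k z : ℕ) : ℕ := bif Nat.beq (k % 2) 0 then z else negN B N z
def psiN (B N K : ℕ) : ℕ :=
  (1 + negN B N (smN (fun k => sgN B N k (shN B N 1 (ex k 0) + shN B N 1 (ex k 1))) K)) &&& mskN B N
def LtN (B N ρ σ k : ℕ) : ℕ :=
  forceN (geoN (18 * (k + 1) * B) (Nat.log2 (N / (18 * (k + 1))) + 1)) fun g =>
    sgN B N k ((shN B N g (ex k ρ) + shN B N g (ex k (9 - ρ)) + shN B N g (ex k (σ + 1)) +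
      shN B N g (ex k (10 - σ))) + negN B N (shN B N g (ex k (ρ + 1)) + shN B N g (ex k (10 - ρ)) +
      shN B N g (ex k σ) + shN B N g (ex k (9 - σ))))
def LN (B N K ρ σ : ℕ) : ℕ := smN (LtN B N ρ σ) K &&& mskN B N
/-- Newton inverse modulo powers of two -/
def newtN (psi B N : ℕ) : ℕ → ℕ
  | 0 => 1
  | i + 1 => forceN (newtN psi B N i) fun v => forceN (mskN B (min (2 ^ (i + 1)) N)) fun M =>
      (v * (M + 3 - (((psi &&& M) * v) &&& M))) &&& M
/-- digit check; `O` is the geometric sum -/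
def digN (B N g X : ℕ) : Bool :=
  forceN (geoN B g) fun O => forceN (geoN B 2 + (geoN B 5) <<< (4 * B)) fun lo =>
  forceN ((X + lo + negN B N (O - lo)) &&& mskN B N) fun W =>
    Nat.beq (W &&& (((1 <<< 36 - 1) <<< (B - 36)) * O)) 0 &&
    Nat.beq ((W + (O - lo)) &&& mskN B N) ((X + lo) &&& mskN B N)
/-- spreading digits from a small base to a large base; T is the total number of levels -/
def sprN (B' B T : ℕ) : ℕ → ℕ → ℕ
  | 0, x => x
  | h + 1, x => forceN x fun x => forceN (x &&& ((1 <<< (2 ^ h * B') - 1) * geoN (2 ^ (h + 1) * B) (T - (h + 1)))) fun lo =>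
      sprN B' B T h (lo + (x - lo) <<< (2 ^ h * (B - B')))
def bigN (B' B N T x : ℕ) : ℕ :=
  (sprN B' B T T ((x + 1 <<< (B' - 1) * geoN B' T) &&& mskN B' N)
    + negN B N (1 <<< (B' - 1) * geoN B T)) &&& mskN B N
def chkN (B' B N K T ρ σ : ℕ) : Bool :=
  forceN (bigN B' B N T (psiN B' N K)) fun psi => forceN (newtN psi B N T) fun v =>
  forceN (bigN B' B N T (LN B' N K ρ σ)) fun L => forceN ((L * v) &&& mskN B N) fun X =>
    Nat.beq ((X * psi) &&& mskN B N) L && digN B N T X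

noncomputable def evN (b : ℤ) (N : ℕ) (f : PowerSeries ℤ) : ℤ :=
  ∑ n ∈ Finset.range N, PowerSeries.coeff n f * b ^ n

lemma evN_congr (b : ℤ) (N : ℕ) (f g : PowerSeries ℤ)
    (h : ∀ n < N, PowerSeries.coeff n f = PowerSeries.coeff n g) : evN b N f = evN b N g := by
  rw [evN, evN]
  exact Finset.sum_congr rfl (fun n hn => by rw [h n (Finset.mem_range.1 hn)])

lemma evN_add (b : ℤ) (N : ℕ) (f g : PowerSeries ℤ) : evN b N (f + g) = evN b N f + evN b N g := by
  simp only [evN, map_add, add_mul, Finset.sum_add_distrib]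

lemma evN_neg (b : ℤ) (N : ℕ) (f : PowerSeries ℤ) : evN b N (-f) = -evN b N f := by
  simp only [evN, map_neg, neg_mul, Finset.sum_neg_distrib]

lemma evN_sub (b : ℤ) (N : ℕ) (f g : PowerSeries ℤ) : evN b N (f - g) = evN b N f - evN b N g := by
  simp only [evN, map_sub, sub_mul, Finset.sum_sub_distrib]

lemma evN_poly (b : ℤ) (N : ℕ) (p : Polynomial ℤ) :
    evN b N (p : PowerSeries ℤ) ≡ p.eval b [ZMOD b ^ N] := by
  rw [evN, Polynomial.eval_eq_sum_range' (n := N + (p.natDegree + 1)) (by omega),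
    Finset.sum_range_add]
  simp only [Polynomial.coeff_coe]
  rw [Int.modEq_iff_dvd]
  rw [add_sub_cancel_left]
  apply Finset.dvd_sum
  intro i _
  exact Dvd.dvd.mul_left (pow_dvd_pow b (by omega)) _

lemma evN_mul (b : ℤ) (N : ℕ) (f g : PowerSeries ℤ) :
    evN b N (f * g) ≡ evN b N f * evN b N g [ZMOD b ^ N] := by
  have h1 : ∀ f : PowerSeries ℤ, evN b N f = (PowerSeries.trunc N f).eval b := by
    intro f
    rw [Polynomial.eval, PowerSeries.eval₂_trunc_eq_sum_range, evN]; rfl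
  have h2 : evN b N (f * g) = evN b N (((PowerSeries.trunc N f) * (PowerSeries.trunc N g) : Polynomial ℤ) : PowerSeries ℤ) := by
    apply evN_congr
    intro n hn
    rw [PowerSeries.coeff_mul_eq_coeff_trunc_mul_trunc f g hn]
    simp
  rw [h2, h1 f, h1 g, ← Polynomial.eval_mul]
  exact evN_poly _ _ _

lemma digit_zero (b : ℤ) (hb : 0 < b) : ∀ (N : ℕ) (h : ℕ → ℤ), (∀ i < N, |h i| < b) →
    (b ^ N ∣ ∑ i ∈ Finset.range N, h i * b ^ i) → ∀ i < N, h i = 0 := by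
  intro N
  induction N with
  | zero => intro h _ _ i hi; omega
  | succ N ih =>
    intro h hh hd
    rw [Finset.sum_range_succ'] at hd
    have h1 : ∑ k ∈ Finset.range N, h (k + 1) * b ^ (k + 1) = b * ∑ k ∈ Finset.range N, h (k + 1) * b ^ k := by
      rw [Finset.mul_sum]; apply Finset.sum_congr rfl; intros; ring
    rw [h1, pow_zero, mul_one] at hd
    have h2 : b ∣ h 0 := by
      have : b ∣ b * ∑ k ∈ Finset.range N, h (k + 1) * b ^ k + h 0 :=
        dvd_trans (dvd_pow_self b (by omega)) hd
      exact (dvd_add_right (dvd_mul_right _ _)).1 this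
    have h3 : h 0 = 0 := Int.eq_zero_of_abs_lt_dvd h2 (hh 0 (by omega))
    rw [h3, add_zero, pow_succ'] at hd
    have h4 := ih (fun i => h (i + 1)) (fun i hi => hh _ (by omega)) (Int.dvd_of_mul_dvd_mul_left (ne_of_gt hb) hd)
    intro i hi
    cases i with
    | zero => exact h3
    | succ i => exact h4 i (by omega)

def RR (B N : ℕ) (f : PowerSeries ℤ) (z : ℕ) : Prop := evN (2 ^ B) N f ≡ (z : ℤ) [ZMOD (2 ^ B) ^ N]

lemma mskN_eq (B N : ℕ) : mskN B N = 2 ^ (B * N) - 1 := by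
  rw [mskN, Nat.shiftLeft_eq, one_mul]

lemma and_msk (B N z : ℕ) : z &&& mskN B N = z % 2 ^ (B * N) := by
  rw [mskN_eq, Nat.and_two_pow_sub_one_eq_mod]

lemma RR_msk (B N : ℕ) (f : PowerSeries ℤ) (z : ℕ) : RR B N f (z &&& mskN B N) ↔ RR B N f z := by
  rw [and_msk, RR, RR]
  have : ((z % 2 ^ (B * N) : ℕ) : ℤ) ≡ z [ZMOD (2 ^ B) ^ N] := by
    push_cast
    rw [← pow_mul]
    exact Int.mod_modEq _ _
  exact ⟨fun h => h.trans this, fun h => h.trans this.symm⟩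

lemma RR_add {B N : ℕ} {f g : PowerSeries ℤ} {z w : ℕ} (h1 : RR B N f z) (h2 : RR B N g w) :
    RR B N (f + g) (z + w) := by
  rw [RR, evN_add]; push_cast; exact Int.ModEq.add h1 h2

lemma RR_mul {B N : ℕ} {f g : PowerSeries ℤ} {z w : ℕ} (h1 : RR B N f z) (h2 : RR B N g w) :
    RR B N (f * g) (z * w) := by
  rw [RR]; push_cast; exact (evN_mul _ _ _ _).trans (Int.ModEq.mul h1 h2)

lemma negN_cast (B N z : ℕ) : ((negN B N z : ℕ) : ℤ) ≡ -z [ZMOD (2 ^ B) ^ N] := by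
  have h1 : z % 2 ^ (B * N) < 2 ^ (B * N) := Nat.mod_lt _ (by positivity)
  have h3 : (((2 : ℕ) ^ (B * N) : ℕ) : ℤ) = (2 ^ B) ^ N := by push_cast; rw [pow_mul]
  have h2 : ((negN B N z : ℕ) : ℤ) = (2 ^ B) ^ N - ((z % 2 ^ (B * N) : ℕ) : ℤ) := by
    rw [negN, and_msk, mskN_eq, ← h3]
    omega
  have : ((z % 2 ^ (B * N) : ℕ) : ℤ) ≡ z [ZMOD (2 ^ B) ^ N] := by
    rw [← h3]; push_cast
    exact Int.mod_modEq _ _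
  rw [h2]
  have h4 : ((2 : ℤ) ^ B) ^ N ≡ 0 [ZMOD (2 ^ B) ^ N] := by simp [Int.ModEq]
  simpa using h4.sub this

lemma RR_neg {B N : ℕ} {f : PowerSeries ℤ} {z : ℕ} (h1 : RR B N f z) :
    RR B N (-f) (negN B N z) := by
  rw [RR, evN_neg]; exact (Int.ModEq.neg h1).trans (negN_cast _ _ _).symm

lemma RR_X_pow (B N e : ℕ) : RR B N (PowerSeries.X ^ e) (shN B N 1 e) := by
  rw [RR, evN, shN]
  simp only [PowerSeries.coeff_X_pow, ite_mul, one_mul, zero_mul, Finset.sum_ite_eq', Finset.mem_range]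
  by_cases h : e < N
  · have : Nat.blt e N = true := by simpa [Nat.blt_eq] using h
    rw [if_pos h, this, cond_true, Nat.shiftLeft_eq]
    push_cast
    rw [one_mul, show (2 : ℤ) ^ (e * B) = (2 ^ B) ^ e by rw [← pow_mul, mul_comm]]
  · have : Nat.blt e N = false := by
      rw [Bool.eq_false_iff]; simpa [Nat.blt_eq] using h
    rw [if_neg h, this]; rfl

lemma shN_mul (B N g e : ℕ) : shN B N g e = shN B N 1 e * g := by
  rw [shN, shN]
  cases Nat.blt e N
  · simp
  · simp [Nat.shiftLeft_eq, mul_comm]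

lemma RR_sh {B N : ℕ} {f : PowerSeries ℤ} {z : ℕ} (e : ℕ) (h : RR B N f z) :
    RR B N (PowerSeries.X ^ e * f) (shN B N z e) := by
  rw [shN_mul]; exact RR_mul (RR_X_pow _ _ _) h

lemma RR_sg {B N : ℕ} {f : PowerSeries ℤ} {z : ℕ} (k : ℕ) (h : RR B N f z) :
    RR B N ((-1) ^ k * f) (sgN B N k z) := by
  rw [sgN]
  rcases Nat.even_or_odd k with hk | hk
  · have : Nat.beq (k % 2) 0 = true := by rw [Nat.even_iff.1 hk]; rfl
    rw [this, cond_true, hk.neg_one_pow, one_mul]; exact h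
  · have : Nat.beq (k % 2) 0 = false := by rw [Nat.odd_iff.1 hk]; rfl
    rw [this, cond_false, hk.neg_one_pow, neg_one_mul]; exact RR_neg h

lemma RR_sm {B N : ℕ} {f : ℕ → PowerSeries ℤ} {z : ℕ → ℕ} (h : ∀ k, RR B N (f k) (z k)) (K : ℕ) :
    RR B N (∑ k ∈ Finset.range K, f k) (smN z K) := by
  induction K with
  | zero => simp [RR, evN, smN]
  | succ K ih => rw [Finset.sum_range_succ, smN]; exact RR_add ih (h K)

lemma geoN_eq (s i : ℕ) : geoN s i = ∑ j ∈ Finset.range (2 ^ i), 2 ^ (s * j) := by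
  induction i with
  | zero => simp [geoN]
  | succ i ih =>
    rw [geoN, forceN_eq, ih, pow_succ, mul_two, Finset.sum_range_add, Nat.shiftLeft_eq, Finset.sum_mul]
    congr 1
    apply Finset.sum_congr rfl
    intro j _
    rw [← pow_add]; ring_nf

lemma RR_X_pow' (B N e : ℕ) : RR B N (PowerSeries.X ^ e) (2 ^ (B * e)) := by
  have h := evN_poly (2 ^ B) N (Polynomial.X ^ e)
  rw [RR]
  simp only [Polynomial.coe_pow, Polynomial.coe_X, Polynomial.eval_pow, Polynomial.eval_X] at h
  push_cast
  rw [pow_mul]; exact h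

lemma RR_sum {B N : ℕ} {f : ℕ → PowerSeries ℤ} {z : ℕ → ℕ} (h : ∀ k, RR B N (f k) (z k)) (K : ℕ) :
    RR B N (∑ k ∈ Finset.range K, f k) (∑ k ∈ Finset.range K, z k) := by
  induction K with
  | zero => simp [RR, evN]
  | succ K ih => rw [Finset.sum_range_succ, Finset.sum_range_succ]; exact RR_add ih (h K)

lemma RR_geo (B N s i : ℕ) :
    RR B N (∑ j ∈ Finset.range (2 ^ i), PowerSeries.X ^ (s * j)) (geoN (s * B) i) := by
  rw [geoN_eq]
  apply RR_sum
  intro j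
  have := RR_X_pow' B N (s * j)
  rwa [show B * (s * j) = s * B * j by ring] at this

lemma RR_congr {B N : ℕ} {f g : PowerSeries ℤ} {z : ℕ} (h : RR B N f z)
    (hfg : ∀ n < N, PowerSeries.coeff n f = PowerSeries.coeff n g) : RR B N g z := by
  rw [RR, ← evN_congr _ _ f g hfg]; exact h

lemma RR_one (B N : ℕ) : RR B N 1 1 := by
  simpa using RR_X_pow' B N 0

/-- finite form of `UU a` -/
lemma UU_fin (a N K : ℕ) (J : ℕ → ℕ) (hK : N ≤ 2 * K ^ 2) (hJ : ∀ k, N ≤ 18 * (k + 1) * J k) (n : ℕ) (hn : n < N) :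
    PowerSeries.coeff n (UU a) = PowerSeries.coeff n (∑ k ∈ Finset.range K,
      (-1) ^ k * (PowerSeries.X ^ (ex k a) * ∑ j ∈ Finset.range (J k), PowerSeries.X ^ (18 * (k + 1) * j)) : PowerSeries ℤ) := by
  have hex : ∀ k j, ex k a + 18 * (k + 1) * j = ex k (a + 9 * j) := by intro k j; simp only [ex]; ring
  have h1 : PowerSeries.coeff n (∑ k ∈ Finset.range K,
      (-1) ^ k * (PowerSeries.X ^ (ex k a) * ∑ j ∈ Finset.range (J k), PowerSeries.X ^ (18 * (k + 1) * j)) : PowerSeries ℤ)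
      = ∑ k ∈ Finset.range K, ∑ j ∈ Finset.range (J k), if ex k (a + 9 * j) = n then (-1 : ℤ) ^ k else 0 := by
    rw [map_sum]
    apply Finset.sum_congr rfl
    intro k _
    rw [Finset.mul_sum, Finset.mul_sum, map_sum]
    apply Finset.sum_congr rfl
    intro j _
    rw [← pow_add, hex]
    have : ((-1) ^ k : PowerSeries ℤ) = PowerSeries.C ((-1 : ℤ) ^ k) := by simp
    rw [this, PowerSeries.coeff_C_mul, PowerSeries.coeff_X_pow]
    by_cases h : ex k (a + 9 * j) = n
    · simp [h]
    · simp [h, Ne.symm h]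
  rw [h1, UU_coeff a n N (by omega)]
  have h2 : ∀ j, PowerSeries.coeff n (Th (a + 9 * j)) = ∑ k ∈ Finset.range N, if ex k (a + 9 * j) = n then (-1 : ℤ) ^ k else 0 :=
    fun j => Th_coeff _ n N hn.le
  simp only [h2]
  rw [Finset.sum_comm]
  -- both equal to the sum over max ranges
  have h3 : ∀ k, ∀ J1 J2 : ℕ, N ≤ 18 * (k + 1) * J1 → J1 ≤ J2 →
      ∑ j ∈ Finset.range J1, (if ex k (a + 9 * j) = n then (-1 : ℤ) ^ k else 0) =
      ∑ j ∈ Finset.range J2, if ex k (a + 9 * j) = n then (-1 : ℤ) ^ k else 0 := by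
    intro k J1 J2 hJ1 hJ2
    apply Finset.sum_subset
    · intro x hx; simp at hx ⊢; omega
    · intro j _ hj
      simp at hj
      have e1 := hex k j
      have e2 : 18 * (k + 1) * J1 ≤ 18 * (k + 1) * j := Nat.mul_le_mul_left _ hj
      rw [if_neg (by omega)]
  have h4 : ∀ k, ∑ j ∈ Finset.range (J k), (if ex k (a + 9 * j) = n then (-1 : ℤ) ^ k else 0) =
      ∑ j ∈ Finset.range N, if ex k (a + 9 * j) = n then (-1 : ℤ) ^ k else 0 := by
    intro k
    rw [h3 k (J k) (max (J k) N) (hJ k) (le_max_left _ _),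
      h3 k N (max (J k) N) (by nlinarith [Nat.zero_le (k * N)]) (le_max_right _ _)]
  simp only [h4]
  have h5 : ∀ K1 K2 : ℕ, N ≤ 2 * K1 ^ 2 → K1 ≤ K2 →
      ∑ k ∈ Finset.range K1, ∑ j ∈ Finset.range N, (if ex k (a + 9 * j) = n then (-1 : ℤ) ^ k else 0) =
      ∑ k ∈ Finset.range K2, ∑ j ∈ Finset.range N, (if ex k (a + 9 * j) = n then (-1 : ℤ) ^ k else 0) := by
    intro K1 K2 h1 h2
    apply Finset.sum_subset
    · intro x hx; simp at hx ⊢; omega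
    · intro k _ hk
      simp at hk
      apply Finset.sum_eq_zero
      intro j _
      have e1 : K1 ^ 2 ≤ k ^ 2 := Nat.pow_le_pow_left hk 2
      have e2 : 2 * k ^ 2 ≤ ex k (a + 9 * j) := by simp only [ex]; omega
      have e3 : ex k (a + 9 * j) ≠ n := by
        intro h6; omega
      rw [if_neg e3]
  rw [h5 K (max K N) hK (le_max_left _ _), h5 N (max K N) (by nlinarith) (le_max_right _ _)]

lemma Th_fin (r N K : ℕ) (hK : N ≤ 2 * K ^ 2) (n : ℕ) (hn : n < N) :
    PowerSeries.coeff n (Th r) = PowerSeries.coeff n (∑ k ∈ Finset.range K,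
      (-1) ^ k * PowerSeries.X ^ (ex k r) : PowerSeries ℤ) := by
  have h1 : PowerSeries.coeff n (∑ k ∈ Finset.range K, (-1) ^ k * PowerSeries.X ^ (ex k r) : PowerSeries ℤ)
      = ∑ k ∈ Finset.range K, if ex k r = n then (-1 : ℤ) ^ k else 0 := by
    rw [map_sum]
    apply Finset.sum_congr rfl
    intro k _
    have : ((-1) ^ k : PowerSeries ℤ) = PowerSeries.C ((-1 : ℤ) ^ k) := by simp
    rw [this, PowerSeries.coeff_C_mul, PowerSeries.coeff_X_pow]
    by_cases h : ex k r = n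
    · simp [h]
    · simp [h, Ne.symm h]
  rw [h1, Th_coeff r n (max K n) (le_max_right _ _)]
  symm
  apply Finset.sum_subset
  · intro x hx; simp at hx ⊢; omega
  · intro k _ hk
    simp at hk
    have e1 : K ^ 2 ≤ k ^ 2 := Nat.pow_le_pow_left hk 2
    have e2 : 2 * k ^ 2 ≤ ex k r := by simp only [ex]; omega
    have e3 : ex k r ≠ n := by intro h6; omega
    rw [if_neg e3]

lemma psiN_RR (B N K : ℕ) (hK : N ≤ 2 * K ^ 2) : RR B N (1 - Th 0 - Th 1) (psiN B N K) := by
  rw [psiN, RR_msk]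
  have h := RR_add (RR_one B N) (RR_neg (RR_sm (fun k => RR_sg k (RR_add (RR_X_pow B N (ex k 0)) (RR_X_pow B N (ex k 1)))) K))
  refine RR_congr h ?_
  intro n hn
  simp only [map_add, map_neg, map_sub, Th_fin _ N K hK n hn, mul_add, Finset.sum_add_distrib]
  ring

lemma LN_RR (B N K ρ σ : ℕ) (hK : N ≤ 2 * K ^ 2) : RR B N (LL ρ σ) (LN B N K ρ σ) := by
  rw [LN, RR_msk]
  have key : ∀ k, RR B N ((-1) ^ k *
      (((PowerSeries.X ^ (ex k ρ) * ∑ j ∈ Finset.range (2 ^ (Nat.log2 (N / (18 * (k + 1))) + 1)), PowerSeries.X ^ (18 * (k + 1) * j))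
      + (PowerSeries.X ^ (ex k (9 - ρ)) * ∑ j ∈ Finset.range (2 ^ (Nat.log2 (N / (18 * (k + 1))) + 1)), PowerSeries.X ^ (18 * (k + 1) * j))
      + (PowerSeries.X ^ (ex k (σ + 1)) * ∑ j ∈ Finset.range (2 ^ (Nat.log2 (N / (18 * (k + 1))) + 1)), PowerSeries.X ^ (18 * (k + 1) * j))
      + (PowerSeries.X ^ (ex k (10 - σ)) * ∑ j ∈ Finset.range (2 ^ (Nat.log2 (N / (18 * (k + 1))) + 1)), PowerSeries.X ^ (18 * (k + 1) * j)))
      + -((PowerSeries.X ^ (ex k (ρ + 1)) * ∑ j ∈ Finset.range (2 ^ (Nat.log2 (N / (18 * (k + 1))) + 1)), PowerSeries.X ^ (18 * (k + 1) * j))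
      + (PowerSeries.X ^ (ex k (10 - ρ)) * ∑ j ∈ Finset.range (2 ^ (Nat.log2 (N / (18 * (k + 1))) + 1)), PowerSeries.X ^ (18 * (k + 1) * j))
      + (PowerSeries.X ^ (ex k σ) * ∑ j ∈ Finset.range (2 ^ (Nat.log2 (N / (18 * (k + 1))) + 1)), PowerSeries.X ^ (18 * (k + 1) * j))
      + (PowerSeries.X ^ (ex k (9 - σ)) * ∑ j ∈ Finset.range (2 ^ (Nat.log2 (N / (18 * (k + 1))) + 1)), PowerSeries.X ^ (18 * (k + 1) * j)))))
      (LtN B N ρ σ k) := by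
    intro k
    rw [LtN, forceN_eq]
    have hg := RR_geo B N (18 * (k + 1)) (Nat.log2 (N / (18 * (k + 1))) + 1)
    exact RR_sg k (RR_add (RR_add (RR_add (RR_add (RR_sh _ hg) (RR_sh _ hg)) (RR_sh _ hg)) (RR_sh _ hg))
      (RR_neg (RR_add (RR_add (RR_add (RR_sh _ hg) (RR_sh _ hg)) (RR_sh _ hg)) (RR_sh _ hg))))
  have h := RR_sm key K
  refine RR_congr h ?_
  intro n hn
  have hJ : ∀ k, N ≤ 18 * (k + 1) * 2 ^ (Nat.log2 (N / (18 * (k + 1))) + 1) := by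
    intro k
    have h1 : N / (18 * (k + 1)) < 2 ^ (Nat.log2 (N / (18 * (k + 1))) + 1) := Nat.lt_log2_self
    have h2 := Nat.lt_mul_of_div_lt h1 (by positivity)
    nlinarith
  have hU := fun a => UU_fin a N K (fun k => 2 ^ (Nat.log2 (N / (18 * (k + 1))) + 1)) hK hJ n hn
  rw [LL]
  simp only [map_add, map_sub, hU]
  simp only [mul_add, mul_neg, Finset.sum_add_distrib, Finset.sum_neg_distrib, map_add, map_neg]
  ring

lemma land_block (C y z Y Z : ℕ) (hy : y < 2 ^ C) (hz : z < 2 ^ C) :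
    (y + 2 ^ C * Y) &&& (z + 2 ^ C * Z) = (y &&& z) + 2 ^ C * (Y &&& Z) := by
  have hp : 0 < 2 ^ C := by positivity
  have h1 : (y + 2 ^ C * Y) % 2 ^ C = y := by rw [Nat.add_mul_mod_self_left, Nat.mod_eq_of_lt hy]
  have h2 : (z + 2 ^ C * Z) % 2 ^ C = z := by rw [Nat.add_mul_mod_self_left, Nat.mod_eq_of_lt hz]
  have h3 : (y + 2 ^ C * Y) / 2 ^ C = Y := by rw [Nat.add_mul_div_left _ _ hp, Nat.div_eq_of_lt hy, zero_add]
  have h4 : (z + 2 ^ C * Z) / 2 ^ C = Z := by rw [Nat.add_mul_div_left _ _ hp, Nat.div_eq_of_lt hz, zero_add]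
  rw [← Nat.mod_add_div ((y + 2 ^ C * Y) &&& (z + 2 ^ C * Z)) (2 ^ C), Nat.and_mod_two_pow, Nat.and_div_two_pow, h1, h2, h3, h4]

lemma sum_shift (C : ℕ) (y : ℕ → ℕ) (M : ℕ) : ∑ m ∈ Finset.range (M + 1), y m * 2 ^ (C * m) =
    y 0 + 2 ^ C * ∑ m ∈ Finset.range M, y (m + 1) * 2 ^ (C * m) := by
  rw [Finset.sum_range_succ', Finset.mul_sum, add_comm, mul_zero, pow_zero, mul_one]
  congr 1
  apply Finset.sum_congr rfl
  intro m _
  rw [mul_add, pow_add, mul_one]; ring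

lemma land_sum (C : ℕ) (M : ℕ) : ∀ (y z : ℕ → ℕ) (_ : ∀ m, y m < 2 ^ C) (_ : ∀ m, z m < 2 ^ C),
    (∑ m ∈ Finset.range M, y m * 2 ^ (C * m)) &&& (∑ m ∈ Finset.range M, z m * 2 ^ (C * m)) =
    ∑ m ∈ Finset.range M, (y m &&& z m) * 2 ^ (C * m) := by
  induction M with
  | zero => intros; simp
  | succ M ih =>
    intro y z hy hz
    rw [sum_shift, sum_shift, sum_shift C (fun m => y m &&& z m), land_block C _ _ _ _ (hy 0) (hz 0),
      ih _ _ (fun m => hy _) (fun m => hz _)]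

lemma sum_lt_pow (C : ℕ) (M : ℕ) : ∀ (y : ℕ → ℕ) (_ : ∀ m, y m < 2 ^ C),
    ∑ m ∈ Finset.range M, y m * 2 ^ (C * m) < 2 ^ (C * M) := by
  induction M with
  | zero => intros; simp
  | succ M ih =>
    intro y hy
    rw [sum_shift, mul_add, mul_one, pow_add, mul_comm (2 ^ (C * M))]
    have h1 := hy 0
    have h2 := ih (fun m => y (m + 1)) (fun m => hy _)
    nlinarith

lemma sum_even_odd (f : ℕ → ℕ) (M : ℕ) : ∑ m ∈ Finset.range (2 * M), f m =
    ∑ m ∈ Finset.range M, (f (2 * m) + f (2 * m + 1)) := by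
  induction M with
  | zero => simp
  | succ M ih =>
    rw [show 2 * (M + 1) = 2 * M + 1 + 1 by ring, Finset.sum_range_succ, Finset.sum_range_succ, ih, Finset.sum_range_succ]
    ring

def blk (B' : ℕ) (d : ℕ → ℕ) (h o : ℕ) : ℕ := ∑ i ∈ Finset.range (2 ^ h), d (o + i) * 2 ^ (B' * i)

def valN (B' B T : ℕ) (d : ℕ → ℕ) (h : ℕ) : ℕ :=
  ∑ m ∈ Finset.range (2 ^ (T - h)), blk B' d h (2 ^ h * m) * 2 ^ (2 ^ h * B * m)

lemma blk_lt (B' : ℕ) (d : ℕ → ℕ) (hd : ∀ i, d i < 2 ^ B') (h o : ℕ) : blk B' d h o < 2 ^ (2 ^ h * B') := by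
  rw [mul_comm]
  exact sum_lt_pow B' (2 ^ h) (fun i => d (o + i)) (fun i => hd _)

lemma blk_succ (B' : ℕ) (d : ℕ → ℕ) (h o : ℕ) : blk B' d (h + 1) o =
    blk B' d h o + blk B' d h (o + 2 ^ h) * 2 ^ (2 ^ h * B') := by
  rw [blk, blk, blk, pow_succ, mul_two, Finset.sum_range_add, Finset.sum_mul]
  congr 1
  apply Finset.sum_congr rfl
  intro i _
  rw [mul_assoc, ← pow_add]
  congr 2 <;> ring

lemma sprN_step (B' B T : ℕ) (hB : B' ≤ B) (d : ℕ → ℕ) (hd : ∀ i, d i < 2 ^ B') (h : ℕ) (hT : h + 1 ≤ T) :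
    ∃ lo, valN B' B T d (h + 1) &&& ((1 <<< (2 ^ h * B') - 1) * geoN (2 ^ (h + 1) * B) (T - (h + 1))) = lo ∧
    lo + (valN B' B T d (h + 1) - lo) <<< (2 ^ h * (B - B')) = valN B' B T d h := by
  set M := 2 ^ (T - (h + 1)) with hM
  have hle : 2 ^ h * B' ≤ 2 ^ (h + 1) * B := by
    rw [pow_succ]; nlinarith [Nat.zero_le (2 ^ h * B), Nat.mul_le_mul_left (2 ^ h) hB]
  have hpow : 2 ^ (2 ^ h * B') ≤ 2 ^ (2 ^ (h + 1) * B) := Nat.pow_le_pow_right (by norm_num) hle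
  have hpow2 : 2 ^ (2 ^ (h + 1) * B') ≤ 2 ^ (2 ^ (h + 1) * B) :=
    Nat.pow_le_pow_right (by norm_num) (Nat.mul_le_mul_left _ hB)
  refine ⟨∑ m ∈ Finset.range M, blk B' d h (2 ^ (h + 1) * m) * 2 ^ (2 ^ (h + 1) * B * m), ?_, ?_⟩
  · rw [geoN_eq, Nat.shiftLeft_eq, one_mul, Finset.mul_sum, valN, land_sum]
    · apply Finset.sum_congr rfl
      intro m _
      congr 1
      rw [Nat.and_two_pow_sub_one_eq_mod, blk_succ, Nat.add_mul_mod_self_right, Nat.mod_eq_of_lt (blk_lt B' d hd _ _)]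
    · intro m
      exact lt_of_lt_of_le (blk_lt B' d hd _ _) hpow2
    · intro m
      have : 0 < 2 ^ (2 ^ h * B') := by positivity
      omega
  · have h1 : valN B' B T d (h + 1) = ∑ m ∈ Finset.range M, blk B' d h (2 ^ (h + 1) * m) * 2 ^ (2 ^ (h + 1) * B * m)
        + ∑ m ∈ Finset.range M, blk B' d h (2 ^ (h + 1) * m + 2 ^ h) * 2 ^ (2 ^ h * B') * 2 ^ (2 ^ (h + 1) * B * m) := by
      rw [valN, ← Finset.sum_add_distrib]
      apply Finset.sum_congr rfl
      intro m _
      rw [blk_succ, add_mul]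
    have e0 : 2 ^ (T - h) = 2 * M := by rw [show T - h = T - (h + 1) + 1 by omega, pow_succ, mul_comm]
    rw [h1, Nat.add_sub_cancel_left, Nat.shiftLeft_eq, valN, e0,
      sum_even_odd, Finset.sum_add_distrib, Finset.sum_mul]
    congr 1
    · apply Finset.sum_congr rfl
      intro m _
      rw [pow_succ]
      ring_nf
    · apply Finset.sum_congr rfl
      intro m _
      have e1 : 2 ^ (h + 1) * m + 2 ^ h = 2 ^ h * (2 * m + 1) := by rw [pow_succ]; ring
      rw [e1, mul_assoc, mul_assoc, ← pow_add, ← pow_add]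
      congr 2
      obtain ⟨e, rfl⟩ := Nat.exists_eq_add_of_le hB
      rw [Nat.add_sub_cancel_left, pow_succ]; ring

lemma sprN_eq (B' B T : ℕ) (hB : B' ≤ B) (d : ℕ → ℕ) (hd : ∀ i, d i < 2 ^ B') (h : ℕ) (hT : h ≤ T) :
    sprN B' B T h (valN B' B T d h) = ∑ m ∈ Finset.range (2 ^ T), d m * 2 ^ (B * m) := by
  induction h with
  | zero => simp [sprN, valN, blk]
  | succ h ih =>
    obtain ⟨lo, h1, h2⟩ := sprN_step B' B T hB d hd h hT
    rw [sprN, forceN_eq, forceN_eq, h1, h2, ih (by omega)]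

lemma bigN_RR (B' B N T : ℕ) (hB : B' ≤ B) (hB' : 1 ≤ B') (hN : N ≤ 2 ^ T) (f : PowerSeries ℤ) (x : ℕ)
    (h : RR B' N f x) (hf : ∀ n < N, |PowerSeries.coeff n f| < 2 ^ (B' - 1)) :
    RR B N f (bigN B' B N T x) := by
  rw [bigN, RR_msk]
  set G : PowerSeries ℤ := ∑ j ∈ Finset.range (2 ^ T), PowerSeries.X ^ (1 * j) with hG
  have hgeo : ∀ B, RR B N G (geoN B T) := fun B => by
    have := RR_geo B N 1 T
    rwa [one_mul] at this
  have hGc : ∀ n < N, PowerSeries.coeff n G = 1 := by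
    intro n hn
    rw [hG, map_sum]
    simp only [one_mul, PowerSeries.coeff_X_pow]
    rw [Finset.sum_ite_eq, if_pos (Finset.mem_range.2 (by omega))]
  set hf2 : ℕ := 2 ^ (B' - 1) with hhf
  have hhalf : 1 <<< (B' - 1) = hf2 := by rw [Nat.shiftLeft_eq, one_mul]
  have hC : ∀ B, RR B N (PowerSeries.C (hf2 : ℤ)) hf2 := by
    intro B
    have := evN_poly (2 ^ B) N (Polynomial.C (hf2 : ℤ))
    rw [Polynomial.coe_C, Polynomial.eval_C] at this
    exact this
  rw [hhalf]
  have hpow : (2 : ℤ) ^ B' = 2 * hf2 := by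
    rw [hhf]; push_cast; rw [← pow_succ']; congr 1; omega
  have hdec : ∃ d : ℕ → ℕ, ∀ n, (n < N → (d n : ℤ) = PowerSeries.coeff n f + hf2) ∧ (N ≤ n → d n = 0) := by
    refine ⟨fun n => if n < N then (PowerSeries.coeff n f + hf2).toNat else 0, ?_⟩
    intro n
    constructor
    · intro hn
      have := abs_lt.1 (hf n hn)
      simp only [hn, if_true]
      rw [Int.toNat_of_nonneg]
      rw [hhf]; push_cast; linarith
    · intro hn
      simp [not_lt.2 hn]
  obtain ⟨d, hd⟩ := hdec
  have hdlt : ∀ i, d i < 2 ^ B' := by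
    intro i
    by_cases hi : i < N
    · have h1 := (hd i).1 hi
      have := abs_lt.1 (hf i hi)
      zify
      rw [h1, hpow, hhf]; push_cast; linarith
    · rw [(hd i).2 (by omega)]; positivity
  have hsum : ∀ B, (∑ m ∈ Finset.range (2 ^ T), d m * 2 ^ (B * m)) = ∑ m ∈ Finset.range N, d m * 2 ^ (B * m) := by
    intro B
    symm
    apply Finset.sum_subset
    · intro x hx; simp at hx ⊢; omega
    · intro m _ hm
      rw [(hd m).2 (by simpa using hm), zero_mul]
  have hev : ∀ B, evN (2 ^ B) N (f + PowerSeries.C (hf2 : ℤ) * G) = ((∑ m ∈ Finset.range N, d m * 2 ^ (B * m) : ℕ) : ℤ) := by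
    intro B
    rw [evN]
    push_cast
    apply Finset.sum_congr rfl
    intro n hn
    have hn' := Finset.mem_range.1 hn
    rw [map_add, PowerSeries.coeff_C_mul, hGc n hn', (hd n).1 hn', mul_one, pow_mul]
  have hin : (x + hf2 * geoN B' T) &&& mskN B' N = ∑ m ∈ Finset.range N, d m * 2 ^ (B' * m) := by
    have h1 := RR_add h (RR_mul (hC B') (hgeo B'))
    rw [RR, hev B', ← pow_mul] at h1
    rw [and_msk]
    have h2 : (∑ m ∈ Finset.range N, d m * 2 ^ (B' * m)) ≡ (x + hf2 * geoN B' T) [MOD 2 ^ (B' * N)] := by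
      rw [← Int.natCast_modEq_iff]
      exact_mod_cast h1
    rw [← h2, Nat.mod_eq_of_lt (sum_lt_pow B' N d hdlt)]
  have hval : ∑ m ∈ Finset.range N, d m * 2 ^ (B' * m) = valN B' B T d T := by
    rw [← hsum B', valN]; simp [blk]
  rw [hin, hval, sprN_eq B' B T hB d hdlt T le_rfl, hsum B]
  have h3 : RR B N (f + PowerSeries.C (hf2 : ℤ) * G) (∑ m ∈ Finset.range N, d m * 2 ^ (B * m)) := by
    rw [RR, hev B]
  have h4 := RR_add h3 (RR_neg (RR_mul (hC B) (hgeo B)))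
  simpa using h4

lemma Th_abs (r n : ℕ) : |PowerSeries.coeff n (Th r)| ≤ n := by
  rw [Th_coeff r n n le_rfl]
  refine (Finset.abs_sum_le_sum_abs _ _).trans ?_
  calc ∑ k ∈ Finset.range n, |if ex k r = n then (-1 : ℤ) ^ k else 0| ≤ ∑ k ∈ Finset.range n, (1 : ℤ) := by
        apply Finset.sum_le_sum
        intro k _
        split_ifs <;> simp
    _ = n := by simp

lemma UU_abs (a n : ℕ) : |PowerSeries.coeff n (UU a)| ≤ n := by
  rw [UU_coeff a n (n + 1) le_rfl]
  simp only [fun j => Th_coeff (a + 9 * j) n n le_rfl]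
  rw [Finset.sum_comm]
  refine (Finset.abs_sum_le_sum_abs _ _).trans ?_
  calc ∑ k ∈ Finset.range n, |∑ j ∈ Finset.range (n + 1), if ex k (a + 9 * j) = n then (-1 : ℤ) ^ k else 0|
      ≤ ∑ k ∈ Finset.range n, (1 : ℤ) := by
        apply Finset.sum_le_sum
        intro k _
        by_cases h : ∃ j0 ∈ Finset.range (n + 1), ex k (a + 9 * j0) = n
        · obtain ⟨j0, hj0, h0⟩ := h
          rw [Finset.sum_eq_single j0]
          · split_ifs <;> simp
          · intro j _ hj
            rw [if_neg]
            intro h1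
            apply hj
            rw [← h0] at h1
            simp only [ex] at h1
            nlinarith
          · intro h; exact absurd hj0 h
        · push Not at h
          rw [Finset.sum_eq_zero]
          · simp
          · intro j hj; rw [if_neg (h j hj)]
    _ = n := by simp

lemma psi_abs (n : ℕ) : |PowerSeries.coeff n (1 - Th 0 - Th 1 : PowerSeries ℤ)| ≤ 2 * n + 1 := by
  rw [map_sub, map_sub]
  have h0 := abs_le.1 (Th_abs 0 n)
  have h1 := abs_le.1 (Th_abs 1 n)
  rw [PowerSeries.coeff_one, abs_le]
  split_ifs <;> constructor <;> linarith

lemma LL_abs (ρ σ n : ℕ) : |PowerSeries.coeff n (LL ρ σ)| ≤ 8 * n := by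
  simp only [LL, map_sub, map_add]
  have h1 := abs_le.1 (UU_abs ρ n)
  have h2 := abs_le.1 (UU_abs (ρ + 1) n)
  have h3 := abs_le.1 (UU_abs (9 - ρ) n)
  have h4 := abs_le.1 (UU_abs (10 - ρ) n)
  have h5 := abs_le.1 (UU_abs σ n)
  have h6 := abs_le.1 (UU_abs (σ + 1) n)
  have h7 := abs_le.1 (UU_abs (9 - σ) n)
  have h8 := abs_le.1 (UU_abs (10 - σ) n)
  rw [abs_le]
  constructor <;> linarith

lemma digits_sum (B W M : ℕ) : ∑ i ∈ Finset.range M, (W / 2 ^ (B * i) % 2 ^ B) * 2 ^ (B * i) = W % 2 ^ (B * M) := by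
  induction M with
  | zero => simp [Nat.mod_one]
  | succ M ih =>
    rw [Finset.sum_range_succ, ih, mul_add, mul_one, pow_add, Nat.mod_mul, mul_comm (W / _ % _)]

lemma hi_zero (B w : ℕ) (hB : 36 ≤ B) (hw : w < 2 ^ B) (h : w &&& ((1 <<< 36 - 1) <<< (B - 36)) = 0) :
    w < 2 ^ (B - 36) := by
  have h1 : (w &&& ((1 <<< 36 - 1) <<< (B - 36))) / 2 ^ (B - 36) = w / 2 ^ (B - 36) := by
    rw [Nat.and_div_two_pow, Nat.shiftLeft_eq, Nat.mul_div_cancel _ (by positivity), Nat.shiftLeft_eq, one_mul,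
      Nat.and_two_pow_sub_one_eq_mod, Nat.mod_eq_of_lt]
    rw [Nat.div_lt_iff_lt_mul (by positivity), ← pow_add]
    rwa [show 36 + (B - 36) = B by omega]
  rw [h, Nat.zero_div] at h1
  exact (Nat.div_eq_zero_iff_lt (by positivity)).1 h1.symm

lemma lo_eq_aux (B c m n : ℕ) (hc : c = 2 ^ m) : geoN B m + (geoN B n) <<< (c * B) =
    ∑ j ∈ Finset.range (2 ^ m + 2 ^ n), 2 ^ (B * j) := by
  rw [geoN_eq, geoN_eq, Nat.shiftLeft_eq, Finset.sum_range_add, Finset.sum_mul]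
  congr 1
  apply Finset.sum_congr rfl
  intro i _
  rw [← pow_add, hc]; congr 1; ring

lemma lo_eq (B : ℕ) : geoN B 2 + (geoN B 5) <<< (4 * B) = ∑ j ∈ Finset.range 36, 2 ^ (B * j) :=
  lo_eq_aux B 4 2 5 rfl

lemma digN_sound (B N g X : ℕ) (hB : 36 ≤ B) (hN : N ≤ 2 ^ g) (hN36 : 36 ≤ N) (h : digN B N g X = true) :
    ∃ w : ℕ → ℕ, (∀ i, w i < 2 ^ (B - 36)) ∧
      RR B N (PowerSeries.mk fun i => (w i : ℤ) + if i < 36 then -1 else 1) X := by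
  simp only [digN, forceN_eq, Bool.and_eq_true] at h
  obtain ⟨h1, -⟩ := h
  have h1' := Nat.eq_of_beq_eq_true h1
  set O := geoN B g with hO
  set lo := geoN B 2 + (geoN B 5) <<< (4 * B) with hlo
  set W := (X + lo + negN B N (O - lo)) &&& mskN B N with hW
  have hWlt : W < 2 ^ (B * N) := by rw [hW, and_msk]; exact Nat.mod_lt _ (by positivity)
  have hloeq : lo = ∑ j ∈ Finset.range 36, 2 ^ (B * j) := by
    rw [hlo]; exact lo_eq B
  have hOeq : O = ∑ j ∈ Finset.range (2 ^ g), 2 ^ (B * j) := geoN_eq _ _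
  have hle : lo ≤ O := by
    rw [hloeq, hOeq]
    apply Finset.sum_le_sum_of_subset
    intro x hx; simp at hx ⊢; omega
  have hWg : ∑ i ∈ Finset.range (2 ^ g), (W / 2 ^ (B * i) % 2 ^ B) * 2 ^ (B * i) = W := by
    rw [digits_sum, Nat.mod_eq_of_lt]
    exact lt_of_lt_of_le hWlt (Nat.pow_le_pow_right (by norm_num) (Nat.mul_le_mul_left _ hN))
  have hWN : ∑ i ∈ Finset.range N, (W / 2 ^ (B * i) % 2 ^ B) * 2 ^ (B * i) = W := by
    rw [digits_sum, Nat.mod_eq_of_lt hWlt]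
  have hdl : ∀ i, W / 2 ^ (B * i) % 2 ^ B < 2 ^ B := fun i => Nat.mod_lt _ (by positivity)
  refine ⟨fun i => W / 2 ^ (B * i) % 2 ^ B, ?_, ?_⟩
  · intro i
    by_cases hi : i < 2 ^ g
    · apply hi_zero B _ hB (hdl i)
      have hc : (1 <<< 36 - 1) <<< (B - 36) < 2 ^ B := by
        rw [Nat.shiftLeft_eq, Nat.shiftLeft_eq, one_mul]
        have : 2 ^ B = 2 ^ 36 * 2 ^ (B - 36) := by rw [← pow_add]; congr 1; omega
        rw [this]
        exact Nat.mul_lt_mul_of_pos_right (by norm_num) (by positivity)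
      have h2 := land_sum B (2 ^ g) (fun i => W / 2 ^ (B * i) % 2 ^ B) (fun _ => (1 <<< 36 - 1) <<< (B - 36)) hdl (fun _ => hc)
      rw [hWg, ← Finset.mul_sum, ← hOeq, h1'] at h2
      have h3 := (Finset.sum_eq_zero_iff.1 h2.symm) i (Finset.mem_range.2 hi)
      rcases Nat.mul_eq_zero.1 h3 with h4 | h4
      · exact h4
      · exact absurd h4 (by positivity)
    · change W / 2 ^ (B * i) % 2 ^ B < 2 ^ (B - 36)
      rw [Nat.div_eq_of_lt, Nat.zero_mod]
      · positivity
      · refine lt_of_lt_of_le hWlt (Nat.pow_le_pow_right (by norm_num) (Nat.mul_le_mul_left _ ?_))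
        omega
  · rw [RR]
    have e1 : evN (2 ^ B) N (PowerSeries.mk fun i => ((W / 2 ^ (B * i) % 2 ^ B : ℕ) : ℤ) + if i < 36 then -1 else 1)
        = W + ((∑ j ∈ Finset.range N, 2 ^ (B * j) : ℕ) : ℤ) - 2 * lo := by
      conv_rhs => rw [← hWN, hloeq]
      obtain ⟨M, rfl⟩ := Nat.exists_eq_add_of_le hN36
      rw [evN]
      simp only [PowerSeries.coeff_mk, add_mul, Finset.sum_add_distrib]
      have : ∑ x ∈ Finset.range (36 + M), (if x < 36 then (-1 : ℤ) else 1) * (2 ^ B) ^ x =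
          ((∑ j ∈ Finset.range (36 + M), 2 ^ (B * j) : ℕ) : ℤ) - 2 * ((∑ j ∈ Finset.range 36, 2 ^ (B * j) : ℕ) : ℤ) := by
        rw [Finset.sum_range_add, Finset.sum_range_add]
        push_cast
        have a1 : ∑ x ∈ Finset.range 36, (if x < 36 then (-1 : ℤ) else 1) * (2 ^ B) ^ x = - ∑ x ∈ Finset.range 36, 2 ^ (B * x) := by
          rw [← Finset.sum_neg_distrib]
          apply Finset.sum_congr rfl
          intro x hx
          rw [if_pos (Finset.mem_range.1 hx), pow_mul]; ring
        have a2 : ∑ x ∈ Finset.range M, (if 36 + x < 36 then (-1 : ℤ) else 1) * (2 ^ B) ^ (36 + x) = ∑ x ∈ Finset.range M, 2 ^ (B * (36 + x)) := by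
          apply Finset.sum_congr rfl
          intro x hx
          rw [if_neg (by omega), pow_mul]; ring
        rw [a1, a2]; ring
      rw [this]
      push_cast
      simp only [pow_mul]
      ring
    rw [e1]
    have e2 : (W : ℤ) ≡ X + lo + (-((O : ℤ) - lo)) [ZMOD (2 ^ B) ^ N] := by
      have := negN_cast B N (O - lo)
      rw [Nat.cast_sub hle] at this
      have h5 : (W : ℤ) ≡ ((X + lo + negN B N (O - lo) : ℕ) : ℤ) [ZMOD (2 ^ B) ^ N] := by
        rw [hW, and_msk]
        push_cast
        rw [← pow_mul]
        exact Int.mod_modEq _ _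
      refine h5.trans ?_
      push_cast
      exact Int.ModEq.add_left _ this
    have e3 : (O : ℤ) ≡ ((∑ j ∈ Finset.range N, 2 ^ (B * j) : ℕ) : ℤ) [ZMOD (2 ^ B) ^ N] := by
      rw [hOeq]
      obtain ⟨M, hM⟩ := Nat.exists_eq_add_of_le hN
      rw [hM, Finset.sum_range_add]
      apply Int.ModEq.symm
      rw [Int.modEq_iff_dvd]
      push_cast
      rw [add_sub_cancel_left]
      apply Finset.dvd_sum
      intro i _
      rw [← pow_mul]
      exact pow_dvd_pow _ (Nat.mul_le_mul_left _ (by omega))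
    have e4 := (e2.add e3.symm).sub_right (2 * (lo : ℤ))
    refine e4.trans ?_
    rw [show (X : ℤ) + lo + -((O : ℤ) - lo) + O - 2 * lo = X by ring]

lemma coeff_pp (f g : PowerSeries ℤ) (N : ℕ) (h : ∀ i < N, PowerSeries.coeff i f = PowerSeries.coeff i g) (n : ℕ) (hn : n < N)
    (p : PowerSeries ℤ) : PowerSeries.coeff n (p * f) = PowerSeries.coeff n (p * g) := by
  rw [PowerSeries.coeff_mul, PowerSeries.coeff_mul]
  apply Finset.sum_congr rfl
  intro x hx
  have := Finset.HasAntidiagonal.mem_antidiagonal.1 hx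
  rw [h x.2 (by omega)]

theorem chkN_sound (B' B N K T ρ σ : ℕ) (h : chkN B' B N K T ρ σ = true) (hB : B' ≤ B) (hB' : 1 ≤ B') (hN : N ≤ 2 ^ T)
    (hB36 : 36 ≤ B) (hN36 : 36 ≤ N) (hK : N ≤ 2 * K ^ 2) (h8 : 8 * N < 2 ^ (B' - 1))
    (hbig : 2 * N ^ 2 * 2 ^ (B - 36) + 8 * N < 2 ^ B) (n : ℕ) (h36 : 36 ≤ n) (hn : n < N) :
    1 ≤ PowerSeries.coeff n (PP * LL ρ σ) := by
  simp only [chkN, forceN_eq, Bool.and_eq_true] at h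
  obtain ⟨h1, h2⟩ := h
  have h1' := Nat.eq_of_beq_eq_true h1
  obtain ⟨w, hw, hY⟩ := digN_sound B N T _ hB36 hN hN36 h2
  set Y : PowerSeries ℤ := PowerSeries.mk fun i => (w i : ℤ) + if i < 36 then -1 else 1 with hYd
  set ψ : PowerSeries ℤ := 1 - Th 0 - Th 1 with hψ
  have h8' : (8 * N : ℤ) < 2 ^ (B' - 1) := by exact_mod_cast h8
  have hψR := bigN_RR B' B N T hB hB' hN ψ _ (psiN_RR B' N K hK) (by
    intro n hn
    have := psi_abs n
    have : (n : ℤ) < N := by exact_mod_cast hn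
    linarith)
  have hLR := bigN_RR B' B N T hB hB' hN (LL ρ σ) _ (LN_RR B' N K ρ σ hK) (by
    intro n hn
    have := LL_abs ρ σ n
    have : (n : ℤ) < N := by exact_mod_cast hn
    linarith)
  have h3 := RR_mul hY hψR
  rw [← RR_msk, h1'] at h3
  have h4 : evN (2 ^ B) N (LL ρ σ) ≡ evN (2 ^ B) N (Y * ψ) [ZMOD (2 ^ B) ^ N] := hLR.trans h3.symm
  have h5 := (Int.modEq_iff_dvd.1 h4)
  rw [← evN_sub, evN] at h5
  have hbig' : 2 * (N : ℤ) ^ 2 * 2 ^ (B - 36) + 8 * N < 2 ^ B := by exact_mod_cast hbig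
  have hYb : ∀ i, |PowerSeries.coeff i Y| ≤ 2 ^ (B - 36) := by
    intro i
    rw [hYd, PowerSeries.coeff_mk]
    have a1 : (w i : ℤ) + 1 ≤ 2 ^ (B - 36) := by exact_mod_cast hw i
    have a2 : (0 : ℤ) ≤ w i := by positivity
    rw [abs_le]
    split_ifs <;> constructor <;> linarith
  have h6 := digit_zero (2 ^ B) (by positivity) N _ (by
    intro i hi
    rw [map_sub]
    have a1 : |PowerSeries.coeff i (Y * ψ)| ≤ 2 * N ^ 2 * 2 ^ (B - 36) := by
      rw [PowerSeries.coeff_mul]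
      refine (Finset.abs_sum_le_sum_abs _ _).trans ?_
      calc _ ≤ ∑ x ∈ Finset.HasAntidiagonal.antidiagonal i, (2 ^ (B - 36) * (2 * N) : ℤ) := by
            apply Finset.sum_le_sum
            intro x hx
            have hx' := Finset.HasAntidiagonal.mem_antidiagonal.1 hx
            rw [abs_mul]
            apply mul_le_mul (hYb _) _ (abs_nonneg _) (by positivity)
            refine (psi_abs _).trans ?_
            have : x.2 + 1 ≤ N := by omega
            have : (x.2 : ℤ) + 1 ≤ N := by exact_mod_cast this
            linarith
        _ = (i + 1) * (2 ^ (B - 36) * (2 * N)) := by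
            rw [Finset.sum_const, Finset.Nat.card_antidiagonal]; push_cast; ring
        _ ≤ N * (2 ^ (B - 36) * (2 * N)) := by
            apply mul_le_mul_of_nonneg_right _ (by positivity)
            exact_mod_cast hi
        _ = _ := by ring
    have a2 := LL_abs ρ σ i
    have a3 : (i : ℤ) < N := by exact_mod_cast hi
    have := abs_sub (PowerSeries.coeff i (Y * ψ)) (PowerSeries.coeff i (LL ρ σ))
    linarith) h5
  have h7 : PowerSeries.coeff n (PP * LL ρ σ) = PowerSeries.coeff n Y := by
    rw [coeff_pp (LL ρ σ) (Y * ψ) N _ n hn PP]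
    · rw [mul_comm Y, ← mul_assoc, PP_psi, one_mul]
    · intro i hi
      have := h6 i hi
      rw [map_sub] at this
      linarith
  rw [h7, hYd, PowerSeries.coeff_mk, if_neg (by omega)]
  have : (0 : ℤ) ≤ w n := by positivity
  linarith

theorem chk_a : chkN 20 400 40960 144 16 0 3 = true := by decide +kernel
theorem chk_b : chkN 20 400 40960 144 16 1 2 = true := by decide +kernel
theorem chk_c : chkN 20 400 40960 144 16 2 4 = true := by decide +kernel

lemma big_ineq : 2 * 40960 ^ 2 * 2 ^ (400 - 36) + 8 * 40960 < 2 ^ 400 := by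
  have h1 : (2 : ℕ) ^ 400 = 2 ^ 36 * 2 ^ 364 := by rw [← pow_add]
  rw [h1, show 400 - 36 = 364 by norm_num]
  have h2 : 8 * 40960 ≤ 2 ^ 364 := le_trans (by norm_num) (Nat.pow_le_pow_right (n := 2) (by norm_num) (show 20 ≤ 364 by norm_num))
  generalize (2 : ℕ) ^ 364 = z at *
  omega

lemma coeff_small (ρ σ : ℕ) (h : chkN 20 400 40960 144 16 ρ σ = true) (n : ℕ) (h36 : 36 ≤ n) (hn : n < 40960) :
    1 ≤ PowerSeries.coeff n (PP * LL ρ σ) :=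
  chkN_sound 20 400 40960 144 16 ρ σ h (by norm_num) (by norm_num) (by norm_num) (by norm_num) (by norm_num)
    (by norm_num) (by norm_num) big_ineq n h36 hn

/-- absolute convergence of the evaluation of a power series -/
def CV (f : PowerSeries ℤ) (q : ℂ) : Prop := Summable fun n => ‖((PowerSeries.coeff n f : ℤ) : ℂ) * q ^ n‖
noncomputable def ev (f : PowerSeries ℤ) (q : ℂ) : ℂ := ∑' n, ((PowerSeries.coeff n f : ℤ) : ℂ) * q ^ n

lemma mul_term (f g : PowerSeries ℤ) (q : ℂ) (n : ℕ) :
    ((PowerSeries.coeff n (f * g) : ℤ) : ℂ) * q ^ n = ∑ kl ∈ Finset.HasAntidiagonal.antidiagonal n,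
      (((PowerSeries.coeff kl.1 f : ℤ) : ℂ) * q ^ kl.1) * (((PowerSeries.coeff kl.2 g : ℤ) : ℂ) * q ^ kl.2) := by
  rw [PowerSeries.coeff_mul]
  push_cast
  rw [Finset.sum_mul]
  apply Finset.sum_congr rfl
  intro x hx
  have := Finset.HasAntidiagonal.mem_antidiagonal.1 hx
  rw [← this, pow_add]; ring

lemma CV_mul {f g : PowerSeries ℤ} {q : ℂ} (hf : CV f q) (hg : CV g q) : CV (f * g) q := by
  have := summable_norm_sum_mul_antidiagonal_of_summable_norm hf hg
  rw [CV]
  simpa only [mul_term] using this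

lemma ev_mul {f g : PowerSeries ℤ} {q : ℂ} (hf : CV f q) (hg : CV g q) : ev (f * g) q = ev f q * ev g q := by
  rw [ev, ev, ev, tsum_mul_tsum_eq_tsum_sum_antidiagonal_of_summable_norm hf hg]
  simp only [mul_term]

lemma CV_one (q : ℂ) : CV 1 q := by
  apply summable_of_ne_finset_zero (s := {0})
  intro n hn
  have : n ≠ 0 := by simpa using hn
  simp [PowerSeries.coeff_one, this]

lemma ev_one (q : ℂ) : ev 1 q = 1 := by
  rw [ev, tsum_eq_single 0]
  · simp
  · intro n hn; simp [PowerSeries.coeff_one, hn]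

lemma CV_add {f g : PowerSeries ℤ} {q : ℂ} (hf : CV f q) (hg : CV g q) : CV (f + g) q := by
  refine Summable.of_nonneg_of_le (fun _ => norm_nonneg _) (fun n => ?_) (Summable.add hf hg)
  rw [map_add]; push_cast; rw [add_mul]; exact norm_add_le _ _

lemma ev_add {f g : PowerSeries ℤ} {q : ℂ} (hf : CV f q) (hg : CV g q) : ev (f + g) q = ev f q + ev g q := by
  rw [ev, ev, ev, ← Summable.tsum_add hf.of_norm hg.of_norm]
  congr 1; ext n; rw [map_add]; push_cast; ring

lemma CV_neg {f : PowerSeries ℤ} {q : ℂ} (hf : CV f q) : CV (-f) q := by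
  rw [CV] at *; simpa using hf

lemma ev_neg {f : PowerSeries ℤ} {q : ℂ} : ev (-f) q = -ev f q := by
  rw [ev, ev, ← tsum_neg]
  congr 1; ext n; rw [map_neg]; push_cast; ring

lemma CV_sub {f g : PowerSeries ℤ} {q : ℂ} (hf : CV f q) (hg : CV g q) : CV (f - g) q := by
  rw [sub_eq_add_neg]; exact CV_add hf (CV_neg hg)

lemma ev_sub {f g : PowerSeries ℤ} {q : ℂ} (hf : CV f q) (hg : CV g q) : ev (f - g) q = ev f q - ev g q := by
  rw [sub_eq_add_neg, ev_add hf (CV_neg hg), ev_neg, sub_eq_add_neg]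

lemma CV_of_abs (f : PowerSeries ℤ) (c : ℤ) (h : ∀ n, |PowerSeries.coeff n f| ≤ c * n) (q : ℂ) (hq : ‖q‖ < 1) : CV f q := by
  have h1 : Summable fun n : ℕ => (c : ℝ) * ((n : ℝ) ^ 1 * ‖q‖ ^ n) :=
    Summable.mul_left _ (summable_pow_mul_geometric_of_norm_lt_one (R := ℝ) 1 (r := ‖q‖) (by rwa [norm_norm]))
  refine Summable.of_nonneg_of_le (fun _ => norm_nonneg _) (fun n => ?_) h1
  rw [norm_mul, norm_pow, pow_one, ← mul_assoc]
  apply mul_le_mul_of_nonneg_right _ (by positivity)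
  rw [Complex.norm_intCast]
  have h2 : ((|PowerSeries.coeff n f| : ℤ) : ℝ) ≤ ((c * n : ℤ) : ℝ) := Int.cast_le.2 (h n)
  rw [Int.cast_abs, Int.cast_mul, Int.cast_natCast] at h2
  exact h2

lemma CV_Th (r : ℕ) (q : ℂ) (hq : ‖q‖ < 1) : CV (Th r) q :=
  CV_of_abs _ 1 (fun n => by simpa using Th_abs r n) q hq
lemma CV_UU (r : ℕ) (q : ℂ) (hq : ‖q‖ < 1) : CV (UU r) q :=
  CV_of_abs _ 1 (fun n => by simpa using UU_abs r n) q hq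
lemma CV_LL (r s : ℕ) (q : ℂ) (hq : ‖q‖ < 1) : CV (LL r s) q :=
  CV_of_abs _ 8 (fun n => LL_abs r s n) q hq

/-- coefficient extraction -/
lemma coeff_integral (f : PowerSeries ℤ) (t : ℝ) (h : CV f (Real.exp (-t))) (n : ℕ) :
    IntervalIntegrable (fun φ : ℝ => ev f (Complex.exp (-(t - Complex.I * φ))) * Complex.exp (n * (t - Complex.I * φ))) MeasureTheory.volume (-Real.pi) Real.pi ∧
    ∫ φ in (-Real.pi)..Real.pi, ev f (Complex.exp (-(t - Complex.I * φ))) * Complex.exp (n * (t - Complex.I * φ))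
      = 2 * Real.pi * (PowerSeries.coeff n f : ℤ) := by
  set a : ℕ → ℂ := fun m => ((PowerSeries.coeff m f : ℤ) : ℂ) with ha
  set F : ℕ → ℝ → ℂ := fun m φ => a m * Complex.exp (-(t - Complex.I * φ)) ^ m * Complex.exp (n * (t - Complex.I * φ)) with hF
  have hFc : ∀ m, Continuous (F m) := by intro m; rw [hF]; fun_prop
  have hb : ∀ m φ, ‖F m φ‖ = ‖a m * (Real.exp (-t) : ℂ) ^ m‖ * Real.exp (n * t) := by
    intro m φ
    rw [hF]
    simp only [norm_mul, norm_pow, Complex.norm_exp, Complex.norm_real, Real.norm_eq_abs, Real.abs_exp]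
    simp
  have hev : ∀ φ : ℝ, HasSum (fun m => F m φ) (ev f (Complex.exp (-(t - Complex.I * φ))) * Complex.exp (n * (t - Complex.I * φ))) := by
    intro φ
    apply HasSum.mul_right
    apply Summable.hasSum
    apply Summable.of_norm
    refine h.congr ?_
    intro m
    rw [norm_mul, norm_mul, norm_pow, norm_pow, Complex.norm_exp, Complex.norm_real, Real.norm_eq_abs, Real.abs_exp]
    simp [ha]
  have hFF : (fun φ : ℝ => ev f (Complex.exp (-(t - Complex.I * φ))) * Complex.exp (n * (t - Complex.I * φ))) = fun φ => ∑' m, F m φ := by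
    ext φ; exact (hev φ).tsum_eq.symm
  have hs : Summable fun m => ‖a m * (Real.exp (-t) : ℂ) ^ m‖ * Real.exp (n * t) := h.mul_right _
  have hcont : Continuous (fun φ : ℝ => ev f (Complex.exp (-(t - Complex.I * φ))) * Complex.exp (n * (t - Complex.I * φ))) := by
    rw [hFF]
    exact continuous_tsum hFc hs (fun m φ => (hb m φ).le)
  refine ⟨hcont.intervalIntegrable _ _, ?_⟩
  have h1 := intervalIntegral.hasSum_integral_of_dominated_convergence (μ := MeasureTheory.volume) (a := -Real.pi) (b := Real.pi) (F := F)
    (fun m _ => ‖a m * (Real.exp (-t) : ℂ) ^ m‖ * Real.exp (n * t))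
    (fun m => (hFc m).aestronglyMeasurable) (fun m => Filter.Eventually.of_forall (fun φ _ => (hb m φ).le))
    (Filter.Eventually.of_forall (fun φ _ => hs)) (by simp) (Filter.Eventually.of_forall (fun φ _ => hev φ))
  rw [← h1.tsum_eq, tsum_eq_single n]
  · have : ∀ φ, F n φ = a n := by
      intro φ
      rw [hF]
      simp only
      rw [mul_assoc, ← Complex.exp_nat_mul, ← Complex.exp_add]
      rw [show (n : ℂ) * (-(t - Complex.I * φ)) + n * (t - Complex.I * φ) = 0 by ring, Complex.exp_zero, mul_one]
    simp only [this]
    rw [intervalIntegral.integral_const]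
    rw [Complex.real_smul]; push_cast; ring
  · intro m hm
    have h2 : ∀ φ : ℝ, F m φ = (a m * Complex.exp ((n - m : ℂ) * t)) * Complex.exp (((m : ℂ) - n) * Complex.I * φ) := by
      intro φ
      rw [hF]
      simp only
      rw [mul_assoc, mul_assoc, ← Complex.exp_nat_mul, ← Complex.exp_add, ← Complex.exp_add]
      congr 2; ring
    simp only [h2]
    have hmn : ((m : ℂ) - n) ≠ 0 := sub_ne_zero.2 (by exact_mod_cast hm)
    rw [intervalIntegral.integral_const_mul, integral_exp_mul_complex (mul_ne_zero hmn Complex.I_ne_zero)]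
    have : Complex.exp (((m : ℂ) - n) * Complex.I * (Real.pi : ℝ)) = Complex.exp (((m : ℂ) - n) * Complex.I * ((-Real.pi : ℝ) : ℂ)) := by
      rw [Complex.exp_eq_exp_iff_exists_int]
      refine ⟨(m : ℤ) - n, ?_⟩
      push_cast; ring
    rw [this]; simp

noncomputable def FF (k : ℕ) : PowerSeries ℤ :=
  PowerSeries.mk fun n => if (k + 1) ∣ n ∧ (Even k → n ≤ k + 1) then 1 else 0

noncomputable def fch (i c : ℕ) : ℤ := if Odd i ∧ 1 < c then 0 else 1

lemma genFun_PP : Nat.Partition.genFun fch = PP := by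
  ext n
  rw [Nat.Partition.coeff_genFun, PP, PowerSeries.coeff_mk, p2, SS]
  have h1 : ∀ p : n.Partition, p.parts.toFinsupp.prod fch = if VV p.parts then 1 else 0 := by
    intro p
    rw [Finsupp.prod]
    by_cases h : VV p.parts
    · rw [if_pos h]
      apply Finset.prod_eq_one
      intro i _
      rw [Multiset.toFinsupp_apply, fch, if_neg]
      rintro ⟨h1, h2⟩
      have := h.2 i h1
      omega
    · rw [if_neg h]
      have : ∃ j, Odd j ∧ 1 < p.parts.count j := by
        by_contra hc
        push Not at hc
        exact h ⟨fun x hx => p.parts_pos hx, hc⟩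
      obtain ⟨j, hj, hj1⟩ := this
      apply Finset.prod_eq_zero (i := j)
      · rw [Multiset.toFinsupp_support, Multiset.mem_toFinset, ← Multiset.count_pos]; omega
      · rw [Multiset.toFinsupp_apply, fch, if_pos ⟨hj, hj1⟩]
  simp only [h1]
  rw [Finset.sum_boole, Finset.filter_image, Finset.card_image_of_injective]
  intro a b hab
  exact Nat.Partition.ext hab

open scoped PowerSeries.WithPiTopology in
lemma gen_coeff {R : Type*} [CommSemiring R] [TopologicalSpace R] [T2Space R] (f : ℕ → ℕ → R) (i n : ℕ) :
    PowerSeries.coeff n (1 + ∑' j, f (i + 1) (j + 1) • (PowerSeries.X : PowerSeries R) ^ ((i + 1) * (j + 1)))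
     = (if n = 0 then 1 else 0) + ∑' j, f (i + 1) (j + 1) * (if n = (i + 1) * (j + 1) then 1 else 0) := by
  rw [map_add, (Nat.Partition.summable_genFun_term f i).map_tsum _ (PowerSeries.WithPiTopology.continuous_coeff _ _)]
  simp only [map_smul, PowerSeries.coeff_X_pow, PowerSeries.coeff_one, smul_eq_mul]

lemma FF_eq (i n : ℕ) : ((if n = 0 then 1 else 0) + ∑' j, fch (i + 1) (j + 1) * (if n = (i + 1) * (j + 1) then 1 else 0))
   = PowerSeries.coeff n (FF i) := by
  simp only [FF, PowerSeries.coeff_mk]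
  have hodd : Odd (i + 1) ↔ Even i := by rw [Nat.odd_add_one, Nat.not_odd_iff_even]
  by_cases hd : (i + 1) ∣ n
  · obtain ⟨m, rfl⟩ := hd
    rcases m with _ | m
    · rw [tsum_congr (g := fun _ => (0 : ℤ))]
      · simp
      · intro j
        rw [if_neg, mul_zero]
        rw [mul_zero]; positivity
    · rw [tsum_eq_single m]
      · rw [if_neg (by positivity), if_pos rfl, fch, mul_one, zero_add]
        simp only [hodd]
        have e : (i + 1) * (m + 1) ≤ i + 1 ↔ m = 0 := by
          constructor
          · intro h; nlinarith
          · rintro rfl; simp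
        simp only [e]
        by_cases he : Even i <;> by_cases hm : m = 0 <;> simp [he, hm]
      · intro j hj
        rw [if_neg, mul_zero]
        intro h
        have := Nat.eq_of_mul_eq_mul_left (Nat.succ_pos i) h
        omega
  · rw [tsum_congr (g := fun _ => (0 : ℤ))]
    · have : n ≠ 0 := by rintro rfl; simp at hd
      simp [hd, this]
    · intro j
      rw [if_neg, mul_zero]
      rintro rfl
      simp at hd

open scoped PowerSeries.WithPiTopology in
lemma PP_tendsto (n : ℕ) : Filter.Tendsto (fun K => PowerSeries.coeff n (∏ k ∈ Finset.range K, FF k)) Filter.atTop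
    (nhds (p2 n : ℤ)) := by
  have h := Nat.Partition.hasProd_genFun (R := ℤ) fch
  have e0 : (fun i ↦ 1 + ∑' j, fch (i + 1) (j + 1) • (PowerSeries.X : PowerSeries ℤ) ^ ((i + 1) * (j + 1))) = FF := by
    funext i; ext n
    rw [← FF_eq]
    exact gen_coeff fch i n
  rw [genFun_PP] at h
  replace h : HasProd FF PP := by rw [← e0]; exact h
  have h2 := ((PowerSeries.WithPiTopology.continuous_coeff ℤ n).tendsto _).comp h.tendsto_prod_nat
  have e : PowerSeries.coeff n PP = (p2 n : ℤ) := by rw [PP, PowerSeries.coeff_mk]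
  rw [e] at h2
  exact h2

lemma FF_nonneg (k n : ℕ) : 0 ≤ PowerSeries.coeff n (FF k) := by
  rw [FF, PowerSeries.coeff_mk]; split_ifs <;> norm_num

lemma prod_nonneg (K n : ℕ) : 0 ≤ PowerSeries.coeff n (∏ k ∈ Finset.range K, FF k) := by
  induction K generalizing n with
  | zero => simp [PowerSeries.coeff_one]; split_ifs <;> norm_num
  | succ K ih =>
    rw [Finset.prod_range_succ, PowerSeries.coeff_mul]
    exact Finset.sum_nonneg (fun x _ => mul_nonneg (ih _) (FF_nonneg _ _))

lemma prod_mono (n : ℕ) : Monotone (fun K => PowerSeries.coeff n (∏ k ∈ Finset.range K, FF k)) := by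
  apply monotone_nat_of_le_succ
  intro K
  rw [Finset.prod_range_succ, PowerSeries.coeff_mul]
  have hmem : ((n, 0) : ℕ × ℕ) ∈ Finset.HasAntidiagonal.antidiagonal n := by
    rw [Finset.HasAntidiagonal.mem_antidiagonal]; simp
  refine le_trans ?_ (Finset.single_le_sum (fun x _ => mul_nonneg (prod_nonneg K _) (FF_nonneg K _)) hmem)
  simp [FF]

lemma prod_le (K n : ℕ) : PowerSeries.coeff n (∏ k ∈ Finset.range K, FF k) ≤ p2 n :=
  (prod_mono n).ge_of_tendsto (PP_tendsto n) K

/-- evaluation of one factor -/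
lemma FF_ev (k : ℕ) (q : ℂ) (hq : ‖q‖ < 1) : CV (FF k) q ∧
    ev (FF k) q = if Even k then 1 + q ^ (k + 1) else (1 - q ^ (k + 1))⁻¹ := by
  have hq1 : ‖q ^ (k + 1)‖ < 1 := by rw [norm_pow]; exact pow_lt_one₀ (norm_nonneg _) hq (by omega)
  refine ⟨?_, ?_⟩
  · refine Summable.of_nonneg_of_le (fun _ => norm_nonneg _) (fun n => ?_) (summable_geometric_of_lt_one (norm_nonneg q) hq)
    rw [FF, PowerSeries.coeff_mk, norm_mul, norm_pow]
    split_ifs <;> simp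
  · rw [ev]
    simp only [FF, PowerSeries.coeff_mk]
    split_ifs with hk
    · rw [tsum_eq_sum (s := {0, k + 1})]
      · rw [Finset.sum_pair (by omega)]
        simp
      · intro n hn
        rw [if_neg]
        · simp
        · rintro ⟨h1, h2⟩
          have := h2 hk
          obtain ⟨m, rfl⟩ := h1
          have : m ≤ 1 := by nlinarith
          interval_cases m <;> simp at hn
    · have hinj : Function.Injective (fun m : ℕ => (k + 1) * m) := fun a b h => Nat.eq_of_mul_eq_mul_left (Nat.succ_pos k) h
      rw [← tsum_geometric_of_norm_lt_one hq1, ← hinj.tsum_eq]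
      · apply tsum_congr
        intro m
        simp [hk, pow_mul]
      · intro n hn
        rw [Function.mem_support] at hn
        by_contra hc
        apply hn
        rw [if_neg]
        · simp
        · rintro ⟨⟨m, rfl⟩, -⟩
          exact hc ⟨m, rfl⟩

lemma prod_ev (K : ℕ) (q : ℂ) (hq : ‖q‖ < 1) : CV (∏ k ∈ Finset.range K, FF k) q ∧
    ev (∏ k ∈ Finset.range K, FF k) q = ∏ k ∈ Finset.range K, if Even k then 1 + q ^ (k + 1) else (1 - q ^ (k + 1))⁻¹ := by
  induction K with
  | zero => simpa using ⟨CV_one q, ev_one q⟩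
  | succ K ih =>
    rw [Finset.prod_range_succ, Finset.prod_range_succ]
    exact ⟨CV_mul ih.1 (FF_ev K q hq).1, by rw [ev_mul ih.1 (FF_ev K q hq).1, ih.2, (FF_ev K q hq).2]⟩

noncomputable def cc (q : ℂ) (k m : ℕ) : ℂ :=
  if Even k then -((-q ^ (k + 1)) ^ (m + 1) / ((m + 1 : ℕ) : ℂ)) else (q ^ (k + 1)) ^ (m + 1) / ((m + 1 : ℕ) : ℂ)

lemma cc_norm (q : ℂ) (hq : ‖q‖ < 1) (k m : ℕ) : ‖cc q k m‖ ≤ ‖q‖ ^ k * ‖q‖ ^ m := by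
  have h1 : ‖cc q k m‖ = ‖q‖ ^ ((k + 1) * (m + 1)) / (m + 1) := by
    rw [cc]
    have : ‖((m + 1 : ℕ) : ℂ)‖ = m + 1 := by rw [Complex.norm_natCast]; push_cast; ring
    split_ifs <;> simp only [norm_neg, norm_div, norm_pow, this, ← pow_mul]
  rw [h1, ← pow_add]
  refine (div_le_self (by positivity) (by linarith [(Nat.cast_nonneg m : (0 : ℝ) ≤ m)])).trans ?_
  exact pow_le_pow_of_le_one (norm_nonneg _) hq.le (by nlinarith)

lemma hasSum_congr_fn {f g : ℕ → ℂ} {a : ℂ} (h : HasSum f a) (e : ∀ j, g j = f j) : HasSum g a := by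
  rwa [funext e]

lemma cc_summable (q : ℂ) (hq : ‖q‖ < 1) : Summable fun x : ℕ × ℕ => cc q x.1 x.2 := by
  have hg := summable_geometric_of_lt_one (norm_nonneg q) hq
  have := hg.mul_of_nonneg hg (fun _ => by positivity) (fun _ => by positivity)
  exact Summable.of_norm (Summable.of_nonneg_of_le (fun _ => norm_nonneg _) (fun x => cc_norm q hq _ _) this)

lemma cc_log (q : ℂ) (hq : ‖q‖ < 1) (k : ℕ) :
    (if Even k then 1 + q ^ (k + 1) else (1 - q ^ (k + 1))⁻¹) = Complex.exp (∑' m, cc q k m) := by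
  have hq1 : ‖q ^ (k + 1)‖ < 1 := by rw [norm_pow]; exact pow_lt_one₀ (norm_nonneg _) hq (by omega)
  have hlog : ∀ z : ℂ, ‖z‖ < 1 → HasSum (fun m : ℕ => z ^ (m + 1) / ((m + 1 : ℕ) : ℂ)) (-Complex.log (1 - z)) := by
    intro z hz
    have := (hasSum_nat_add_iff' 1).2 (Complex.hasSum_taylorSeries_neg_log hz)
    simpa using this
  have hne : ∀ z : ℂ, ‖z‖ < 1 → 1 - z ≠ 0 := by
    intro z hz h
    have : z = 1 := by linear_combination -h
    rw [this] at hz; simp at hz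
  simp only [cc]
  split_ifs with hk
  · have h1 : ‖-q ^ (k + 1)‖ < 1 := by rwa [norm_neg]
    rw [(hlog _ h1).neg.tsum_eq, neg_neg, Complex.exp_log (hne _ h1)]; ring
  · rw [(hlog _ hq1).tsum_eq, Complex.exp_neg, Complex.exp_log (hne _ hq1)]

lemma prod_tendsto (q : ℂ) (hq : ‖q‖ < 1) : Filter.Tendsto
    (fun K => ∏ k ∈ Finset.range K, if Even k then 1 + q ^ (k + 1) else (1 - q ^ (k + 1))⁻¹) Filter.atTop
    (nhds (Complex.exp (∑' m, ∑' k, cc q k m))) := by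
  simp only [cc_log q hq, ← Complex.exp_sum]
  apply (Complex.continuous_exp.tendsto _).comp
  have e : ∑' m, ∑' k, cc q k m = ∑' k, ∑' m, cc q k m :=
    Summable.tsum_comm (f := fun k m => cc q k m) (cc_summable q hq)
  rw [e]
  exact (cc_summable q hq).prod.hasSum.tendsto_sum_nat

lemma CV_PP (q : ℂ) (hq : ‖q‖ < 1) : CV PP q := by
  rw [CV]
  have hr : ‖(‖q‖ : ℂ)‖ < 1 := by simpa using hq
  have ht := (prod_tendsto (‖q‖ : ℂ) hr).norm
  obtain ⟨B, hB⟩ := ht.bddAbove_range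
  apply summable_of_sum_range_le (c := B) (fun _ => norm_nonneg _)
  intro M
  have h1 : Filter.Tendsto (fun K => ∑ n ∈ Finset.range M, ‖((PowerSeries.coeff n (∏ k ∈ Finset.range K, FF k) : ℤ) : ℂ) * q ^ n‖) Filter.atTop
      (nhds (∑ n ∈ Finset.range M, ‖((PowerSeries.coeff n PP : ℤ) : ℂ) * q ^ n‖)) := by
    apply tendsto_finsetSum
    intro n _
    have e : PowerSeries.coeff n PP = (p2 n : ℤ) := by rw [PP, PowerSeries.coeff_mk]
    rw [e]
    have hc : Continuous (fun z : ℤ => ‖(z : ℂ) * q ^ n‖) := continuous_of_discreteTopology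
    exact (hc.tendsto _).comp (PP_tendsto n)
  apply le_of_tendsto h1
  filter_upwards with K
  obtain ⟨hcv, hev⟩ := prod_ev K (‖q‖ : ℂ) hr
  have h2 : ‖ev (∏ k ∈ Finset.range K, FF k) (‖q‖ : ℂ)‖ ≤ B := by
    rw [hev]; exact hB ⟨K, rfl⟩
  refine le_trans ?_ h2
  have h3 : ∀ n, ((PowerSeries.coeff n (∏ k ∈ Finset.range K, FF k) : ℤ) : ℂ) * (‖q‖ : ℂ) ^ n
      = ((‖((PowerSeries.coeff n (∏ k ∈ Finset.range K, FF k) : ℤ) : ℂ) * q ^ n‖ : ℝ) : ℂ) := by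
    intro n
    rw [norm_mul, norm_pow, Complex.norm_intCast, abs_of_nonneg (by exact_mod_cast prod_nonneg K n)]
    push_cast; ring
  rw [ev]
  simp only [h3]
  rw [← Complex.ofReal_tsum, Complex.norm_real, Real.norm_eq_abs]
  refine le_trans ?_ (le_abs_self _)
  apply Summable.sum_le_tsum _ (fun _ _ => norm_nonneg _)
  have := hcv
  rw [CV] at this
  refine this.congr ?_
  intro n
  rw [norm_mul, norm_mul, norm_pow, norm_pow, Complex.norm_real, norm_norm]

lemma PP_exp (q : ℂ) (hq : ‖q‖ < 1) : ev PP q = Complex.exp (∑' m, ∑' k, cc q k m) := by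
  refine tendsto_nhds_unique ?_ (prod_tendsto q hq)
  simp only [← fun K => (prod_ev K q hq).2]
  rw [ev]
  have e : ∀ n, PowerSeries.coeff n PP = (p2 n : ℤ) := fun n => by rw [PP, PowerSeries.coeff_mk]
  simp only [ev]
  apply tendsto_tsum_of_dominated_convergence (CV_PP q hq)
  · intro n
    rw [e]
    have hc : Continuous (fun z : ℤ => (z : ℂ) * q ^ n) := continuous_of_discreteTopology
    exact (hc.tendsto _).comp (PP_tendsto n)
  · filter_upwards with K
    intro n
    rw [norm_mul, norm_mul, e]
    apply mul_le_mul_of_nonneg_right _ (norm_nonneg _)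
    rw [Complex.norm_intCast, Complex.norm_intCast, abs_of_nonneg (by exact_mod_cast prod_nonneg K n), Int.cast_natCast, Nat.abs_cast]
    exact_mod_cast prod_le K n

lemma cc_even (q : ℂ) (m j : ℕ) : cc q (2 * j) m =
    ((-1) ^ m * q ^ (m + 1)) * (((-1) ^ m * q ^ (m + 1)) ^ 2) ^ j / ((m + 1 : ℕ) : ℂ) := by
  have h1 : ((-1 : ℂ) ^ m) ^ 2 = 1 := by rw [← pow_mul, mul_comm, pow_mul]; simp
  have h2 : (-1 : ℂ) ^ (m + 1) = - (-1) ^ m := by rw [pow_succ]; ring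
  rw [cc, if_pos (even_two_mul j), ← neg_div, neg_pow, h2, mul_pow _ _ 2, h1]
  congr 1
  rw [one_mul, ← pow_mul, ← pow_mul, ← pow_mul, mul_assoc, ← pow_add, neg_mul, neg_neg]
  congr 2; ring

lemma cc_odd (q : ℂ) (m j : ℕ) : cc q (2 * j + 1) m =
    ((-1) ^ m * q ^ (m + 1)) ^ 2 * (((-1) ^ m * q ^ (m + 1)) ^ 2) ^ j / ((m + 1 : ℕ) : ℂ) := by
  have h1 : ((-1 : ℂ) ^ m) ^ 2 = 1 := by rw [← pow_mul, mul_comm, pow_mul]; simp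
  have hno : ¬ Even (2 * j + 1) := by simp
  rw [cc, if_neg hno, mul_pow _ _ 2, h1]
  congr 1
  rw [one_mul, ← pow_mul, ← pow_mul, ← pow_mul, ← pow_add]
  congr 1; ring

lemma cc_sum (q : ℂ) (hq : ‖q‖ < 1) (m : ℕ) : ∑' k, cc q k m =
    ((-1) ^ m * q ^ (m + 1)) / (1 - (-1) ^ m * q ^ (m + 1)) / ((m + 1 : ℕ) : ℂ) := by
  obtain ⟨u, hu⟩ : ∃ u : ℂ, u = (-1) ^ m * q ^ (m + 1) := ⟨_, rfl⟩
  rw [← hu]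
  have hun : ‖u‖ < 1 := by
    rw [hu, norm_mul, norm_pow, norm_pow, norm_neg, norm_one, one_pow, one_mul]
    exact pow_lt_one₀ (norm_nonneg _) hq (by omega)
  have hu2n : ‖u ^ 2‖ < 1 := by rw [norm_pow]; exact pow_lt_one₀ (norm_nonneg _) hun (by omega)
  have hne : ∀ z : ℂ, ‖z‖ < 1 → 1 - z ≠ 0 := by
    intro z hz h
    have : z = 1 := by linear_combination -h
    rw [this] at hz; simp at hz
  have hg := hasSum_geometric_of_norm_lt_one hu2n
  have he : HasSum (fun j => cc q (2 * j) m) (u * (1 - u ^ 2)⁻¹ / ((m + 1 : ℕ) : ℂ)) := by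
    refine hasSum_congr_fn ((hg.mul_left u).div_const ((m + 1 : ℕ) : ℂ)) ?_
    intro j
    rw [cc_even, ← hu]
  have ho : HasSum (fun j => cc q (2 * j + 1) m) (u ^ 2 * (1 - u ^ 2)⁻¹ / ((m + 1 : ℕ) : ℂ)) := by
    refine hasSum_congr_fn ((hg.mul_left (u ^ 2)).div_const ((m + 1 : ℕ) : ℂ)) ?_
    intro j
    rw [cc_odd, ← hu]
  have h1 := hne u hun
  have h2 := hne _ hu2n
  have h3 : (1 : ℂ) + u ≠ 0 := by
    have := hne (-u) (by rwa [norm_neg])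
    rwa [sub_neg_eq_add] at this
  have hs := (HasSum.even_add_odd (f := fun k => cc q k m) he ho).tsum_eq
  refine hs.trans ?_
  rw [← add_div]
  congr 1
  rw [show (1 : ℂ) - u ^ 2 = (1 - u) * (1 + u) by ring]
  field_simp

lemma PP_norm (q : ℂ) (hq : ‖q‖ < 1) :
    Summable (fun m : ℕ => (((-1) ^ m * q ^ (m + 1)) / (1 - (-1) ^ m * q ^ (m + 1))).re / (m + 1)) ∧
    ‖ev PP q‖ = Real.exp (∑' m : ℕ, (((-1) ^ m * q ^ (m + 1)) / (1 - (-1) ^ m * q ^ (m + 1))).re / (m + 1)) := by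
  have hs : Summable fun m => ∑' k, cc q k m := (cc_summable q hq).prod_symm.prod
  have hre : ∀ m, (∑' k, cc q k m).re = (((-1) ^ m * q ^ (m + 1)) / (1 - (-1) ^ m * q ^ (m + 1))).re / (m + 1) := by
    intro m
    rw [cc_sum q hq m, Complex.div_natCast_re]; push_cast; rfl
  have hs2 := (Complex.hasSum_re hs.hasSum)
  simp only [hre] at hs2
  refine ⟨hs2.summable, ?_⟩
  rw [PP_exp q hq, Complex.norm_exp, hs2.tsum_eq]

/-- evaluate a power series given as a formal sum of signed monomials -/
lemma fiber {ι : Type} (f : PowerSeries ℤ) (e : ι → ℕ) (ε : ι → ℤ) (q : ℂ)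
    (hε : ∀ i, |ε i| ≤ 1) (hs : Summable fun i => ‖q‖ ^ (e i))
    (hc : ∀ n, ∃ s : Finset ι, (∀ i, e i = n → i ∈ s) ∧ PowerSeries.coeff n f = ∑ i ∈ s, if e i = n then ε i else 0) :
    ev f q = ∑' i, (ε i : ℂ) * q ^ (e i) := by
  have hb : ∀ i, ‖(ε i : ℂ) * q ^ (e i)‖ ≤ ‖q‖ ^ (e i) := by
    intro i
    rw [norm_mul, norm_pow, Complex.norm_intCast]
    have : |(ε i : ℝ)| ≤ 1 := by exact_mod_cast hε i
    exact mul_le_of_le_one_left (by positivity) this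
  have hF : Summable fun x : ι × ℕ => (if e x.1 = x.2 then (ε x.1 : ℂ) * q ^ (e x.1) else 0) := by
    apply Summable.of_norm
    rw [summable_prod_of_nonneg (fun _ => norm_nonneg _)]
    constructor
    · intro i
      apply summable_of_ne_finset_zero (s := {e i})
      intro n hn
      have : e i ≠ n := by rintro rfl; simp at hn
      simp [this]
    · refine Summable.of_nonneg_of_le (fun _ => tsum_nonneg (fun _ => norm_nonneg _)) (fun i => ?_) hs
      rw [tsum_eq_single (e i)]
      · simpa using hb i
      · intro n hn; simp [hn.symm]
  have h1 := Summable.tsum_comm (f := fun i n => if e i = n then (ε i : ℂ) * q ^ (e i) else 0) hF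
  have h2 : ∀ i, ∑' n, (if e i = n then (ε i : ℂ) * q ^ (e i) else 0) = (ε i : ℂ) * q ^ (e i) := by
    intro i
    rw [tsum_eq_single (e i)]
    · simp
    · intro n hn; rw [if_neg hn.symm]
  simp only [h2] at h1
  rw [← h1, ev]
  apply tsum_congr
  intro n
  obtain ⟨s, hs1, hs2⟩ := hc n
  rw [hs2, tsum_eq_sum (s := s)]
  · push_cast
    rw [Finset.sum_mul]
    apply Finset.sum_congr rfl
    intro i _
    by_cases h : e i = n
    · simp [h]
    · simp [h]
  · intro i hi
    rw [if_neg]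
    intro h; exact hi (hs1 i h)

lemma ev_Th (r : ℕ) (q : ℂ) (hq : ‖q‖ < 1) : ev (Th r) q = ∑' k : ℕ, (-1 : ℂ) ^ k * q ^ (ex k r) := by
  rw [fiber (Th r) (fun k => ex k r) (fun k => (-1) ^ k) q]
  · simp
  · intro i; simp
  · refine Summable.of_nonneg_of_le (fun _ => by positivity) (fun k => ?_) (summable_geometric_of_lt_one (norm_nonneg q) hq)
    exact pow_le_pow_of_le_one (norm_nonneg _) hq.le (ex_gt k r).le
  · intro n
    refine ⟨Finset.range n, ?_, Th_coeff r n n le_rfl⟩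
    intro k hk
    have := ex_gt k r
    simp; omega

lemma ex_ge' (a k j : ℕ) : k + 18 * j ≤ ex k (a + 9 * j) := by
  simp only [ex]; have := Nat.zero_le (2 * k ^ 2); have := Nat.zero_le (2 * (a + 9 * j) * k); omega

lemma geo_two (q : ℂ) (hq : ‖q‖ < 1) : HasSum (fun x : ℕ × ℕ => ‖q‖ ^ x.1 * (‖q‖ ^ 18) ^ x.2)
    ((1 - ‖q‖)⁻¹ * (1 - ‖q‖ ^ 18)⁻¹) := by
  have h18 : ‖q‖ ^ 18 < 1 := pow_lt_one₀ (norm_nonneg _) hq (by omega)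
  have h1 := hasSum_geometric_of_lt_one (norm_nonneg q) hq
  have h2 := hasSum_geometric_of_lt_one (by positivity) h18
  exact h1.mul h2 (h1.summable.mul_of_nonneg h2.summable (fun _ => by positivity) (fun _ => by positivity))

lemma UU_le (a : ℕ) (q : ℂ) (hq : ‖q‖ < 1) (x : ℕ × ℕ) : ‖q‖ ^ (ex x.1 (a + 9 * x.2)) ≤ ‖q‖ ^ x.1 * (‖q‖ ^ 18) ^ x.2 := by
  rw [← pow_mul, ← pow_add]
  exact pow_le_pow_of_le_one (norm_nonneg _) hq.le (ex_ge' a _ _)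

lemma UU_summable (a : ℕ) (q : ℂ) (hq : ‖q‖ < 1) : Summable fun x : ℕ × ℕ => ‖q‖ ^ (ex x.1 (a + 9 * x.2)) :=
  Summable.of_nonneg_of_le (fun _ => by positivity) (UU_le a q hq) (geo_two q hq).summable

lemma ev_UU (a : ℕ) (q : ℂ) (hq : ‖q‖ < 1) :
    ev (UU a) q = ∑' x : ℕ × ℕ, (-1 : ℂ) ^ x.1 * q ^ (ex x.1 (a + 9 * x.2)) := by
  rw [fiber (UU a) (fun x : ℕ × ℕ => ex x.1 (a + 9 * x.2)) (fun x => (-1) ^ x.1) q]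
  · simp
  · intro i; simp
  · exact UU_summable a q hq
  · intro n
    refine ⟨Finset.range n ×ˢ Finset.range (n + 1), ?_, ?_⟩
    · intro x hx
      have h1 := ex_gt x.1 (a + 9 * x.2)
      have h2 := ex_ge x.1 (a + 9 * x.2)
      simp only [Finset.mem_product, Finset.mem_range]
      omega
    · rw [UU_coeff a n (n + 1) le_rfl, Finset.sum_product_right]
      apply Finset.sum_congr rfl
      intro j _
      exact Th_coeff _ n n le_rfl

lemma UU_norm (a : ℕ) (q : ℂ) (hq : ‖q‖ < 1) : ‖ev (UU a) q‖ ≤ (1 - ‖q‖)⁻¹ * (1 - ‖q‖ ^ 18)⁻¹ := by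
  rw [ev_UU a q hq]
  apply tsum_of_norm_bounded (geo_two q hq)
  intro x
  rw [norm_mul, norm_pow, norm_neg, norm_one, one_pow, one_mul, norm_pow]
  exact UU_le a q hq x

lemma LL_norm (ρ σ : ℕ) (q : ℂ) (hq : ‖q‖ < 1) : ‖ev (LL ρ σ) q‖ ≤ 8 * ((1 - ‖q‖)⁻¹ * (1 - ‖q‖ ^ 18)⁻¹) := by
  have c := fun a => CV_UU a q hq
  have b := fun a => UU_norm a q hq
  rw [LL, ev_sub (CV_sub (CV_add (CV_sub (c _) (c _)) (c _)) (c _)) (CV_sub (CV_add (CV_sub (c _) (c _)) (c _)) (c _)),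
   ev_sub (CV_add (CV_sub (c _) (c _)) (c _)) (c _), ev_add (CV_sub (c _) (c _)) (c _), ev_sub (c _) (c _),
   ev_sub (CV_add (CV_sub (c _) (c _)) (c _)) (c _), ev_add (CV_sub (c _) (c _)) (c _), ev_sub (c _) (c _)]
  refine (norm_sub_le _ _).trans ?_
  have h1 := (norm_sub_le (ev (UU ρ) q - ev (UU (ρ + 1)) q + ev (UU (9 - ρ)) q) (ev (UU (10 - ρ)) q))
  have h2 := (norm_add_le (ev (UU ρ) q - ev (UU (ρ + 1)) q) (ev (UU (9 - ρ)) q))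
  have h3 := (norm_sub_le (ev (UU ρ) q) (ev (UU (ρ + 1)) q))
  have h4 := (norm_sub_le (ev (UU σ) q - ev (UU (σ + 1)) q + ev (UU (9 - σ)) q) (ev (UU (10 - σ)) q))
  have h5 := (norm_add_le (ev (UU σ) q - ev (UU (σ + 1)) q) (ev (UU (9 - σ)) q))
  have h6 := (norm_sub_le (ev (UU σ) q) (ev (UU (σ + 1)) q))
  linarith [b ρ, b (ρ + 1), b (9 - ρ), b (10 - ρ), b σ, b (σ + 1), b (9 - σ), b (10 - σ)]

lemma UU_hasSum (a : ℕ) (s : ℂ) (hs : 0 < s.re) :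
    HasSum (fun k : ℕ => (-1 : ℂ) ^ k * (Complex.exp (-2 * (k + 1) ^ 2 * s) *
      (Complex.exp (-((k + 1) * s) * (2 * a - 10)) / (2 * Complex.sinh (9 * ((k + 1) * s))))))
      (ev (UU a) (Complex.exp (-s))) := by
  have hq : ‖Complex.exp (-s)‖ < 1 := by
    rw [Complex.norm_exp, Real.exp_lt_one_iff]; simpa using hs
  have hsum : Summable fun x : ℕ × ℕ => (-1 : ℂ) ^ x.1 * (Complex.exp (-s)) ^ (ex x.1 (a + 9 * x.2)) := by
    apply Summable.of_norm
    refine (UU_summable a _ hq).congr ?_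
    intro x
    rw [norm_mul, norm_pow, norm_neg, norm_one, one_pow, one_mul, norm_pow]
  have h := hsum.hasSum.prod_fiberwise (g := fun k : ℕ => (-1 : ℂ) ^ k * (Complex.exp (-2 * (k + 1) ^ 2 * s) *
      (Complex.exp (-((k + 1) * s) * (2 * a - 10)) / (2 * Complex.sinh (9 * ((k + 1) * s)))))) ?_
  · rw [← ev_UU a _ hq] at h; exact h
  · intro k
    have hk : ‖Complex.exp (-(18 * ((k + 1) * s)))‖ < 1 := by
      rw [Complex.norm_exp, Real.exp_lt_one_iff]
      have : (-(18 * (((k : ℂ) + 1) * s))).re = -(18 * ((k + 1) * s.re)) := by simp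
      rw [this]
      have : 0 < ((k : ℝ) + 1) * s.re := by positivity
      linarith
    have hg := (hasSum_geometric_of_norm_lt_one hk).mul_left ((-1 : ℂ) ^ k * Complex.exp (-2 * (k + 1) ^ 2 * s - ((k + 1) * s) * (2 * a - 1)))
    have e1 : (1 - Complex.exp (-(18 * ((k + 1) * s)))) = Complex.exp (-(9 * ((k + 1) * s))) * (2 * Complex.sinh (9 * ((k + 1) * s))) := by
      rw [Complex.sinh, mul_div_cancel₀ _ (two_ne_zero), mul_sub, ← Complex.exp_add, ← Complex.exp_add]
      congr 1
      · rw [neg_add_cancel, Complex.exp_zero]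
      · congr 1; ring
    have e2 : (-1 : ℂ) ^ k * (Complex.exp (-2 * (k + 1) ^ 2 * s) *
      (Complex.exp (-((k + 1) * s) * (2 * a - 10)) / (2 * Complex.sinh (9 * ((k + 1) * s))))) =
      (-1 : ℂ) ^ k * Complex.exp (-2 * (k + 1) ^ 2 * s - ((k + 1) * s) * (2 * a - 1)) * (1 - Complex.exp (-(18 * ((k + 1) * s))))⁻¹ := by
      rw [e1, mul_inv, ← Complex.exp_neg, div_eq_mul_inv]
      have e3 : Complex.exp (-2 * (k + 1) ^ 2 * s) * Complex.exp (-((k + 1) * s) * (2 * a - 10)) =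
        Complex.exp (-2 * (k + 1) ^ 2 * s - ((k + 1) * s) * (2 * a - 1)) * Complex.exp (- -(9 * ((k + 1) * s))) := by
        rw [← Complex.exp_add, ← Complex.exp_add]; congr 1; ring
      linear_combination (-1 : ℂ) ^ k * (2 * Complex.sinh (9 * ((k + 1) * s)))⁻¹ * e3
    · change HasSum (fun c : ℕ => (-1 : ℂ) ^ k * (Complex.exp (-s)) ^ (ex k (a + 9 * c))) _
      rw [e2]
      refine hasSum_congr_fn hg ?_
      intro j
      rw [mul_assoc, ← Complex.exp_nat_mul, ← Complex.exp_nat_mul, ← Complex.exp_add]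
      congr 2
      simp only [ex]; push_cast; ring

/-- the kernel function -/
noncomputable def HH (α β γ : ℕ) (u : ℂ) : ℂ :=
  4 * (Complex.sinh (α * u) * Complex.sinh (β * u) * Complex.sinh (γ * u)) / Complex.sinh (9 * u)

lemma LL_hasSum (ρ σ : ℕ) (s : ℂ) (hs : 0 < s.re) (α β γ : ℕ) (hid : ∀ v : ℂ,
    (Complex.exp (-v * (2 * ρ - 10)) - Complex.exp (-v * (2 * (ρ + 1 : ℕ) - 10)) + Complex.exp (-v * (2 * (9 - ρ : ℕ) - 10))
     - Complex.exp (-v * (2 * (10 - ρ : ℕ) - 10))) - 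
    (Complex.exp (-v * (2 * σ - 10)) - Complex.exp (-v * (2 * (σ + 1 : ℕ) - 10)) + Complex.exp (-v * (2 * (9 - σ : ℕ) - 10))
     - Complex.exp (-v * (2 * (10 - σ : ℕ) - 10))) = 2 * (4 * (Complex.sinh (α * v) * Complex.sinh (β * v) * Complex.sinh (γ * v)))) :
    HasSum (fun k : ℕ => (-1 : ℂ) ^ k * (Complex.exp (-2 * (k + 1) ^ 2 * s) * HH α β γ ((k + 1) * s)))
      (ev (LL ρ σ) (Complex.exp (-s))) := by
  have hq : ‖Complex.exp (-s)‖ < 1 := by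
    rw [Complex.norm_exp, Real.exp_lt_one_iff]; simpa using hs
  have c := fun a => CV_UU a _ hq
  have b := fun a => UU_hasSum a s hs
  rw [LL, ev_sub (CV_sub (CV_add (CV_sub (c _) (c _)) (c _)) (c _)) (CV_sub (CV_add (CV_sub (c _) (c _)) (c _)) (c _)),
   ev_sub (CV_add (CV_sub (c _) (c _)) (c _)) (c _), ev_add (CV_sub (c _) (c _)) (c _), ev_sub (c _) (c _),
   ev_sub (CV_add (CV_sub (c _) (c _)) (c _)) (c _), ev_add (CV_sub (c _) (c _)) (c _), ev_sub (c _) (c _)]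
  have h := ((((b ρ).sub (b (ρ + 1))).add (b (9 - ρ))).sub (b (10 - ρ))).sub ((((b σ).sub (b (σ + 1))).add (b (9 - σ))).sub (b (10 - σ)))
  refine hasSum_congr_fn h ?_
  intro k
  have := hid ((k + 1) * s)
  rw [← mul_sub, ← mul_add, ← mul_sub, ← mul_sub, ← mul_add, ← mul_sub, ← mul_sub]
  rw [← mul_sub, ← mul_add, ← mul_sub, ← mul_sub, ← mul_add, ← mul_sub, ← mul_sub]
  congr 2
  rw [← sub_div, ← add_div, ← sub_div, ← sub_div, ← add_div, ← sub_div, ← sub_div, this, HH, mul_div_mul_left _ _ two_ne_zero]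

lemma LL_a (s : ℂ) (hs : 0 < s.re) :
    HasSum (fun k : ℕ => (-1 : ℂ) ^ k * (Complex.exp (-2 * (k + 1) ^ 2 * s) * HH 1 3 6 ((k + 1) * s)))
      (ev (LL 0 3) (Complex.exp (-s))) := by
  apply LL_hasSum 0 3 s hs
  intro v
  simp only [Complex.sinh]
  ring_nf
  simp only [← Complex.exp_add]
  ring_nf

lemma LL_b (s : ℂ) (hs : 0 < s.re) :
    HasSum (fun k : ℕ => (-1 : ℂ) ^ k * (Complex.exp (-2 * (k + 1) ^ 2 * s) * HH 1 1 6 ((k + 1) * s)))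
      (ev (LL 1 2) (Complex.exp (-s))) := by
  apply LL_hasSum 1 2 s hs
  intro v
  simp only [Complex.sinh]
  push_cast
  ring_nf
  simp only [← Complex.exp_add, ← Complex.exp_nat_mul]
  push_cast
  ring_nf

lemma LL_c (s : ℂ) (hs : 0 < s.re) :
    HasSum (fun k : ℕ => (-1 : ℂ) ^ k * (Complex.exp (-2 * (k + 1) ^ 2 * s) * HH 1 2 3 ((k + 1) * s)))
      (ev (LL 2 4) (Complex.exp (-s))) := by
  apply LL_hasSum 2 4 s hs
  intro v
  simp only [Complex.sinh]
  push_cast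
  ring_nf
  simp only [← Complex.exp_add]
  ring_nf

lemma exp_half_pi : Complex.exp (Real.pi * Complex.I / 2) = Complex.I := by
  rw [show (Real.pi * Complex.I / 2 : ℂ) = (Real.pi / 2) * Complex.I by ring, Complex.exp_pi_div_two_mul_I]

lemma hasSum_Th (r : ℕ) (q : ℂ) (hq : ‖q‖ < 1) : HasSum (fun k : ℕ => (-1 : ℂ) ^ k * q ^ (ex k r)) (ev (Th r) q) := by
  rw [ev_Th r q hq]
  apply Summable.hasSum
  apply Summable.of_norm
  refine Summable.of_nonneg_of_le (fun _ => by positivity) (fun k => ?_) (summable_geometric_of_lt_one (norm_nonneg q) hq)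
  rw [norm_mul, norm_pow, norm_neg, norm_one, one_pow, one_mul, norm_pow]
  exact pow_le_pow_of_le_one (norm_nonneg _) hq.le (ex_gt k r).le

lemma norm_exp_lt_one (s : ℂ) (hs : 0 < s.re) : ‖Complex.exp (-s)‖ < 1 := by
  rw [Complex.norm_exp, Real.exp_lt_one_iff]; simpa using hs

lemma neg_one_pow_exp (k : ℕ) : Complex.exp (Real.pi * Complex.I * k) = (-1) ^ k := by
  rw [mul_comm, Complex.exp_nat_mul, Complex.exp_pi_mul_I]

lemma neg_one_pow_exp' (k : ℕ) : Complex.exp (-(Real.pi * Complex.I * k)) = (-1) ^ k := by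
  rw [Complex.exp_neg, neg_one_pow_exp, ← inv_pow]; norm_num

lemma psi_theta (s : ℂ) (hs : 0 < s.re) : ev (1 - Th 0 - Th 1) (Complex.exp (-s)) =
    jacobiTheta₂ (1 / 2 + Complex.I * s / (2 * Real.pi)) (2 * Complex.I * s / Real.pi) := by
  have hq := norm_exp_lt_one s hs
  have hpi : (Real.pi : ℂ) ≠ 0 := by exact_mod_cast Real.pi_ne_zero
  rw [ev_sub (CV_sub (CV_one _) (CV_Th _ _ hq)) (CV_Th _ _ hq), ev_sub (CV_one _) (CV_Th _ _ hq), ev_one]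
  have hterm : ∀ n : ℤ, jacobiTheta₂_term n (1 / 2 + Complex.I * s / (2 * Real.pi)) (2 * Complex.I * s / Real.pi)
      = Complex.exp (Real.pi * Complex.I * n - (2 * n ^ 2 + n) * s) := by
    intro n
    rw [jacobiTheta₂_term]
    congr 1
    field_simp
    linear_combination (n * s + 2 * n ^ 2 * s) * Complex.I_sq
  have key : HasSum (fun n : ℤ => Complex.exp (Real.pi * Complex.I * n - (2 * n ^ 2 + n) * s))
      (-ev (Th 1) (Complex.exp (-s)) + Complex.exp (Real.pi * Complex.I * (0 : ℤ) - (2 * (0 : ℤ) ^ 2 + (0 : ℤ)) * s) + -ev (Th 0) (Complex.exp (-s))) := by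
    apply HasSum.of_add_one_of_neg_add_one
    · refine hasSum_congr_fn (hasSum_Th 1 _ hq).neg ?_
      intro k
      rw [← Complex.exp_nat_mul, sub_eq_add_neg, Complex.exp_add]
      have : Complex.exp (Real.pi * Complex.I * ((k + 1 : ℤ) : ℂ)) = - (-1) ^ k := by
        have := neg_one_pow_exp (k + 1)
        rw [pow_succ] at this
        push_cast at this ⊢
        rw [this]; ring
      rw [this, neg_mul]
      congr 3
      simp only [ex]; push_cast; ring
    · refine hasSum_congr_fn (hasSum_Th 0 _ hq).neg ?_
      intro k
      rw [← Complex.exp_nat_mul, sub_eq_add_neg, Complex.exp_add]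
      have : Complex.exp (Real.pi * Complex.I * ((-(k + 1) : ℤ) : ℂ)) = - (-1) ^ k := by
        have := neg_one_pow_exp' (k + 1)
        rw [pow_succ] at this
        push_cast at this ⊢
        rw [mul_neg, this]; ring
      rw [this, neg_mul]
      congr 3
      simp only [ex]; push_cast; ring
  have hτ : 0 < (2 * Complex.I * s / Real.pi).im := by
    rw [show 2 * Complex.I * s / Real.pi = ((2 / Real.pi : ℝ) : ℂ) * (Complex.I * s) by push_cast; ring, Complex.im_ofReal_mul]
    have : (Complex.I * s).im = s.re := by simp
    rw [this]; positivity
  have h0 := hasSum_jacobiTheta₂_term (1 / 2 + Complex.I * s / (2 * Real.pi)) hτ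
  simp only [hterm] at h0
  have := h0.unique key
  rw [this]
  have e0 : Complex.exp (Real.pi * Complex.I * (0 : ℤ) - (2 * (0 : ℤ) ^ 2 + (0 : ℤ)) * s) = 1 := by simp
  rw [e0]; ring

/-- the dual theta series -/
lemma dual_theta (s : ℂ) (hs : 0 < s.re) (hR : 1 ≤ (1 / s).re) :
    ∃ δ : ℂ, ‖δ‖ ≤ 4 * Real.exp (-(Real.pi ^ 2 * (1 / s).re)) ∧
    jacobiTheta₂ ((1 / 2 + Complex.I * s / (2 * Real.pi)) / (2 * Complex.I * s / Real.pi)) (-1 / (2 * Complex.I * s / Real.pi)) =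
    (1 + Complex.I) * (1 + δ) := by
  have hpi : (Real.pi : ℂ) ≠ 0 := by exact_mod_cast Real.pi_ne_zero
  have hs0 : s ≠ 0 := by rintro rfl; simp at hs
  set R := (1 / s).re with hRdef
  set y := Real.exp (-(Real.pi ^ 2 * R)) with hy
  have hy0 : 0 < y := Real.exp_pos _
  have hpi3 := Real.pi_gt_three
  have hy1 : y ≤ 1 / 2 := by
    rw [hy, Real.exp_neg, one_div]
    apply inv_anti₀ two_pos
    have := Real.add_one_le_exp (Real.pi ^ 2 * R)
    nlinarith
  have hterm : ∀ n : ℤ, jacobiTheta₂_term n ((1 / 2 + Complex.I * s / (2 * Real.pi)) / (2 * Complex.I * s / Real.pi)) (-1 / (2 * Complex.I * s / Real.pi))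
      = Complex.exp (Real.pi * Complex.I / 2 * n + (Real.pi ^ 2 / 2 * (n - n ^ 2) : ℝ) * (1 / s)) := by
    intro n
    rw [jacobiTheta₂_term]
    congr 1
    push_cast
    field_simp
    ring
  have hτ : 0 < (-1 / (2 * Complex.I * s / Real.pi)).im := by
    have : (-1 / (2 * Complex.I * s / Real.pi)) = ((Real.pi / 2 : ℝ) : ℂ) * (Complex.I * (1 / s)) := by
      push_cast
      field_simp
      linear_combination (-1 : ℂ) * Complex.I_sq
    rw [this, Complex.im_ofReal_mul]
    have : (Complex.I * (1 / s)).im = R := by rw [Complex.I_mul_im]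
    rw [this]; positivity
  have h0 := hasSum_jacobiTheta₂_term ((1 / 2 + Complex.I * s / (2 * Real.pi)) / (2 * Complex.I * s / Real.pi)) hτ
  have h1 := ((Equiv.addRight (1 : ℤ)).hasSum_iff.2 h0).nat_add_neg_add_one
  simp only [Function.comp, Equiv.coe_addRight, hterm] at h1
  have h2 := (hasSum_nat_add_iff' 1).2 h1
  rw [Finset.sum_range_one] at h2
  have e0 : Complex.exp (Real.pi * Complex.I / 2 * ((((0 : ℕ) : ℤ) + 1 : ℤ) : ℂ) + (Real.pi ^ 2 / 2 * (((((0 : ℕ) : ℤ) + 1 : ℤ) : ℝ) - ((((0 : ℕ) : ℤ) + 1 : ℤ) : ℝ) ^ 2) : ℝ) * (1 / s))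
     + Complex.exp (Real.pi * Complex.I / 2 * (((-(((0 : ℕ) : ℤ) + 1) + 1 : ℤ)) : ℂ) + (Real.pi ^ 2 / 2 * (((-(((0 : ℕ) : ℤ) + 1) + 1 : ℤ) : ℝ) - ((-(((0 : ℕ) : ℤ) + 1) + 1 : ℤ) : ℝ) ^ 2) : ℝ) * (1 / s))
     = 1 + Complex.I := by
    have := exp_half_pi
    simp [this]; ring
  rw [e0] at h2
  have hg : HasSum (fun n : ℕ => 2 * y * y ^ n) (2 * y * (1 - y)⁻¹) :=
    (hasSum_geometric_of_lt_one hy0.le (by linarith)).mul_left _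
  have hbase : ∀ (a b : ℝ) (m : ℕ), b ≤ -(Real.pi ^ 2 * (m + 1)) → ‖Complex.exp (Real.pi * Complex.I / 2 * a + (b : ℝ) * (1 / s))‖ ≤ y * y ^ m := by
    intro a b m hb
    rw [Complex.norm_exp, hy, ← Real.exp_nat_mul, ← Real.exp_add]
    apply Real.exp_le_exp.2
    have : (Real.pi * Complex.I / 2 * a + (b : ℝ) * (1 / s)).re = b * R := by
      rw [Complex.add_re, Complex.re_ofReal_mul, ← hRdef]
      have : (Real.pi * Complex.I / 2 * a : ℂ) = ((Real.pi * a / 2 : ℝ) : ℂ) * Complex.I := by push_cast; ring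
      rw [this, Complex.re_ofReal_mul]; simp
    rw [this]
    nlinarith
  have hnorm := tsum_of_norm_bounded hg (f := fun n : ℕ => Complex.exp (Real.pi * Complex.I / 2 * ((((n + 1 : ℕ) : ℤ) + 1 : ℤ) : ℂ) + (Real.pi ^ 2 / 2 * (((((n + 1 : ℕ) : ℤ) + 1 : ℤ) : ℝ) - ((((n + 1 : ℕ) : ℤ) + 1 : ℤ) : ℝ) ^ 2) : ℝ) * (1 / s))
     + Complex.exp (Real.pi * Complex.I / 2 * (((-(((n + 1 : ℕ) : ℤ) + 1) + 1 : ℤ)) : ℂ) + (Real.pi ^ 2 / 2 * (((-(((n + 1 : ℕ) : ℤ) + 1) + 1 : ℤ) : ℝ) - ((-(((n + 1 : ℕ) : ℤ) + 1) + 1 : ℤ) : ℝ) ^ 2) : ℝ) * (1 / s))) ?_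
  · rw [h2.tsum_eq] at hnorm
    set θ := jacobiTheta₂ ((1 / 2 + Complex.I * s / (2 * Real.pi)) / (2 * Complex.I * s / Real.pi)) (-1 / (2 * Complex.I * s / Real.pi))
    have hI : (1 : ℂ) + Complex.I ≠ 0 := by
      intro h
      have := congrArg Complex.re h
      simp at this
    have hI1 : 1 ≤ ‖(1 : ℂ) + Complex.I‖ := by
      have := Complex.abs_re_le_norm ((1 : ℂ) + Complex.I)
      simpa using this
    refine ⟨(θ - (1 + Complex.I)) / (1 + Complex.I), ?_, ?_⟩
    · rw [norm_div]
      refine (div_le_self (norm_nonneg _) hI1).trans (hnorm.trans ?_)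
      have : (1 - y)⁻¹ ≤ 2 := by
        rw [inv_le_comm₀ (by linarith) two_pos]; linarith
      nlinarith
    · field_simp; ring
  · intro n
    have hn : (0 : ℝ) ≤ n := n.cast_nonneg
    have hp := sq_nonneg Real.pi
    refine (norm_add_le _ _).trans ?_
    have a1 := hbase ((((n + 1 : ℕ) : ℤ) + 1 : ℤ) : ℝ) (Real.pi ^ 2 / 2 * (((((n + 1 : ℕ) : ℤ) + 1 : ℤ) : ℝ) - ((((n + 1 : ℕ) : ℤ) + 1 : ℤ) : ℝ) ^ 2)) n (by
      push_cast; nlinarith [mul_nonneg hp hn, mul_nonneg (mul_nonneg hp hn) hn])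
    have a2 := hbase ((-(((n + 1 : ℕ) : ℤ) + 1) + 1 : ℤ) : ℝ) (Real.pi ^ 2 / 2 * (((-(((n + 1 : ℕ) : ℤ) + 1) + 1 : ℤ) : ℝ) - ((-(((n + 1 : ℕ) : ℤ) + 1) + 1 : ℤ) : ℝ) ^ 2)) n (by
      push_cast; nlinarith [mul_nonneg hp hn, mul_nonneg (mul_nonneg hp hn) hn])
    rw [Complex.ofReal_intCast] at a1 a2
    linarith

/-- P in terms of the modular variable -/
lemma PP_modular (s : ℂ) (hs : 0 < s.re) (hR : 1 ≤ (1 / s).re) :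
    ∃ δ : ℂ, ‖δ‖ ≤ 4 * Real.exp (-(Real.pi ^ 2 * (1 / s).re)) ∧
    ev PP (Complex.exp (-s)) * (1 + δ) = (2 * s / Real.pi) ^ (1 / 2 : ℂ) / (Real.sqrt 2 : ℂ) * Complex.exp (Real.pi ^ 2 / (8 * s) - s / 8) := by
  obtain ⟨δ, hδ, h⟩ := dual_theta s hs hR
  refine ⟨δ, hδ, ?_⟩
  have hq := norm_exp_lt_one s hs
  have hpi : (Real.pi : ℂ) ≠ 0 := by exact_mod_cast Real.pi_ne_zero
  have hs0 : s ≠ 0 := by rintro rfl; simp at hs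
  have hP : ev PP (Complex.exp (-s)) * ev (1 - Th 0 - Th 1) (Complex.exp (-s)) = 1 := by
    rw [← ev_mul (CV_PP _ hq) (CV_sub (CV_sub (CV_one _) (CV_Th _ _ hq)) (CV_Th _ _ hq)), PP_psi, ev_one]
  rw [psi_theta s hs, jacobiTheta₂_functional_equation, h] at hP
  have e1 : (-Complex.I * (2 * Complex.I * s / Real.pi)) = 2 * s / Real.pi := by
    field_simp
    linear_combination (-1 : ℂ) * Complex.I_sq
  have e2 : (-Real.pi * Complex.I * (1 / 2 + Complex.I * s / (2 * Real.pi)) ^ 2 / (2 * Complex.I * s / Real.pi)) = 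
      -(Real.pi ^ 2 / (8 * s) - s / 8) - Real.pi * Complex.I / 4 := by
    field_simp
    linear_combination (-s ^ 2 * 32) * Complex.I_sq
  have e3 : (1 : ℂ) + Complex.I = (Real.sqrt 2 : ℂ) * Complex.exp (Real.pi * Complex.I / 4) := by
    rw [show (Real.pi * Complex.I / 4 : ℂ) = ((Real.pi / 4 : ℝ) : ℂ) * Complex.I by push_cast; ring, Complex.exp_mul_I,
      ← Complex.ofReal_cos, ← Complex.ofReal_sin, Real.cos_pi_div_four, Real.sin_pi_div_four]
    have : (Real.sqrt 2 : ℂ) * (Real.sqrt 2 : ℂ) = 2 := by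
      rw [← Complex.ofReal_mul, Real.mul_self_sqrt (by norm_num)]; norm_num
    push_cast
    linear_combination (-(1 + Complex.I) / 2) * this
  rw [e1, e2, e3, Complex.exp_sub, Complex.exp_neg (Real.pi ^ 2 / (8 * s) - s / 8)] at hP
  have h2 : (Real.sqrt 2 : ℂ) ≠ 0 := by
    have : Real.sqrt 2 ≠ 0 := by positivity
    exact_mod_cast this
  have h3 : (2 * s / Real.pi) ^ (1 / 2 : ℂ) ≠ 0 := by
    rw [Complex.cpow_ne_zero_iff]
    left
    exact div_ne_zero (mul_ne_zero two_ne_zero hs0) hpi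
  have h4 := Complex.exp_ne_zero (Real.pi * Complex.I / 4)
  have h5 := Complex.exp_ne_zero (Real.pi ^ 2 / (8 * s) - s / 8)
  generalize (2 * s / Real.pi) ^ (1 / 2 : ℂ) = w at *
  generalize Complex.exp (Real.pi * Complex.I / 4) = a at *
  generalize Complex.exp (Real.pi ^ 2 / (8 * s) - s / 8) = b at *
  generalize ev PP (Complex.exp (-s)) = P at *
  generalize (Real.sqrt 2 : ℂ) = r at *
  field_simp at hP ⊢
  linear_combination hP

/-- integral over the boundary of a rectangle -/
noncomputable def RI (f : ℂ → ℂ) (a b c d : ℝ) : ℂ :=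
  (∫ x : ℝ in a..b, f (x + c * Complex.I)) - (∫ x : ℝ in a..b, f (x + d * Complex.I)) +
    Complex.I * (∫ y : ℝ in c..d, f (b + y * Complex.I)) - Complex.I * (∫ y : ℝ in c..d, f (a + y * Complex.I))

lemma log_neg_pos (z : ℂ) (h : 0 < z.im) : Complex.log (-z) = Complex.log z - Real.pi * Complex.I := by
  rw [Complex.log, Complex.log, norm_neg, Complex.arg_neg_eq_arg_sub_pi_of_im_pos h]; push_cast; ring

lemma log_neg_neg (z : ℂ) (h : z.im < 0) : Complex.log (-z) = Complex.log z + Real.pi * Complex.I := by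
  rw [Complex.log, Complex.log, norm_neg, Complex.arg_neg_eq_arg_add_pi_of_im_neg h]; push_cast; ring

lemma log_line_h (p : ℂ) (a b c : ℝ) (h : c ≠ p.im) :
    ∫ x : ℝ in a..b, (1 / ((x + c * Complex.I) - p) : ℂ) = Complex.log (b + c * Complex.I - p) - Complex.log (a + c * Complex.I - p) := by
  have hsl : ∀ x : ℝ, ((x : ℂ) + c * Complex.I - p) ∈ Complex.slitPlane := by
    intro x
    right
    simp only [Complex.sub_im, Complex.add_im, Complex.ofReal_im, Complex.mul_im, Complex.ofReal_re, Complex.I_im, Complex.I_re]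
    intro hh; apply h; linarith
  rw [intervalIntegral.integral_eq_sub_of_hasDerivAt (f := fun x : ℝ => Complex.log ((x : ℂ) + c * Complex.I - p))]
  · intro x _
    have h1 : HasDerivAt (fun x : ℝ => ((x : ℂ) + c * Complex.I - p)) 1 x :=
      ((Complex.ofRealCLM.hasDerivAt).add_const _).sub_const _
    exact h1.clog_real (hsl x)
  · apply Continuous.intervalIntegrable
    apply Continuous.div (by fun_prop) (by fun_prop)
    intro x
    exact Complex.slitPlane_ne_zero (hsl x)

lemma log_line_v (p : ℂ) (e : ℂ) (a c d : ℝ) (he : e ≠ 0) (h : ∀ y : ℝ, e * ((a : ℂ) + y * Complex.I - p) ∈ Complex.slitPlane) :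
    Complex.I * ∫ y : ℝ in c..d, (1 / ((a + y * Complex.I) - p) : ℂ) = Complex.log (e * (a + d * Complex.I - p)) - Complex.log (e * (a + c * Complex.I - p)) := by
  rw [← intervalIntegral.integral_const_mul]
  rw [intervalIntegral.integral_eq_sub_of_hasDerivAt (f := fun y : ℝ => Complex.log (e * ((a : ℂ) + y * Complex.I - p)))]
  · intro y _
    have h1 : HasDerivAt (fun y : ℝ => e * ((a : ℂ) + y * Complex.I - p)) (e * (1 * Complex.I)) y :=
      ((((Complex.ofRealCLM.hasDerivAt).mul_const Complex.I).const_add _).sub_const _).const_mul e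
    have h2 := h1.clog_real (h y)
    have hne := Complex.slitPlane_ne_zero (h y)
    have hne2 : ((a : ℂ) + y * Complex.I - p) ≠ 0 := right_ne_zero_of_mul hne
    have h3 : Complex.I * (1 / ((a : ℂ) + y * Complex.I - p)) = (e * (1 * Complex.I)) / (e * ((a : ℂ) + y * Complex.I - p)) := by
      rw [mul_div_mul_left _ _ he]; ring
    rw [h3]; exact h2
  · apply Continuous.intervalIntegrable
    apply Continuous.mul continuous_const
    apply Continuous.div (by fun_prop) (by fun_prop)
    intro y
    exact right_ne_zero_of_mul (Complex.slitPlane_ne_zero (h y))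

lemma RI_pole (p : ℂ) (a b c d : ℝ) (h1 : a < p.re) (h2 : p.re < b) (h3 : c < p.im) (h4 : p.im < d) :
    RI (fun w => 1 / (w - p)) a b c d = 2 * Real.pi * Complex.I := by
  rw [RI, log_line_h p a b c h3.ne, log_line_h p a b d h4.ne', log_line_v p 1 b c d one_ne_zero, log_line_v p (-1) a c d (by norm_num)]
  · rw [one_mul, one_mul, neg_one_mul, neg_one_mul, log_neg_pos, log_neg_neg]
    · ring
    · simp; linarith
    · simp; linarith
  · intro y; left; simp; linarith
  · intro y; left; simp; linarith

/-- residue theorem on a rectangle, simple poles -/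
lemma RI_res (f : ℂ → ℂ) (S : Finset ℂ) (r : ℂ → ℂ) (a b c d : ℝ) (hab : a < b) (hcd : c < d)
    (hS : ∀ p ∈ S, a < p.re ∧ p.re < b ∧ c < p.im ∧ p.im < d)
    (hd : ∀ w : ℂ, a ≤ w.re → w.re ≤ b → c ≤ w.im → w.im ≤ d → w ∉ S → DifferentiableAt ℂ f w)
    (hr : ∀ p ∈ S, Filter.Tendsto (fun w => (w - p) * f w) (nhdsWithin p {p}ᶜ) (nhds (r p))) :
    RI f a b c d = 2 * Real.pi * Complex.I * ∑ p ∈ S, r p := by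
  set g : ℂ → ℂ := fun w => f w - ∑ p ∈ S, r p * (1 / (w - p)) with hg
  set G : ℂ → ℂ := fun w => if w ∈ S then Filter.limUnder (nhdsWithin w {w}ᶜ) g else g w with hG
  have hgd : ∀ w : ℂ, a ≤ w.re → w.re ≤ b → c ≤ w.im → w.im ≤ d → w ∉ S → DifferentiableAt ℂ g w := by
    intro w h1 h2 h3 h4 h5
    apply (hd w h1 h2 h3 h4 h5).sub
    apply DifferentiableAt.fun_sum
    intro p hp
    have : w - p ≠ 0 := by
      intro h; rw [sub_eq_zero] at h; rw [h] at h5; exact h5 hp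
    fun_prop (disch := assumption)
  have hopen : ∀ p ∈ S, ∀ᶠ w in nhdsWithin p {p}ᶜ, a ≤ w.re ∧ w.re ≤ b ∧ c ≤ w.im ∧ w.im ≤ d ∧ w ∉ S := by
    intro p hp
    obtain ⟨h1, h2, h3, h4⟩ := hS p hp
    have e1 : ∀ᶠ w in nhds p, a ≤ w.re ∧ w.re ≤ b ∧ c ≤ w.im ∧ w.im ≤ d := by
      filter_upwards [Complex.continuous_re.continuousAt.eventually (lt_mem_nhds h1), Complex.continuous_re.continuousAt.eventually (gt_mem_nhds h2),
        Complex.continuous_im.continuousAt.eventually (lt_mem_nhds h3), Complex.continuous_im.continuousAt.eventually (gt_mem_nhds h4)] with w a1 a2 a3 a4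
      exact ⟨a1.le, a2.le, a3.le, a4.le⟩
    have e2 : ∀ᶠ w in nhds p, w ∉ S.erase p := by
      have : IsClosed ((S.erase p : Finset ℂ) : Set ℂ) := (S.erase p).finite_toSet.isClosed
      exact this.isOpen_compl.mem_nhds (by simp)
    filter_upwards [e1.filter_mono nhdsWithin_le_nhds, e2.filter_mono nhdsWithin_le_nhds, self_mem_nhdsWithin] with w a1 a2 a3
    refine ⟨a1.1, a1.2.1, a1.2.2.1, a1.2.2.2, ?_⟩
    intro h
    exact a2 (Finset.mem_erase.2 ⟨a3, h⟩)
  have hlim : ∀ p ∈ S, Filter.Tendsto g (nhdsWithin p {p}ᶜ) (nhds (Filter.limUnder (nhdsWithin p {p}ᶜ) g)) := by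
    intro p hp
    apply Complex.tendsto_limUnder_of_differentiable_on_punctured_nhds_of_isLittleO
    · filter_upwards [hopen p hp] with w hw
      exact hgd w hw.1 hw.2.1 hw.2.2.1 hw.2.2.2.1 hw.2.2.2.2
    · have key : Filter.Tendsto (fun w => (g w - g p) * (w - p)) (nhdsWithin p {p}ᶜ) (nhds 0) := by
        have t1 : Filter.Tendsto (fun w : ℂ => w - p) (nhdsWithin p {p}ᶜ) (nhds 0) := by
          have : Filter.Tendsto (fun w : ℂ => w - p) (nhds p) (nhds (p - p)) := (continuous_id.sub continuous_const).tendsto p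
          rw [sub_self] at this
          exact this.mono_left nhdsWithin_le_nhds
        have t2 : Filter.Tendsto (fun w : ℂ => ∑ x ∈ S.erase p, r x * (1 / (w - x))) (nhdsWithin p {p}ᶜ) (nhds (∑ x ∈ S.erase p, r x * (1 / (p - x)))) := by
          apply tendsto_finsetSum
          intro x hx
          have hx : p - x ≠ 0 := sub_ne_zero.2 (Finset.ne_of_mem_erase hx).symm
          have : ContinuousAt (fun w : ℂ => r x * (1 / (w - x))) p := by fun_prop (disch := assumption)
          exact this.tendsto.mono_left nhdsWithin_le_nhds
        have t3 := (((hr p hp).sub_const (r p)).sub (t2.mul t1)).sub (t1.const_mul (g p))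
        rw [sub_self, mul_zero, mul_zero, sub_zero, sub_zero] at t3
        refine t3.congr' ?_
        filter_upwards [self_mem_nhdsWithin] with w hw
        have hw : w - p ≠ 0 := sub_ne_zero.2 hw
        simp only [hg]
        rw [← Finset.add_sum_erase S (fun x => r x * (1 / (w - x))) hp]
        field_simp
        ring
      rw [Asymptotics.isLittleO_iff_tendsto']
      · simpa only [div_inv_eq_mul] using key
      · filter_upwards [self_mem_nhdsWithin] with w hw h
        exact absurd (inv_eq_zero.1 h) (sub_ne_zero.2 hw)
  have hGe : ∀ w, w ∉ S → G w = g w := fun w hw => by simp only [hG, if_neg hw]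
  have hGd : ∀ w : ℂ, a < w.re → w.re < b → c < w.im → w.im < d → w ∉ S → DifferentiableAt ℂ G w := by
    intro w h1 h2 h3 h4 h5
    apply (hgd w h1.le h2.le h3.le h4.le h5).congr_of_eventuallyEq
    have : IsClosed (S : Set ℂ) := S.finite_toSet.isClosed
    filter_upwards [this.isOpen_compl.mem_nhds (by simpa using h5)] with z hz
    exact hGe z (by simpa using hz)
  have hGc : ∀ w : ℂ, a ≤ w.re → w.re ≤ b → c ≤ w.im → w.im ≤ d → ContinuousAt G w := by
    intro w h1 h2 h3 h4
    by_cases h5 : w ∈ S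
    · rw [continuousAt_iff_punctured_nhds]
      have : G w = Filter.limUnder (nhdsWithin w {w}ᶜ) g := by simp only [hG, if_pos h5]
      rw [this]
      refine (hlim w h5).congr' ?_
      filter_upwards [hopen w h5] with z hz
      exact (hGe z hz.2.2.2.2).symm
    · apply (hgd w h1 h2 h3 h4 h5).continuousAt.congr
      have : IsClosed (S : Set ℂ) := S.finite_toSet.isClosed
      filter_upwards [this.isOpen_compl.mem_nhds (by simpa using h5)] with z hz
      exact (hGe z (by simpa using hz)).symm
  have h0 : RI G a b c d = 0 := by
    have := Complex.integral_boundary_rect_eq_zero_of_differentiable_on_off_countable G (a + c * Complex.I) (b + d * Complex.I) S S.countable_toSet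
      (by
        intro w hw
        rw [Complex.mem_reProdIm] at hw
        simp [Set.uIcc_of_le hab.le, Set.uIcc_of_le hcd.le] at hw
        exact (hGc w hw.1.1 hw.1.2 hw.2.1 hw.2.2).continuousWithinAt)
      (by
        intro w hw
        obtain ⟨hw, hwS⟩ := hw
        rw [Complex.mem_reProdIm] at hw
        simp [hab.le, hcd.le] at hw
        exact hGd w hw.1.1 hw.1.2 hw.2.1 hw.2.2 (by simpa using hwS))
    simpa [RI] using this
  -- the boundary avoids S
  have hbS : ∀ w : ℂ, (w.re = a ∨ w.re = b ∨ w.im = c ∨ w.im = d) → w ∉ S := by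
    intro w hw hwS
    obtain ⟨h1, h2, h3, h4⟩ := hS w hwS
    rcases hw with h | h | h | h <;> linarith
  have hlin : ∀ (γ : ℝ → ℂ) (u v : ℝ), u ≤ v → Continuous γ → (∀ x, u ≤ x → x ≤ v → (a ≤ (γ x).re ∧ (γ x).re ≤ b ∧ c ≤ (γ x).im ∧ (γ x).im ≤ d) ∧ γ x ∉ S) →
      ∫ x in u..v, f (γ x) = (∫ x in u..v, G (γ x)) + ∑ p ∈ S, r p * ∫ x in u..v, 1 / (γ x - p) := by
    intro γ u v huv hγ hx
    have hinteg : ∀ p ∈ S, IntervalIntegrable (fun x => r p * (1 / (γ x - p))) MeasureTheory.volume u v := by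
      intro p hp
      apply ContinuousOn.intervalIntegrable
      rw [Set.uIcc_of_le huv]
      apply ContinuousOn.mul continuousOn_const
      apply ContinuousOn.div continuousOn_const (hγ.continuousOn.sub continuousOn_const)
      intro x hxx h
      have h : γ x - p = 0 := h
      rw [sub_eq_zero] at h
      exact (hx x hxx.1 hxx.2).2 (h ▸ hp)
    simp only [← intervalIntegral.integral_const_mul]
    rw [← intervalIntegral.integral_finsetSum hinteg, ← intervalIntegral.integral_add]
    · apply intervalIntegral.integral_congr
      intro x hxx
      rw [Set.uIcc_of_le huv] at hxx
      simp only [hGe _ (hx x hxx.1 hxx.2).2, hg]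
      ring
    · apply ContinuousOn.intervalIntegrable
      rw [Set.uIcc_of_le huv]
      intro x hxx
      have h1 := (hx x hxx.1 hxx.2).1
      exact ((hGc _ h1.1 h1.2.1 h1.2.2.1 h1.2.2.2).comp hγ.continuousAt).continuousWithinAt
    · have := IntervalIntegrable.sum _ hinteg
      rw [Finset.sum_fn] at this
      exact this
  have e1 := hlin (fun x : ℝ => (x : ℂ) + c * Complex.I) a b hab.le (by fun_prop) (by
    intro x h1 h2
    refine ⟨by simp [h1, h2, hcd.le], hbS _ (by simp)⟩)
  have e2 := hlin (fun x : ℝ => (x : ℂ) + d * Complex.I) a b hab.le (by fun_prop) (by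
    intro x h1 h2
    refine ⟨by simp [h1, h2, hcd.le], hbS _ (by simp)⟩)
  have e3 := hlin (fun y : ℝ => (b : ℂ) + y * Complex.I) c d hcd.le (by fun_prop) (by
    intro x h1 h2
    refine ⟨by simp [h1, h2, hab.le], hbS _ (by simp)⟩)
  have e4 := hlin (fun y : ℝ => (a : ℂ) + y * Complex.I) c d hcd.le (by fun_prop) (by
    intro x h1 h2
    refine ⟨by simp [h1, h2, hab.le], hbS _ (by simp)⟩)
  have hfin : RI f a b c d = RI G a b c d + ∑ p ∈ S, r p * RI (fun w => 1 / (w - p)) a b c d := by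
    simp only [RI]
    rw [e1, e2, e3, e4]
    simp only [mul_add, mul_sub, Finset.sum_add_distrib, Finset.sum_sub_distrib, Finset.mul_sum, mul_left_comm (r _) Complex.I]
    ring
  rw [hfin, h0, zero_add, Finset.mul_sum]
  apply Finset.sum_congr rfl
  intro p hp
  obtain ⟨h1, h2, h3, h4⟩ := hS p hp
  rw [RI_pole p a b c d h1 h2 h3 h4]; ring

lemma norm_sinh_le (z : ℂ) : ‖Complex.sinh z‖ ≤ Real.exp |z.re| := by
  have h1 : ‖Complex.sinh z‖ ≤ (Real.exp z.re + Real.exp (-z.re)) / 2 := by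
    rw [Complex.sinh, norm_div]
    have := norm_sub_le (Complex.exp z) (Complex.exp (-z))
    rw [Complex.norm_exp, Complex.norm_exp, Complex.neg_re] at this
    simp only [Complex.norm_ofNat]
    linarith
  have h2 : Real.exp z.re ≤ Real.exp |z.re| := Real.exp_le_exp.2 (le_abs_self _)
  have h3 : Real.exp (-z.re) ≤ Real.exp |z.re| := Real.exp_le_exp.2 (neg_le_abs _)
  linarith

lemma le_norm_sinh (z : ℂ) : Real.sinh |z.re| ≤ ‖Complex.sinh z‖ := by
  rw [Complex.sinh, norm_div, Real.sinh_eq]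
  simp only [Complex.norm_ofNat]
  have h := abs_norm_sub_norm_le (Complex.exp z) (Complex.exp (-z))
  rw [Complex.norm_exp, Complex.norm_exp, Complex.neg_re] at h
  rcases abs_cases z.re with ⟨h1, _⟩ | ⟨h1, _⟩ <;> rw [h1]
  · linarith [le_abs_self (Real.exp z.re - Real.exp (-z.re))]
  · rw [neg_neg]; linarith [neg_le_abs (Real.exp z.re - Real.exp (-z.re))]

lemma sin_eq_sinh (z : ℂ) : Complex.sin z = -(Complex.sinh (z * Complex.I) * Complex.I) := by
  rw [Complex.sinh_mul_I, mul_assoc, Complex.I_mul_I]; ring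

lemma le_norm_sin (z : ℂ) : Real.sinh |z.im| ≤ ‖Complex.sin z‖ := by
  rw [sin_eq_sinh, norm_neg, norm_mul, Complex.norm_I, mul_one]
  have := le_norm_sinh (z * Complex.I)
  simpa using this

lemma sinh_zero (z : ℂ) (h : Complex.sinh z = 0) : ∃ k : ℤ, z = k * Real.pi * Complex.I := by
  have h1 : Complex.sin (z * Complex.I) = 0 := by rw [Complex.sin_mul_I, h, zero_mul]
  obtain ⟨k, hk⟩ := Complex.sin_eq_zero_iff.1 h1
  refine ⟨-k, ?_⟩
  have : z = -(z * Complex.I) * Complex.I := by rw [neg_mul, mul_assoc, Complex.I_mul_I]; ring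
  rw [this, hk]; push_cast; ring

lemma norm_cosh_ge (z : ℂ) (h : |z.im| ≤ 2 * |z.re|) : 1 / 2 ≤ ‖Complex.cosh z‖ := by
  have h1 : ‖Complex.cosh z‖ ^ 2 = Real.sinh z.re ^ 2 + Real.cos z.im ^ 2 := by
    rw [← Complex.normSq_eq_norm_sq, Complex.normSq_apply]
    have : Complex.cosh z = Complex.cosh (z.re + z.im * Complex.I) := by rw [Complex.re_add_im]
    rw [this, Complex.cosh_add, Complex.cosh_mul_I, Complex.sinh_mul_I, ← Complex.ofReal_cosh, ← Complex.ofReal_sinh, ← Complex.ofReal_cos, ← Complex.ofReal_sin]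
    simp only [Complex.add_re, Complex.add_im, Complex.mul_re, Complex.mul_im, Complex.ofReal_re, Complex.ofReal_im, Complex.I_re, Complex.I_im]
    have e1 := Real.cosh_sq z.re
    have e2 := Real.sin_sq z.im
    linear_combination Real.cos z.im ^ 2 * e1 + Real.sinh z.re ^ 2 * e2
  have h2 : (1 / 2 : ℝ) ^ 2 ≤ ‖Complex.cosh z‖ ^ 2 := by
    rw [h1]
    by_cases hh : 1 / 2 ≤ |z.re|
    · have : |z.re| ≤ Real.sinh |z.re| := Real.self_le_sinh_iff.2 (abs_nonneg _)
      have e : Real.sinh z.re ^ 2 = Real.sinh |z.re| ^ 2 := by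
        rcases abs_cases z.re with ⟨h1, _⟩ | ⟨h1, _⟩ <;> rw [h1]
        rw [Real.sinh_neg]; ring
      rw [e]
      nlinarith [sq_nonneg (Real.cos z.im)]
    · push Not at hh
      have : |z.im| ≤ 1 := by linarith
      have := Real.one_sub_sq_div_two_le_cos (x := z.im)
      have h3 : z.im ^ 2 ≤ 1 := by rw [← sq_abs]; nlinarith [abs_nonneg z.im]
      nlinarith [sq_nonneg (Real.sinh z.re)]
  exact le_of_sq_le_sq h2 (norm_nonneg _)

lemma exp_quarter_le_sinh (z : ℝ) (h : 1 ≤ z) : Real.exp z / 4 ≤ Real.sinh z := by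
  rw [Real.sinh_eq, Real.exp_neg]
  have h1 : 2 ≤ Real.exp z := by linarith [Real.add_one_le_exp z]
  have : (Real.exp z)⁻¹ ≤ 1 / 2 := by
    rw [inv_le_comm₀ (by positivity) (by norm_num)]; linarith
  linarith

lemma res_div (A B : ℂ → ℂ) (p b : ℂ) (hA : ContinuousAt A p) (hB : HasDerivAt B b p) (hb : b ≠ 0) (h0 : B p = 0) :
    Filter.Tendsto (fun w => (w - p) * (A w / B w)) (nhdsWithin p {p}ᶜ) (nhds (A p / b)) := by
  have h1 := (hasDerivAt_iff_tendsto_slope.1 hB).inv₀ hb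
  have h2 := (hA.tendsto.mono_left nhdsWithin_le_nhds).mul h1
  rw [← div_eq_mul_inv] at h2
  refine h2.congr ?_
  intro w
  rw [slope_def_field, h0, sub_zero, inv_div]
  ring

noncomputable def gL (α β γ : ℕ) (s w : ℂ) : ℂ :=
  Complex.exp (-2 * w ^ 2 * s) * HH α β γ (w * s) / Complex.sin (Real.pi * w)

lemma HH_neg (α β γ : ℕ) (u : ℂ) : HH α β γ (-u) = HH α β γ u := by
  simp only [HH, mul_neg, Complex.sinh_neg]
  rw [div_neg]; ring

lemma gL_neg (α β γ : ℕ) (s w : ℂ) : gL α β γ s (-w) = - gL α β γ s w := by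
  simp only [gL, neg_mul w s, HH_neg, mul_neg, Complex.sin_neg, neg_sq, div_neg]

noncomputable def rhoL (α β γ : ℕ) (s : ℂ) : ℂ :=
  4 * (Real.sin (α * Real.pi / 9) * Real.sin (β * Real.pi / 9) * Real.sin (γ * Real.pi / 9) : ℝ) * Complex.exp (2 * Real.pi ^ 2 / (81 * s)) /
    (9 * s * Complex.sinh (Real.pi ^ 2 / (9 * s)))

lemma HH_norm (α β γ : ℕ) (h : α + β + γ ≤ 10) (u : ℂ) : ‖HH α β γ u‖ ≤ 4 * Real.exp (10 * |u.re|) / ‖Complex.sinh (9 * u)‖ := by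
  rw [HH, norm_div, norm_mul, norm_mul, norm_mul]
  apply div_le_div_of_nonneg_right _ (norm_nonneg _)
  simp only [Complex.norm_ofNat]
  apply mul_le_mul_of_nonneg_left _ (by norm_num)
  have key : ∀ a : ℕ, ‖Complex.sinh (a * u)‖ ≤ Real.exp (a * |u.re|) := by
    intro a
    have := norm_sinh_le (a * u)
    simpa [abs_mul] using this
  calc _ ≤ Real.exp (α * |u.re|) * Real.exp (β * |u.re|) * Real.exp (γ * |u.re|) := by
        gcongr
        · exact key α
        · exact key β
        · exact key γ
    _ = Real.exp ((α + β + γ) * |u.re|) := by rw [← Real.exp_add, ← Real.exp_add]; ring_nf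
    _ ≤ _ := by
        apply Real.exp_le_exp.2
        apply mul_le_mul_of_nonneg_right _ (abs_nonneg _)
        exact_mod_cast h

lemma one_div_re_pos (s : ℂ) (hs : 0 < s.re) : 0 < (1 / s).re := by
  rw [one_div, Complex.inv_re]
  have : s ≠ 0 := by rintro rfl; simp at hs
  exact div_pos hs (Complex.normSq_pos.2 this)

/-- bound on the top side -/
lemma gL_top (α β γ : ℕ) (h : α + β + γ ≤ 10) (s : ℂ) (hs : 0 < s.re) (hi : |s.im| ≤ 2 * s.re) (hR : 1 ≤ (1 / s).re) (x : ℝ) :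
    ‖gL α β γ s (x + Real.pi / 6 * Complex.I / s)‖ ≤ 32 * Real.exp (25 * s.re) * Real.exp (-(Real.pi ^ 2 * (1 / s).re / 9)) * Real.exp (-s.re * x ^ 2) := by
  have hs0 : s ≠ 0 := by rintro rfl; simp at hs
  set R := (1 / s).re with hRdef
  have hpi := Real.pi_gt_three
  set w : ℂ := x + Real.pi / 6 * Complex.I / s with hw
  have hws : w * s = x * s + Real.pi / 6 * Complex.I := by rw [hw]; field_simp
  have him : w.im = Real.pi / 6 * R := by
    have : w = x + ((Real.pi / 6 : ℝ) : ℂ) * (Complex.I * (1 / s)) := by rw [hw]; push_cast; ring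
    rw [this, Complex.add_im, Complex.im_ofReal_mul, Complex.I_mul_im]
    simp [hRdef]
  have hre : (w * s).re = x * s.re := by
    rw [hws]; simp
  have hsinh : 1 / 2 ≤ ‖Complex.sinh (9 * (w * s))‖ := by
    have e : Complex.sinh (9 * (w * s)) = -(Complex.I * Complex.cosh ((9 * x : ℝ) * s)) := by
      rw [hws]
      have : (9 * (x * s + Real.pi / 6 * Complex.I) : ℂ) = (9 * x : ℝ) * s + ((Real.pi / 2 : ℝ) * Complex.I + (Real.pi : ℝ) * Complex.I) := by
        push_cast; ring
      rw [this, Complex.sinh_add, Complex.sinh_add, Complex.cosh_add]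
      simp only [Complex.sinh_mul_I, Complex.cosh_mul_I, ← Complex.ofReal_sin, ← Complex.ofReal_cos, Real.sin_pi_div_two, Real.cos_pi_div_two, Real.sin_pi, Real.cos_pi]
      push_cast; ring
    rw [e, norm_neg, norm_mul, Complex.norm_I, one_mul]
    apply norm_cosh_ge
    rw [Complex.im_ofReal_mul, Complex.re_ofReal_mul, abs_mul, abs_mul (9 * x) s.re, abs_of_pos hs]
    nlinarith [abs_nonneg (9 * x)]
  have hHH : ‖HH α β γ (w * s)‖ ≤ 8 * Real.exp (10 * (|x| * s.re)) := by
    refine (HH_norm α β γ h (w * s)).trans ?_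
    rw [hre, abs_mul, abs_of_pos hs, div_le_iff₀ (by linarith)]
    have := Real.exp_pos (10 * (|x| * s.re))
    nlinarith
  have hsin : Real.exp (Real.pi ^ 2 * R / 6) / 4 ≤ ‖Complex.sin (Real.pi * w)‖ := by
    refine le_trans ?_ (le_norm_sin _)
    rw [Complex.im_ofReal_mul, him]
    have : |Real.pi * (Real.pi / 6 * R)| = Real.pi ^ 2 * R / 6 := by
      rw [abs_of_nonneg (by positivity)]; ring
    rw [this]
    apply exp_quarter_le_sinh
    nlinarith
  have hexp : ‖Complex.exp (-2 * w ^ 2 * s)‖ = Real.exp (-2 * x ^ 2 * s.re + Real.pi ^ 2 / 18 * R) := by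
    rw [Complex.norm_exp]
    congr 1
    have : -2 * w ^ 2 * s = ((-2 * x ^ 2 : ℝ) : ℂ) * s + ((-2 * x * Real.pi / 3 : ℝ) : ℂ) * Complex.I + ((Real.pi ^ 2 / 18 : ℝ) : ℂ) * (1 / s) := by
      rw [hw]; push_cast; field_simp
      ring_nf
      rw [Complex.I_sq]; ring
    rw [this, Complex.add_re, Complex.add_re, Complex.re_ofReal_mul, Complex.re_ofReal_mul, Complex.re_ofReal_mul]
    simp [hRdef]
  rw [gL, norm_div, norm_mul, hexp]
  have hsp : 0 < ‖Complex.sin (Real.pi * w)‖ := lt_of_lt_of_le (by positivity) hsin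
  rw [div_le_iff₀ hsp]
  calc _ ≤ Real.exp (-2 * x ^ 2 * s.re + Real.pi ^ 2 / 18 * R) * (8 * Real.exp (10 * (|x| * s.re))) := by gcongr
    _ = 8 * Real.exp (-2 * x ^ 2 * s.re + Real.pi ^ 2 / 18 * R + 10 * (|x| * s.re)) := by rw [Real.exp_add _ (10 * (|x| * s.re))]; ring
    _ ≤ 8 * Real.exp (25 * s.re + -(Real.pi ^ 2 * R / 9) + -s.re * x ^ 2 + Real.pi ^ 2 * R / 6) := by
        apply mul_le_mul_of_nonneg_left _ (by norm_num)
        apply Real.exp_le_exp.2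
        have : 0 ≤ s.re * (|x| - 5) ^ 2 := by positivity
        have h2 := sq_abs x
        nlinarith
    _ = 32 * Real.exp (25 * s.re) * Real.exp (-(Real.pi ^ 2 * R / 9)) * Real.exp (-s.re * x ^ 2) * (Real.exp (Real.pi ^ 2 * R / 6) / 4) := by
        rw [Real.exp_add, Real.exp_add, Real.exp_add]; ring
    _ ≤ _ := by gcongr

lemma RI_gL (α β γ : ℕ) (s : ℂ) (hs : 0 < s.re) (N : ℕ)
    (hN : |(Real.pi / 9 * Complex.I / s).re| < N + 1 / 2) :
    ∑ k ∈ Finset.range N, (-1 : ℂ) ^ k * (Complex.exp (-2 * (k + 1) ^ 2 * s) * HH α β γ ((k + 1) * s)) =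
      Real.pi * rhoL α β γ s + Complex.I / 4 * RI (gL α β γ s) (-(N + 1 / 2)) (N + 1 / 2)
        (-(Real.pi / 6 * (1 / s).re)) (Real.pi / 6 * (1 / s).re) := by
  have hs0 : s ≠ 0 := by rintro rfl; simp at hs
  have hR := one_div_re_pos s hs
  set R := (1 / s).re with hRdef
  have hpi := Real.pi_pos
  have hpiC : (Real.pi : ℂ) ≠ 0 := by exact_mod_cast hpi.ne'
  set w1 : ℂ := Real.pi / 9 * Complex.I / s with hw1
  have him : w1.im = Real.pi / 9 * R := by
    have : w1 = ((Real.pi / 9 : ℝ) : ℂ) * (Complex.I * (1 / s)) := by rw [hw1]; push_cast; ring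
    rw [this, Complex.im_ofReal_mul, Complex.I_mul_im]
  have hw1s : w1 * s = Real.pi / 9 * Complex.I := by rw [hw1]; field_simp
  have hw1im : 0 < w1.im := by rw [him]; positivity
  set S1 : Finset ℂ := (Finset.Icc (-(N : ℤ)) N).image (fun n : ℤ => (n : ℂ)) with hS1
  set S2 : Finset ℂ := {w1, -w1} with hS2
  have hdisj : Disjoint S1 S2 := by
    rw [Finset.disjoint_left]
    intro p hp hp2
    obtain ⟨n, _, rfl⟩ := Finset.mem_image.1 hp
    rw [hS2, Finset.mem_insert, Finset.mem_singleton] at hp2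
    rcases hp2 with h | h
    · have := congrArg Complex.im h; simp at this; linarith
    · have := congrArg Complex.im h; simp at this; linarith
  set r : ℂ → ℂ := fun p => if p ∈ S2 then rhoL α β γ s else Complex.exp (-2 * p ^ 2 * s) * HH α β γ (p * s) / (Real.pi * Complex.cos (Real.pi * p)) with hr
  -- zeros
  have hz1 : ∀ w : ℂ, Complex.sin (Real.pi * w) = 0 → ∃ k : ℤ, w = k := by
    intro w h
    obtain ⟨k, hk⟩ := Complex.sin_eq_zero_iff.1 h
    refine ⟨k, ?_⟩
    apply mul_left_cancel₀ hpiC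
    rw [hk]; ring
  have hz2 : ∀ w : ℂ, Complex.sinh (9 * (w * s)) = 0 → ∃ k : ℤ, w = k * w1 := by
    intro w h
    obtain ⟨k, hk⟩ := sinh_zero _ h
    refine ⟨k, ?_⟩
    apply mul_right_cancel₀ hs0
    rw [mul_assoc, hw1s]
    linear_combination hk / 9
  have hsum : ∑ p ∈ S1 ∪ S2, r p = 2 * rhoL α β γ s - 2 / Real.pi * ∑ k ∈ Finset.range N, (-1 : ℂ) ^ k * (Complex.exp (-2 * (k + 1) ^ 2 * s) * HH α β γ ((k + 1) * s)) := by
    rw [Finset.sum_union hdisj]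
    have e2 : ∑ p ∈ S2, r p = 2 * rhoL α β γ s := by
      have : w1 ≠ -w1 := by
        intro h; have := congrArg Complex.im h; simp at this; linarith
      rw [hS2, Finset.sum_pair this]
      simp only [hr]
      rw [if_pos (by simp [hS2]), if_pos (by simp [hS2])]; ring
    have e1 : ∑ p ∈ S1, r p = - (2 / Real.pi * ∑ k ∈ Finset.range N, (-1 : ℂ) ^ k * (Complex.exp (-2 * (k + 1) ^ 2 * s) * HH α β γ ((k + 1) * s))) := by
      set F : ℤ → ℂ := fun n => Complex.exp (-2 * (n : ℂ) ^ 2 * s) * HH α β γ (n * s) / (Real.pi * Complex.cos (Real.pi * n)) with hF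
      have h1 : ∑ p ∈ S1, r p = ∑ n ∈ Finset.Icc (-(N : ℤ)) N, F n := by
        rw [hS1, Finset.sum_image (by intro a _ b _ h; exact Int.cast_injective h)]
        apply Finset.sum_congr rfl
        intro n hn
        simp only [hr, hF]
        rw [if_neg]
        exact Finset.disjoint_left.1 hdisj (Finset.mem_image.2 ⟨n, hn, rfl⟩)
      have hev : Function.Even F := by
        intro n
        simp only [hF]
        push_cast
        rw [neg_mul (n : ℂ) s, HH_neg, mul_neg (Real.pi : ℂ), Complex.cos_neg, neg_sq]
      rw [h1, Finset.sum_Icc_of_even_eq_range hev, Finset.sum_range_succ']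
      have hF0 : F 0 = 0 := by simp [hF, HH]
      rw [Nat.cast_zero, hF0, add_zero, sub_zero, nsmul_eq_mul, Finset.mul_sum, Finset.mul_sum, ← Finset.sum_neg_distrib]
      apply Finset.sum_congr rfl
      intro k _
      simp only [hF]
      have : Complex.cos (Real.pi * ((k + 1 : ℕ) : ℤ)) = -(-1 : ℂ) ^ k := by
        have := Real.cos_nat_mul_pi (k + 1)
        rw [mul_comm] at this
        have e : (Real.pi * ((k + 1 : ℕ) : ℤ) : ℂ) = ((Real.pi * (k + 1 : ℕ) : ℝ) : ℂ) := by push_cast; ring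
        rw [e, ← Complex.ofReal_cos, this]; push_cast; ring
      rw [this]
      push_cast
      have hsq : ((-1 : ℂ) ^ k) * (-1) ^ k = 1 := by rw [← mul_pow]; norm_num
      have hne : ((-1 : ℂ) ^ k) ≠ 0 := pow_ne_zero _ (by norm_num)
      have hinv : ((-1 : ℂ) ^ k)⁻¹ = (-1) ^ k := by rw [inv_eq_iff_eq_inv]; exact eq_inv_of_mul_eq_one_left hsq
      rw [div_eq_mul_inv, mul_inv, inv_neg, hinv]
      ring
    rw [e1, e2]; ring
  have hmain := RI_res (gL α β γ s) (S1 ∪ S2) r (-(N + 1 / 2)) (N + 1 / 2) (-(Real.pi / 6 * R)) (Real.pi / 6 * R)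
    (by have : (0 : ℝ) ≤ N := Nat.cast_nonneg N
        linarith) (by have : 0 < Real.pi / 6 * R := by positivity
                      linarith)
    (by
      intro p hp
      rcases Finset.mem_union.1 hp with h | h
      · obtain ⟨n, hn, rfl⟩ := Finset.mem_image.1 h
        rw [Finset.mem_Icc] at hn
        have a1 : (-(N : ℝ)) ≤ n := by exact_mod_cast hn.1
        have a2 : (n : ℝ) ≤ N := by exact_mod_cast hn.2
        have : 0 < Real.pi / 6 * R := by positivity
        simp only [Complex.intCast_re, Complex.intCast_im]
        exact ⟨by linarith, by linarith, by linarith, by linarith⟩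
      · have h1 := abs_lt.1 hN
        have h3 : 0 < Real.pi * R := by positivity
        rw [hS2, Finset.mem_insert, Finset.mem_singleton] at h
        rcases h with rfl | rfl
        · exact ⟨h1.1, h1.2, by linarith, by linarith⟩
        · simp only [Complex.neg_re, Complex.neg_im]
          exact ⟨by linarith [h1.1, h1.2], by linarith [h1.1, h1.2], by linarith, by linarith⟩)
    (by
      intro w a1 a2 a3 a4 hw
      rw [Finset.mem_union, not_or] at hw
      have n1 : Complex.sin (Real.pi * w) ≠ 0 := by
        intro h
        obtain ⟨k, rfl⟩ := hz1 w h
        apply hw.1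
        apply Finset.mem_image.2 ⟨k, _, rfl⟩
        simp only [Complex.intCast_re] at a1 a2
        have b1 : (-(N : ℝ)) - 1 < k := by linarith
        have b2 : (k : ℝ) < N + 1 := by linarith
        have c1 : (-(N : ℤ)) - 1 < k := by exact_mod_cast b1
        have c2 : k < (N : ℤ) + 1 := by exact_mod_cast b2
        rw [Finset.mem_Icc]; omega
      have n2 : Complex.sinh (9 * (w * s)) ≠ 0 := by
        intro h
        obtain ⟨k, hk⟩ := hz2 w h
        have him2 : w.im = k * (Real.pi / 9 * R) := by
          rw [hk, ← him]
          have : (k : ℂ) * w1 = ((k : ℝ) : ℂ) * w1 := by push_cast; rfl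
          rw [this, Complex.im_ofReal_mul]
        have h3 : 0 < Real.pi * R := by positivity
        have b1 : (-2 : ℝ) < k := by nlinarith
        have b2 : (k : ℝ) < 2 := by nlinarith
        have c1 : -2 < k := by exact_mod_cast b1
        have c2 : k < 2 := by exact_mod_cast b2
        have : k = -1 ∨ k = 0 ∨ k = 1 := by omega
        rcases this with rfl | rfl | rfl
        · apply hw.2; rw [hk, hS2]; simp
        · apply n1; rw [hk]; simp
        · apply hw.2; rw [hk, hS2]; simp
      unfold gL HH
      refine DifferentiableAt.fun_div ?_ ?_ n1
      · apply DifferentiableAt.mul (by fun_prop)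
        exact DifferentiableAt.fun_div (by fun_prop) (by fun_prop) n2
      · fun_prop)
    (by
      intro p hp
      have dsin : ∀ p : ℂ, HasDerivAt (fun w : ℂ => Complex.sin (Real.pi * w)) (Complex.cos (Real.pi * p) * (Real.pi * 1)) p := by
        intro p
        exact (Complex.hasDerivAt_sin _).comp p ((hasDerivAt_id p).const_mul _)
      have dsinh : ∀ (a p : ℂ), HasDerivAt (fun w : ℂ => Complex.sinh (a * (w * s))) (Complex.cosh (a * (p * s)) * (a * (1 * s))) p := by
        intro a p
        exact (Complex.hasDerivAt_sinh _).comp p (((hasDerivAt_id p).mul_const s).const_mul a)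
      rcases Finset.mem_union.1 hp with h | h
      · obtain ⟨n, hn, rfl⟩ := Finset.mem_image.1 h
        have hrr : r n = Complex.exp (-2 * (n : ℂ) ^ 2 * s) * HH α β γ (n * s) / (Real.pi * Complex.cos (Real.pi * n)) := by
          simp only [hr]
          rw [if_neg]
          exact Finset.disjoint_left.1 hdisj h
        rw [hrr]
        have hc : Complex.cos (Real.pi * n) ≠ 0 := by
          intro hc
          have h1 := Complex.sin_sq_add_cos_sq (Real.pi * n)
          rw [hc, mul_comm, Complex.sin_int_mul_pi] at h1
          norm_num at h1
        have hsn : Complex.sin (Real.pi * n) = 0 := by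
          rw [mul_comm]; exact Complex.sin_int_mul_pi n
        by_cases hn0 : n = 0
        · subst hn0
          have t1 := res_div (fun _ => 1) _ 0 _ continuousAt_const (dsin 0) (by simpa using hpi.ne') (by simp)
          have t2 := res_div (fun _ => 1) _ 0 _ continuousAt_const (dsinh 9 0) (by simpa using hs0) (by simp)
          have t3 := (hasDerivAt_iff_tendsto_slope.1 (dsinh γ 0))
          have c : ContinuousAt (fun w : ℂ => Complex.exp (-2 * w ^ 2 * s) * 4 * (Complex.sinh (α * (w * s)) * Complex.sinh (β * (w * s)))) 0 := by fun_prop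
          have t4 := ((c.tendsto.mono_left nhdsWithin_le_nhds).mul t3).mul (t1.mul t2)
          have e0 : (Complex.exp (-2 * ((0 : ℤ) : ℂ) ^ 2 * s) * HH α β γ (((0 : ℤ) : ℂ) * s) / (Real.pi * Complex.cos (Real.pi * ((0 : ℤ) : ℂ)))) = 0 := by simp [HH]
          rw [e0, Int.cast_zero]
          simp only [zero_mul, mul_zero, Complex.sinh_zero] at t4
          refine t4.congr' ?_
          filter_upwards [self_mem_nhdsWithin] with w hw
          have hw : w ≠ 0 := hw
          simp only [slope_def_field, gL, HH, sub_zero, zero_mul, mul_zero, Complex.sinh_zero]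
          by_cases q1 : Complex.sin (Real.pi * w) = 0
          · rw [q1]; simp
          by_cases q2 : Complex.sinh (9 * (w * s)) = 0
          · rw [q2]; simp
          field_simp
        · have n2 : Complex.sinh (9 * ((n : ℂ) * s)) ≠ 0 := by
            intro h
            obtain ⟨k, hk⟩ := sinh_zero _ h
            have := congrArg Complex.re hk
            simp at this
            rcases this with h | h
            · exact hn0 h
            · exact hs.ne' h
          have cA : ContinuousAt (fun w : ℂ => Complex.exp (-2 * w ^ 2 * s) * HH α β γ (w * s)) n := by
            unfold HH
            apply ContinuousAt.mul (by fun_prop)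
            fun_prop (disch := assumption)
          have := res_div _ _ _ _ cA (dsin n) (mul_ne_zero hc (by simpa using hpiC)) hsn
          rw [mul_one, mul_comm (Complex.cos _)] at this
          exact this
      · have hrr : r p = rhoL α β γ s := by simp only [hr]; rw [if_pos h]
        rw [hrr]
        rw [hS2, Finset.mem_insert, Finset.mem_singleton] at h
        have hpim : p.im ≠ 0 := by
          rcases h with rfl | rfl
          · exact hw1im.ne'
          · simpa using hw1im.ne'
        have n1 : Complex.sin (Real.pi * p) ≠ 0 := by
          intro h
          obtain ⟨k, rfl⟩ := hz1 p h
          simp at hpim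
        have cA : ContinuousAt (fun w : ℂ => Complex.exp (-2 * w ^ 2 * s) * (4 * (Complex.sinh (α * (w * s)) * Complex.sinh (β * (w * s)) * Complex.sinh (γ * (w * s)))) / Complex.sin (Real.pi * w)) p := by
          fun_prop (disch := assumption)
        have hcw : Complex.cosh (9 * (p * s)) = -1 := by
          have : 9 * (w1 * s) = Real.pi * Complex.I := by rw [hw1s]; ring
          rcases h with rfl | rfl
          · rw [this, Complex.cosh_mul_I, Complex.cos_pi]
          · rw [neg_mul, mul_neg, Complex.cosh_neg, this, Complex.cosh_mul_I, Complex.cos_pi]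
        have hsw : Complex.sinh (9 * (p * s)) = 0 := by
          have : 9 * (w1 * s) = Real.pi * Complex.I := by rw [hw1s]; ring
          rcases h with rfl | rfl
          · rw [this, Complex.sinh_mul_I, Complex.sin_pi, zero_mul]
          · rw [neg_mul, mul_neg, Complex.sinh_neg, this, Complex.sinh_mul_I, Complex.sin_pi, zero_mul, neg_zero]
        have t := res_div _ _ _ _ cA (dsinh 9 p) (by rw [hcw]; simpa using hs0) hsw
        have hval : rhoL α β γ s = Complex.exp (-2 * p ^ 2 * s) * (4 * (Complex.sinh (α * (p * s)) * Complex.sinh (β * (p * s)) * Complex.sinh (γ * (p * s)))) / Complex.sin (Real.pi * p) / (Complex.cosh (9 * (p * s)) * (9 * (1 * s))) := by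
          rw [hcw]
          have q1 : -2 * p ^ 2 * s = 2 * Real.pi ^ 2 / (81 * s) := by
            have : p ^ 2 = w1 ^ 2 := by rcases h with rfl | rfl <;> ring
            rw [this, hw1]; field_simp
            rw [Complex.I_sq]; ring
          have q2 : ∀ a : ℕ, Complex.sinh (a * (w1 * s)) = Complex.I * (Real.sin (a * Real.pi / 9) : ℝ) := by
            intro a
            have : (a : ℂ) * (w1 * s) = ((a * Real.pi / 9 : ℝ) : ℂ) * Complex.I := by rw [hw1s]; push_cast; ring
            rw [this, Complex.sinh_mul_I, Complex.ofReal_sin]; ring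
          have q3 : Complex.sin (Real.pi * w1) = Complex.I * Complex.sinh (Real.pi ^ 2 / (9 * s)) := by
            have : Real.pi * w1 = (Real.pi ^ 2 / (9 * s)) * Complex.I := by rw [hw1]; field_simp
            rw [this, Complex.sin_mul_I]; ring
          have q4 : Complex.sinh (Real.pi ^ 2 / (9 * s)) ≠ 0 := by
            intro hz
            rw [hz, mul_zero] at q3
            apply n1
            rcases h with rfl | rfl
            · exact q3
            · rw [mul_neg, Complex.sin_neg, q3, neg_zero]
          rw [q1, rhoL]
          have hI := Complex.I_ne_zero
          rcases h with rfl | rfl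
          · rw [q2, q2, q2, q3]
            push_cast
            field_simp
            rw [Complex.I_sq]; ring
          · simp only [neg_mul, mul_neg, Complex.sinh_neg, Complex.sin_neg]
            rw [q2, q2, q2, q3]
            push_cast
            field_simp
            rw [Complex.I_sq]; ring
        rw [hval]
        refine t.congr ?_
        intro w
        simp only [gL, HH]
        ring)
  rw [hmain, hsum]
  have hI := Complex.I_sq
  generalize (∑ k ∈ Finset.range N, (-1 : ℂ) ^ k * (Complex.exp (-2 * (k + 1) ^ 2 * s) * HH α β γ ((k + 1) * s))) = T
  field_simp
  rw [hI]; ring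

lemma gL_side (α β γ : ℕ) (h : α + β + γ ≤ 10) (s : ℂ) (hs : 0 < s.re) (N : ℕ) (η y : ℝ) (hy : |y| ≤ η)
    (hM : η * |s.im| + 1 ≤ (N + 1 / 2 : ℝ) * s.re) :
    ‖gL α β γ s (((N + 1 / 2 : ℝ) : ℂ) + y * Complex.I)‖ ≤
      4 * Real.exp (10 * ((N + 1 / 2 : ℝ) * s.re + η * |s.im|) - 2 * (N + 1 / 2 : ℝ) ^ 2 * s.re + 2 * η ^ 2 * s.re + 4 * (N + 1 / 2 : ℝ) * (η * |s.im|)) := by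
  set M : ℝ := N + 1 / 2 with hMd
  have hM0 : 0 < M := by positivity
  have hyp : |y * s.im| ≤ η * |s.im| := by
    rw [abs_mul]; exact mul_le_mul_of_nonneg_right hy (abs_nonneg _)
  have hre : (((M : ℂ) + y * Complex.I) * s).re = M * s.re - y * s.im := by
    simp
  obtain ⟨y1, y2⟩ := abs_le.1 hyp
  have hre1 : 1 ≤ |(((M : ℂ) + y * Complex.I) * s).re| := by
    rw [hre]; exact le_trans (by linarith) (le_abs_self _)
  have hre2 : |(((M : ℂ) + y * Complex.I) * s).re| ≤ M * s.re + η * |s.im| := by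
    rw [hre, abs_le]
    have : 0 < M * s.re := by positivity
    constructor <;> linarith
  have hsinh : 1 ≤ ‖Complex.sinh (9 * (((M : ℂ) + y * Complex.I) * s))‖ := by
    refine le_trans ?_ (le_norm_sinh _)
    have e : (9 * (((M : ℂ) + y * Complex.I) * s)).re = 9 * (((M : ℂ) + y * Complex.I) * s).re := by
      have := Complex.re_ofReal_mul 9 (((M : ℂ) + y * Complex.I) * s)
      exact_mod_cast this
    rw [e, abs_mul]
    refine le_trans ?_ (Real.self_le_sinh_iff.2 (by positivity))
    rw [abs_of_pos (by norm_num : (0:ℝ) < 9)]; linarith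
  have hHH : ‖HH α β γ (((M : ℂ) + y * Complex.I) * s)‖ ≤ 4 * Real.exp (10 * (M * s.re + η * |s.im|)) := by
    refine (HH_norm α β γ h _).trans ?_
    refine (div_le_self (by positivity) hsinh).trans ?_
    gcongr
  have hsin : 1 ≤ ‖Complex.sin (Real.pi * ((M : ℂ) + y * Complex.I))‖ := by
    have e : Complex.sin (Real.pi * ((M : ℂ) + y * Complex.I)) = (((-1) ^ N * Real.cosh (Real.pi * y) : ℝ) : ℂ) := by
      have : (Real.pi * ((M : ℂ) + y * Complex.I)) = ((N * Real.pi + Real.pi / 2 : ℝ) : ℂ) + ((Real.pi * y : ℝ) : ℂ) * Complex.I := by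
        rw [hMd]; push_cast; ring
      rw [this, Complex.sin_add_mul_I, ← Complex.ofReal_sin, ← Complex.ofReal_cos, ← Complex.ofReal_cosh, Real.sin_add_pi_div_two, Real.cos_add_pi_div_two, Real.sin_nat_mul_pi, Real.cos_nat_mul_pi]
      push_cast; ring
    rw [e, Complex.norm_real, norm_mul, norm_pow, norm_neg, norm_one, one_pow, one_mul, Real.norm_eq_abs]
    exact le_trans (Real.one_le_cosh _) (le_abs_self _)
  have hexp : ‖Complex.exp (-2 * ((M : ℂ) + y * Complex.I) ^ 2 * s)‖ ≤ Real.exp (- 2 * M ^ 2 * s.re + 2 * η ^ 2 * s.re + 4 * M * (η * |s.im|)) := by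
    rw [Complex.norm_exp]
    apply Real.exp_le_exp.2
    have : -2 * ((M : ℂ) + y * Complex.I) ^ 2 * s = ((-2 * (M ^ 2 - y ^ 2) : ℝ) : ℂ) * s + ((-4 * M * y : ℝ) : ℂ) * (Complex.I * s) := by
      push_cast
      linear_combination (-2 * (y : ℂ) ^ 2 * s) * Complex.I_sq
    rw [this, Complex.add_re, Complex.re_ofReal_mul, Complex.re_ofReal_mul, Complex.I_mul_re]
    have h1 : y ^ 2 ≤ η ^ 2 := by rw [← sq_abs]; gcongr
    nlinarith
  rw [gL, norm_div, norm_mul]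
  refine (div_le_self (by positivity) hsin).trans ?_
  calc _ ≤ Real.exp (- 2 * M ^ 2 * s.re + 2 * η ^ 2 * s.re + 4 * M * (η * |s.im|)) * (4 * Real.exp (10 * (M * s.re + η * |s.im|))) := by gcongr
    _ = _ := by
      rw [mul_left_comm, ← Real.exp_add]; congr 2; ring

lemma gauss_bd (f : ℝ → ℂ) (K t x0 a b : ℝ) (ht : 0 < t) (hab : a ≤ b) (hK : 0 ≤ K) (h : ∀ x, ‖f x‖ ≤ K * Real.exp (-t * (x - x0) ^ 2)) :
    ‖∫ x in a..b, f x‖ ≤ K * √(Real.pi / t) := by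
  have hi : MeasureTheory.Integrable (fun x : ℝ => K * Real.exp (-t * (x - x0) ^ 2)) :=
    ((integrable_exp_neg_mul_sq ht).comp_sub_right x0).const_mul K
  refine (intervalIntegral.norm_integral_le_of_norm_le hab (Filter.Eventually.of_forall fun x _ => h x) hi.intervalIntegrable).trans ?_
  rw [intervalIntegral.integral_of_le hab]
  refine (MeasureTheory.setIntegral_le_integral hi (Filter.Eventually.of_forall fun x => by positivity)).trans ?_
  rw [MeasureTheory.integral_const_mul, MeasureTheory.integral_sub_right_eq_self (fun x => Real.exp (-t * x ^ 2)), integral_gaussian]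

lemma side_lim (t b c : ℝ) (ht : 0 < t) :
    Filter.Tendsto (fun N : ℕ => 4 * Real.exp (10 * ((N + 1 / 2 : ℝ) * t + b) - 2 * (N + 1 / 2 : ℝ) ^ 2 * t + c + 4 * (N + 1 / 2 : ℝ) * b)) Filter.atTop (nhds 0) := by
  have h0 : Filter.Tendsto (fun N : ℕ => (N + 1 / 2 : ℝ)) Filter.atTop Filter.atTop :=
    Filter.tendsto_atTop_add_const_right _ _ tendsto_natCast_atTop_atTop
  have h1 : Filter.Tendsto (fun N : ℕ => (N + 1 / 2 : ℝ) * (2 * t * (N + 1 / 2 : ℝ) + (- 10 * t - 4 * b)) + (- 10 * b - c)) Filter.atTop Filter.atTop := by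
    apply Filter.tendsto_atTop_add_const_right
    apply h0.atTop_mul_atTop₀
    apply Filter.tendsto_atTop_add_const_right
    exact h0.const_mul_atTop (by linarith)
  have h2 := (Real.tendsto_exp_neg_atTop_nhds_zero.comp h1).const_mul 4
  rw [mul_zero] at h2
  refine h2.congr ?_
  intro N
  simp only [Function.comp]
  congr 2; ring

lemma L_est (α β γ : ℕ) (h : α + β + γ ≤ 10) (s : ℂ) (hs : 0 < s.re) (hi : |s.im| ≤ 2 * s.re) (hR : 1 ≤ (1 / s).re) (T : ℂ)
    (hT : HasSum (fun k : ℕ => (-1 : ℂ) ^ k * (Complex.exp (-2 * (k + 1) ^ 2 * s) * HH α β γ ((k + 1) * s))) T) :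
    ‖T - Real.pi * rhoL α β γ s‖ ≤ 16 * Real.exp (25 * s.re) * Real.exp (-(Real.pi ^ 2 * (1 / s).re / 9)) * √(Real.pi / s.re) := by
  have hs0 : s ≠ 0 := by rintro rfl; simp at hs
  set η := Real.pi / 6 * (1 / s).re with hη
  have hpi := Real.pi_pos
  have hηp : 0 < η := by have := one_div_re_pos s hs; positivity
  set K := 32 * Real.exp (25 * s.re) * Real.exp (-(Real.pi ^ 2 * (1 / s).re / 9)) with hK
  have hKp : 0 ≤ K := by positivity
  set V : ℕ → ℝ := fun N => 4 * Real.exp (10 * ((N + 1 / 2 : ℝ) * s.re + η * |s.im|) - 2 * (N + 1 / 2 : ℝ) ^ 2 * s.re + 2 * η ^ 2 * s.re + 4 * (N + 1 / 2 : ℝ) * (η * |s.im|)) with hV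
  have hVl : Filter.Tendsto V Filter.atTop (nhds 0) := side_lim s.re _ _ hs
  set x0 := (Real.pi / 6 * Complex.I / s).re with hx0
  have hw0 : Real.pi / 6 * Complex.I / s = x0 + η * Complex.I := by
    apply Complex.ext
    · simp [hx0]
    · have : Real.pi / 6 * Complex.I / s = ((Real.pi / 6 : ℝ) : ℂ) * (Complex.I * (1 / s)) := by push_cast; ring
      rw [this, Complex.im_ofReal_mul, Complex.I_mul_im]
      simp [hη]
  have htop : ∀ x : ℝ, ‖gL α β γ s (x + η * Complex.I)‖ ≤ K * Real.exp (-s.re * (x - x0) ^ 2) := by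
    intro x
    have := gL_top α β γ h s hs hi hR (x - x0)
    rw [hw0] at this
    have e : ((x - x0 : ℝ) : ℂ) + (x0 + η * Complex.I) = x + η * Complex.I := by push_cast; ring
    rw [e] at this
    exact this
  have hbot : ∀ x : ℝ, ‖gL α β γ s (x + (-η : ℝ) * Complex.I)‖ ≤ K * Real.exp (-s.re * (x - (-x0)) ^ 2) := by
    intro x
    have := htop (-x)
    have e : ((-x : ℝ) : ℂ) + η * Complex.I = -(x + (-η : ℝ) * Complex.I) := by push_cast; ring
    rw [e, gL_neg, norm_neg] at this
    refine this.trans (le_of_eq ?_)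
    congr 2; ring
  have hev : ∀ᶠ N : ℕ in Filter.atTop, max |(Real.pi / 9 * Complex.I / s).re| ((η * |s.im| + 1) / s.re) < N :=
    tendsto_natCast_atTop_atTop.eventually_gt_atTop _
  have hb : ∀ᶠ N : ℕ in Filter.atTop, ‖(∑ k ∈ Finset.range N, (-1 : ℂ) ^ k * (Complex.exp (-2 * (k + 1) ^ 2 * s) * HH α β γ ((k + 1) * s))) - Real.pi * rhoL α β γ s‖ ≤ (K * √(Real.pi / s.re)) / 2 + η * V N := by
    filter_upwards [hev] with N hN
    have hN1 := lt_of_le_of_lt (le_max_left _ _) hN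
    have hN2 := lt_of_le_of_lt (le_max_right _ _) hN
    have hM : η * |s.im| + 1 ≤ (N + 1 / 2 : ℝ) * s.re := by
      rw [div_lt_iff₀ hs] at hN2; nlinarith
    rw [RI_gL α β γ s hs N (by linarith), add_sub_cancel_left, norm_mul]
    have hI4 : ‖Complex.I / 4‖ = 1 / 4 := by simp
    have hNN : (0 : ℝ) ≤ N := Nat.cast_nonneg N
    have i1 := gauss_bd (fun x : ℝ => gL α β γ s (x + (-η : ℝ) * Complex.I)) K s.re (-x0) (-(N + 1 / 2 : ℝ)) (N + 1 / 2 : ℝ) hs (by linarith) hKp hbot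
    have i2 := gauss_bd (fun x : ℝ => gL α β γ s (x + η * Complex.I)) K s.re x0 (-(N + 1 / 2 : ℝ)) (N + 1 / 2 : ℝ) hs (by linarith) hKp htop
    have i3 : ‖∫ y : ℝ in (-η)..η, gL α β γ s (((N + 1 / 2 : ℝ) : ℂ) + y * Complex.I)‖ ≤ V N * |η - -η| := by
      apply intervalIntegral.norm_integral_le_of_norm_le_const
      intro y hy
      rw [Set.uIoc_of_le (by linarith)] at hy
      exact gL_side α β γ h s hs N η y (abs_le.2 ⟨hy.1.le, hy.2⟩) hM
    have i4 : ‖∫ y : ℝ in (-η)..η, gL α β γ s (((-(N + 1 / 2) : ℝ) : ℂ) + y * Complex.I)‖ ≤ V N * |η - -η| := by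
      apply intervalIntegral.norm_integral_le_of_norm_le_const
      intro y hy
      rw [Set.uIoc_of_le (by linarith)] at hy
      have := gL_side α β γ h s hs N η (-y) (abs_le.2 ⟨by linarith [hy.2], by linarith [hy.1]⟩) hM
      have e : (((N + 1 / 2 : ℝ) : ℂ) + (-y : ℝ) * Complex.I) = -(((-(N + 1 / 2) : ℝ) : ℂ) + y * Complex.I) := by push_cast; ring
      rw [e, gL_neg, norm_neg] at this
      exact this
    have hηη : |η - -η| = 2 * η := by rw [abs_of_pos (by linarith)]; ring
    rw [hηη] at i3 i4
    have hRI : ‖RI (gL α β γ s) (-(N + 1 / 2)) (N + 1 / 2) (-η) η‖ ≤ K * √(Real.pi / s.re) + K * √(Real.pi / s.re) + V N * (2 * η) + V N * (2 * η) := by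
      rw [RI]
      refine (norm_sub_le _ _).trans (add_le_add ((norm_add_le _ _).trans (add_le_add ((norm_sub_le _ _).trans (add_le_add i1 i2)) ?_)) ?_)
      · rw [norm_mul, Complex.norm_I, one_mul]; exact i3
      · rw [norm_mul, Complex.norm_I, one_mul]; exact i4
    rw [hI4]
    linarith
  have l1 := ((hT.tendsto_sum_nat).sub_const (Real.pi * rhoL α β γ s)).norm
  have l2 := (hVl.const_mul η).const_add ((K * √(Real.pi / s.re)) / 2)
  have := le_of_tendsto_of_tendsto l1 l2 hb
  rw [mul_zero, add_zero] at this
  refine this.trans (le_of_eq ?_)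
  rw [hK]; ring

noncomputable def TT (x y : ℝ) : ℝ := Real.exp (-x) * (y - Real.exp (-x)) / (1 - 2 * Real.exp (-x) * y + Real.exp (-x) ^ 2)

lemma TT_np (x y : ℝ) (h : y ≤ 1 - x) (hy : y ≤ 1) : TT x y ≤ 0 := by
  have h1 := Real.add_one_le_exp (-x)
  have h2 := Real.exp_pos (-x)
  apply div_nonpos_of_nonpos_of_nonneg
  · apply mul_nonpos_of_nonneg_of_nonpos h2.le; linarith
  · nlinarith [sq_nonneg (1 - Real.exp (-x))]

lemma TT_le (x y z : ℝ) (hx : 0 < x) (hz : 0 ≤ z) (hy : y ≤ 1 - z) : TT x y ≤ x / (x ^ 2 + 2 * z) := by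
  have h1 := Real.add_one_le_exp (-x)
  have h2 := Real.exp_pos (-x)
  have h3 : Real.exp (-x) * (x + 1) ≤ 1 := by
    have := Real.add_one_le_exp x
    have e : Real.exp (-x) * Real.exp x = 1 := by rw [← Real.exp_add]; simp
    nlinarith
  have hlt : Real.exp (-x) < 1 := by rw [Real.exp_lt_one_iff]; linarith
  rw [TT]
  set ρ := Real.exp (-x) with hρ
  have hden : 0 < 1 - 2 * ρ * y + ρ ^ 2 := by nlinarith [sq_pos_of_pos (sub_pos.2 hlt)]
  rw [div_le_div_iff₀ hden (by positivity)]
  by_cases hv : y ≤ ρ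
  · have : ρ * (y - ρ) * (x ^ 2 + 2 * z) ≤ 0 := by
      apply mul_nonpos_of_nonpos_of_nonneg _ (by positivity)
      exact mul_nonpos_of_nonneg_of_nonpos h2.le (by linarith)
    have : 0 ≤ x * (1 - 2 * ρ * y + ρ ^ 2) := by positivity
    linarith
  · push Not at hv
    have e1 : ρ * (y - ρ) * (x ^ 2 + 2 * z) ≤ ρ * (y - ρ) * (x ^ 2 + 2 * (1 - y)) := by
      apply mul_le_mul_of_nonneg_left (by linarith)
      apply mul_nonneg h2.le; linarith
    refine e1.trans ?_
    have e2 : 0 ≤ x * (1 - ρ) * (1 - ρ - ρ * x) := by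
      apply mul_nonneg (mul_nonneg hx.le (by linarith)); linarith
    have e3 : 0 ≤ ρ * (1 - y) * (x - (1 - ρ)) := by
      apply mul_nonneg (mul_nonneg h2.le (by linarith)); linarith
    have e4 : 0 ≤ ρ * (1 - y) * x ^ 2 := by
      apply mul_nonneg (mul_nonneg h2.le (by linarith)); positivity
    have e5 : 0 ≤ ρ * (1 - y) ^ 2 := by positivity
    nlinarith

lemma TT_le0 (x y : ℝ) (hx : 0 < x) (hy : y ≤ 1) : TT x y ≤ 1 / x := by
  have := TT_le x y 0 hx le_rfl (by linarith)
  refine this.trans (le_of_eq ?_)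
  field_simp
  ring

lemma TT_eq (t φ : ℝ) (m : ℕ) :
    ((-1 : ℂ) ^ m * Complex.exp (-(t - Complex.I * φ)) ^ (m + 1) / (1 - (-1 : ℂ) ^ m * Complex.exp (-(t - Complex.I * φ)) ^ (m + 1))).re =
      TT ((m + 1) * t) ((-1) ^ m * Real.cos ((m + 1) * φ)) := by
  have hu : (-1 : ℂ) ^ m * Complex.exp (-(t - Complex.I * φ)) ^ (m + 1) =
      ((Real.exp (-((m + 1) * t)) * ((-1) ^ m * Real.cos ((m + 1) * φ)) : ℝ) : ℂ) + ((Real.exp (-((m + 1) * t)) * ((-1) ^ m * Real.sin ((m + 1) * φ)) : ℝ) : ℂ) * Complex.I := by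
    rw [← Complex.exp_nat_mul]
    have : ((m + 1 : ℕ) : ℂ) * -(t - Complex.I * φ) = ((-((m + 1) * t) : ℝ) : ℂ) + (((m + 1) * φ : ℝ) : ℂ) * Complex.I := by push_cast; ring
    rw [this, Complex.exp_add, Complex.exp_mul_I]
    push_cast; ring
  rw [hu, TT, Complex.div_re, Complex.normSq_apply]
  have hs : ((-1 : ℝ) ^ m) * (-1) ^ m = 1 := by rw [← mul_pow]; norm_num
  have hcs := Real.sin_sq_add_cos_sq ((m + 1) * φ)
  set ρ := Real.exp (-((m + 1) * t))
  set e : ℝ := (-1) ^ m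
  set C := Real.cos ((m + 1) * φ)
  set S := Real.sin ((m + 1) * φ)
  simp only [Complex.add_re, Complex.add_im, Complex.sub_re, Complex.sub_im, Complex.one_re, Complex.one_im, Complex.mul_re, Complex.mul_im, Complex.ofReal_re, Complex.ofReal_im, Complex.I_re, Complex.I_im]
  have d : (1 - (ρ * (e * C) + (ρ * (e * S) * 0 - 0 * 1))) * (1 - (ρ * (e * C) + (ρ * (e * S) * 0 - 0 * 1))) +
      (0 - (0 + (ρ * (e * S) * 1 + 0 * 0))) * (0 - (0 + (ρ * (e * S) * 1 + 0 * 0))) = 1 - 2 * ρ * (e * C) + ρ ^ 2 := by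
    linear_combination (ρ ^ 2 * (S ^ 2 + C ^ 2)) * hs + ρ ^ 2 * hcs
  rw [d, ← add_div]
  congr 1
  linear_combination (-ρ ^ 2 * (S ^ 2 + C ^ 2)) * hs - ρ ^ 2 * hcs

lemma sumbd (f : ℕ → ℝ) (t : ℝ) (ht : 0 < t) (hf : Summable f) (h : ∀ m : ℕ, f m ≤ 1 / ((m + 1) ^ 2 * t)) (K : ℕ) (c : ℕ → ℚ)
    (hc : ∀ m < K, f m ≤ c m / t) (hfin : ∑ m ∈ Finset.range K, c m + 1 / (K + 1 / 2) ≤ 316 / 1000) :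
    ∑' m, f m ≤ (316 / 1000) / t := by
  have h1 := (hf.sum_add_tsum_nat_add K).symm
  rw [h1]
  have a1 : ∑ m ∈ Finset.range K, f m ≤ ((∑ m ∈ Finset.range K, c m : ℚ) : ℝ) / t := by
    push_cast
    rw [Finset.sum_div]
    exact Finset.sum_le_sum fun m hm => hc m (Finset.mem_range.1 hm)
  have a2 : ∑' m, f (m + K) ≤ 1 / ((K + 1 / 2) * t) := by
    have hs : Summable (fun m => f (m + K)) := (summable_nat_add_iff K).2 hf
    apply hs.tsum_le_of_sum_range_le
    intro n
    have : ∀ n : ℕ, ∑ i ∈ Finset.range n, f (i + K) ≤ 1 / ((K + 1 / 2) * t) - 1 / ((K + n + 1 / 2) * t) := by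
      intro n
      induction n with
      | zero => simp
      | succ n ih =>
        rw [Finset.sum_range_succ]
        have := h (n + K)
        have e : 1 / (((n + K : ℕ) + 1 : ℝ) ^ 2 * t) ≤ 1 / ((K + n + 1 / 2) * t) - 1 / ((K + (n + 1 : ℕ) + 1 / 2) * t) := by
          push_cast
          rw [div_sub_div _ _ (by positivity) (by positivity), div_le_div_iff₀ (by positivity) (by positivity)]
          have hp : 0 < t ^ 2 := by positivity
          nlinarith
        linarith
    have p : 0 ≤ 1 / (((K : ℝ) + n + 1 / 2) * t) := by positivity
    linarith [this n]
  have a3 : ((∑ m ∈ Finset.range K, c m : ℚ) : ℝ) + 1 / (K + 1 / 2) ≤ 316 / 1000 := by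
    have : ((∑ m ∈ Finset.range K, c m + 1 / (K + 1 / 2) : ℚ) : ℝ) ≤ ((316 / 1000 : ℚ) : ℝ) := by exact_mod_cast hfin
    push_cast at this ⊢
    exact this
  calc _ ≤ ((∑ m ∈ Finset.range K, c m : ℚ) : ℝ) / t + 1 / ((K + 1 / 2) * t) := add_le_add a1 a2
    _ = (((∑ m ∈ Finset.range K, c m : ℚ) : ℝ) + 1 / (K + 1 / 2)) / t := by rw [add_div]; congr 1; field_simp
    _ ≤ _ := by gcongr

noncomputable def ff (t φ : ℝ) (m : ℕ) : ℝ := TT ((m + 1) * t) ((-1) ^ m * Real.cos ((m + 1) * φ)) / (m + 1)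

lemma sgn_cos_le (m : ℕ) (x : ℝ) : (-1) ^ m * Real.cos x ≤ 1 := by
  rcases neg_one_pow_eq_or ℝ m with h | h <;> rw [h]
  · linarith [Real.cos_le_one x]
  · linarith [Real.neg_one_le_cos x]

lemma ff_np (t φ : ℝ) (m : ℕ) (h : (-1) ^ m * Real.cos ((m + 1) * φ) ≤ 1 - (m + 1) * t) : ff t φ m ≤ 0 :=
  div_nonpos_of_nonpos_of_nonneg (TT_np _ _ h (sgn_cos_le _ _)) (by positivity)

lemma ff_le (t φ : ℝ) (ht : 0 < t) (m : ℕ) : ff t φ m ≤ 1 / ((m + 1) ^ 2 * t) := by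
  rw [ff, div_le_iff₀ (by positivity)]
  refine (TT_le0 _ _ (by positivity) (sgn_cos_le _ _)).trans (le_of_eq ?_)
  field_simp

lemma ff_le' (t φ : ℝ) (ht : 0 < t) (m : ℕ) : ff t φ m ≤ ((1 / (m + 1) ^ 2 : ℚ) : ℝ) / t := by
  refine (ff_le t φ ht m).trans (le_of_eq ?_)
  push_cast; field_simp

lemma cos_ub (x : ℝ) (h0 : 0 ≤ x) (h1 : x ≤ Real.pi) : Real.cos x ≤ 1 - 2 / 10 * x ^ 2 := by
  have := Real.cos_le_one_sub_mul_cos_sq (x := x) (by rwa [abs_of_nonneg h0])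
  have hp : Real.pi ^ 2 ≤ 10 := by nlinarith [Real.pi_lt_d2, Real.pi_pos]
  have : 2 / 10 ≤ 2 / Real.pi ^ 2 := by
    apply div_le_div_of_nonneg_left (by norm_num) (by positivity) hp
  nlinarith [sq_nonneg x]

lemma minor1 (t φ : ℝ) (ht : 0 < t) (ht2 : t ≤ 31 / 10000) (h1 : 2 * t ≤ φ) (h2 : φ ≤ 1 / 10) (hs : Summable (ff t φ)) :
    ∑' m, ff t φ m ≤ (316 / 1000) / t := by
  apply sumbd (ff t φ) t ht hs (ff_le t φ ht) 24 (fun m => if m % 2 = 0 then 21 / 100 / (m + 1) ^ 2 else 0)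
  · intro m hm
    have hm' : (m : ℝ) + 1 ≤ 24 := by exact_mod_cast hm
    have hφ : 0 < φ := by linarith
    have hm0 : (0 : ℝ) ≤ m := Nat.cast_nonneg m
    have hθ0 : 0 ≤ (m + 1) * φ := by positivity
    have hθ : (m + 1) * φ ≤ 24 / 10 := by nlinarith
    have hx : (m + 1) * t ≤ 744 / 10000 := by nlinarith
    have hpi := Real.pi_gt_d2
    by_cases hp : m % 2 = 0
    · simp only [hp, if_true]
      have hsg : (-1 : ℝ) ^ m = 1 := (Nat.even_iff.2 hp).neg_one_pow
      by_cases hc : (-1) ^ m * Real.cos ((m + 1) * φ) ≤ 1 - (m + 1) * t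
      · refine (ff_np t φ m hc).trans ?_
        push_cast; positivity
      · push Not at hc
        rw [hsg, one_mul] at hc
        have c1 := cos_ub ((m + 1) * φ) hθ0 (by linarith)
        have c2 : ((m + 1) * φ) ^ 2 ≤ 372 / 1000 := by nlinarith
        have c3 := (abs_le.1 (Real.cos_bound (x := (m + 1) * φ) (by rw [abs_of_nonneg hθ0]; nlinarith))).2
        rw [abs_of_nonneg hθ0] at c3
        have c4 : ((m + 1) * φ) ^ 4 ≤ 372 / 1000 * ((m + 1) * φ) ^ 2 := by nlinarith [sq_nonneg ((m + 1) * φ)]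
        have c5 : 4 * ((m + 1) * t) ^ 2 ≤ ((m + 1) * φ) ^ 2 := by
          have : (2 * ((m + 1) * t)) ^ 2 ≤ ((m + 1) * φ) ^ 2 := by
            apply pow_le_pow_left₀ (by positivity); nlinarith
          linarith
        have hxp : 0 < (m + 1) * t := by positivity
        have := TT_le ((m + 1) * t) (Real.cos ((m + 1) * φ)) (192 / 100 * ((m + 1) * t) ^ 2) hxp (by positivity) (by nlinarith)
        rw [ff, hsg, one_mul, div_le_iff₀ (by positivity)]
        refine this.trans ?_
        push_cast
        have e : (m + 1) * t / (((m + 1) * t) ^ 2 + 2 * (192 / 100 * ((m + 1) * t) ^ 2)) = (100 / 484) / ((m + 1) * t) := by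
          field_simp; norm_num
        rw [e]
        have e2 : (21 / 100 : ℝ) / (m + 1) ^ 2 / t * (m + 1) = (21 / 100) / ((m + 1) * t) := by field_simp
        rw [e2]
        exact div_le_div_of_nonneg_right (by norm_num) hxp.le
    · simp only [hp, if_false]
      have hsg : (-1 : ℝ) ^ m = -1 := (Nat.not_even_iff_odd.1 (by rwa [Nat.even_iff])).neg_one_pow
      have : ff t φ m ≤ 0 := by
        apply ff_np
        rw [hsg]
        have c1 := cos_ub (Real.pi - (m + 1) * φ) (by linarith) (by linarith)
        rw [Real.cos_pi_sub] at c1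
        nlinarith
      simpa using this
  · decide +kernel

/-- Chebyshev-type bounds near `φ = π/2` -/
lemma cheb (φ : ℝ) (j : ℕ) : |Real.sin ((2 * j : ℝ) * φ)| ≤ (2 * j) * |Real.cos φ| ∧ |Real.cos ((2 * j + 1 : ℝ) * φ)| ≤ (2 * j + 1) * |Real.cos φ| := by
  induction j with
  | zero => simp
  | succ j ih =>
    have key : ∀ a b x y: ℝ, |y| ≤ 1 → |x| ≤ b → |x * y| ≤ b := by
      intro a b x y hy hx
      rw [abs_mul]
      nlinarith [abs_nonneg x, abs_nonneg y]
    have h1 : |Real.sin ((2 * (j + 1 : ℕ) : ℝ) * φ)| ≤ (2 * (j + 1 : ℕ)) * |Real.cos φ| := by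
      have e : (2 * (j + 1 : ℕ) : ℝ) * φ = (2 * j + 1 : ℝ) * φ + φ := by push_cast; ring
      rw [e, Real.sin_add]
      refine (abs_add_le _ _).trans ?_
      have a1 : |Real.sin ((2 * j + 1 : ℝ) * φ) * Real.cos φ| ≤ |Real.cos φ| := by
        rw [mul_comm]; exact key 0 _ _ _ (Real.abs_sin_le_one _) le_rfl
      have a2 := key 0 _ _ _ (Real.abs_sin_le_one φ) ih.2
      push_cast
      linarith
    refine ⟨h1, ?_⟩
    have e : (2 * (j + 1 : ℕ) + 1 : ℝ) * φ = (2 * (j + 1 : ℕ) : ℝ) * φ + φ := by ring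
    rw [e, Real.cos_add]
    refine (abs_sub _ _).trans ?_
    have a1 : |Real.cos ((2 * (j + 1 : ℕ) : ℝ) * φ) * Real.cos φ| ≤ |Real.cos φ| := by
      rw [mul_comm]; exact key 0 _ _ _ (Real.abs_cos_le_one _) le_rfl
    have a2 := key 0 _ _ _ (Real.abs_sin_le_one φ) h1
    linarith

lemma ff_np_near (t φ : ℝ) (ht : 0 < t) (m : ℕ) (hm : m % 4 ≠ 1) (h : (m + 1) * |Real.cos φ| + (m + 1) * t ≤ 1) : ff t φ m ≤ 0 := by
  apply ff_np
  have hc0 : 0 ≤ ((m : ℝ) + 1) * |Real.cos φ| := by positivity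
  have ht0 : 0 < ((m : ℝ) + 1) * t := by positivity
  by_cases h2 : m % 2 = 0
  · obtain ⟨j, rfl⟩ : ∃ j, m = 2 * j := ⟨m / 2, by omega⟩
    have := (cheb φ j).2
    have hsg : (-1 : ℝ) ^ (2 * j) = 1 := by rw [pow_mul]; norm_num
    rw [hsg, one_mul]
    push_cast at h ⊢
    linarith [le_abs_self (Real.cos ((2 * j + 1 : ℝ) * φ))]
  · obtain ⟨j, rfl⟩ : ∃ j, m = 4 * j + 3 := ⟨m / 4, by omega⟩
    have := (cheb φ (j + 1)).1
    have hsg : (-1 : ℝ) ^ (4 * j + 3) = -1 := by rw [pow_add, pow_mul]; norm_num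
    rw [hsg]
    have e : (((4 * j + 3 : ℕ) : ℝ) + 1) * φ = 2 * ((2 * (j + 1 : ℕ) : ℝ) * φ) := by push_cast; ring
    rw [e, Real.cos_two_mul, Real.cos_sq']
    push_cast at *
    have hle : |Real.sin (2 * (j + 1 : ℝ) * φ)| ≤ 1 / 2 := by nlinarith
    have : Real.sin (2 * (j + 1 : ℝ) * φ) ^ 2 ≤ 1 / 4 := by
      rw [← sq_abs]; nlinarith [abs_nonneg (Real.sin (2 * (j + 1 : ℝ) * φ))]
    linarith

lemma minor2 (t φ : ℝ) (ht : 0 < t) (ht2 : t ≤ 31 / 10000) (h1 : 1 / 10 ≤ φ) (h2 : φ ≤ Real.pi) (hs : Summable (ff t φ)) :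
    ∑' m, ff t φ m ≤ (316 / 1000) / t := by
  have hpi := Real.pi_gt_d2
  have hc1 : Real.cos φ ≤ 1 - 49 / 10000 := by
    have a := Real.cos_le_cos_of_nonneg_of_le_pi (by norm_num : (0:ℝ) ≤ 1 / 10) h2 h1
    have b := (abs_le.1 (Real.cos_bound (x := 1 / 10) (by norm_num [abs_le]))).2
    have e : |(1 / 10 : ℝ)| = 1 / 10 := abs_of_pos (by norm_num)
    rw [e] at b
    linarith
  have f0 : ff t φ 0 ≤ 0 := by
    apply ff_np; simp; linarith
  set c := Real.cos φ with hc
  by_cases hc2 : c ^ 2 < t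
  · have hcabs : |c| ≤ 557 / 10000 := by
      apply abs_le_of_sq_le_sq _ (by norm_num)
      linarith
    by_cases hc3 : 6 / 10 * t ≤ |c|
    · apply sumbd (ff t φ) t ht hs (ff_le t φ ht) 14 (fun m => if m = 1 then 184 / 1000 else if m % 4 = 1 then 1 / (m + 1) ^ 2 else 0)
      · intro m hm
        by_cases hm1 : m = 1
        · subst hm1
          have e : ff t φ 1 = TT (2 * t) (1 - 2 * c ^ 2) / 2 := by
            rw [ff]; norm_num
            rw [Real.cos_two_mul, ← hc]; ring_nf
          rw [e]
          have := TT_le (2 * t) (1 - 2 * c ^ 2) (72 / 100 * t ^ 2) (by positivity) (by positivity) (by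
            have : (6 / 10 * t) ^ 2 ≤ |c| ^ 2 := pow_le_pow_left₀ (by positivity) hc3 2
            rw [sq_abs] at this
            linarith)
          have e2 : 2 * t / ((2 * t) ^ 2 + 2 * (72 / 100 * t ^ 2)) = (200 / 544) / t := by
            field_simp; norm_num
          rw [e2] at this
          simp only [if_true]
          push_cast
          have : (200 / 544 : ℝ) / t ≤ 368 / 1000 / t := div_le_div_of_nonneg_right (by norm_num) ht.le
          have : (184 / 1000 : ℝ) / t = 368 / 1000 / t / 2 := by ring
          linarith
        · simp only [hm1, if_false]
          by_cases hm4 : m % 4 = 1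
          · simp only [hm4, if_true]; exact ff_le' t φ ht m
          · simp only [hm4, if_false]
            have hm' : (m : ℝ) + 1 ≤ 14 := by exact_mod_cast hm
            have := ff_np_near t φ ht m hm4 (by rw [← hc]; nlinarith [abs_nonneg c])
            simpa using this
      · decide +kernel
    · apply sumbd (ff t φ) t ht hs (ff_le t φ ht) 120 (fun m => if m % 4 = 1 then 1 / (m + 1) ^ 2 else 0)
      · intro m hm
        push Not at hc3
        by_cases hm4 : m % 4 = 1
        · simp only [hm4, if_true]; exact ff_le' t φ ht m
        · simp only [hm4, if_false]
          have hm' : (m : ℝ) + 1 ≤ 120 := by exact_mod_cast hm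
          have := ff_np_near t φ ht m hm4 (by rw [← hc]; nlinarith [abs_nonneg c])
          simpa using this
      · decide +kernel
  · push Not at hc2
    have f1 : ff t φ 1 ≤ 0 := by
      apply ff_np
      norm_num
      rw [Real.cos_two_mul]; linarith
    have hcm : -1 ≤ c := Real.neg_one_le_cos φ
    by_cases hc3 : 3 * t ≤ (1 - c) * (2 * c + 1) ^ 2
    · have f2 : ff t φ 2 ≤ 0 := by
        apply ff_np
        norm_num
        rw [Real.cos_three_mul, ← hc]; nlinarith
      apply sumbd (ff t φ) t ht hs (ff_le t φ ht) 3 (fun m => 0)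
      · intro m hm
        interval_cases m <;> simpa
      · decide +kernel
    · push Not at hc3
      have b1 : c < 2 / 10 := by
        by_contra hh
        push Not at hh
        nlinarith [sq_nonneg (2 * c + 1)]
      have b2 : (2 * c + 1) ^ 2 < 117 / 10000 := by nlinarith [sq_nonneg (2 * c + 1)]
      have b3 := abs_lt_of_sq_lt_sq' (show (2 * c + 1) ^ 2 < (11 / 100) ^ 2 by linarith) (by norm_num)
      have b4 : -555 / 1000 < c := by linarith [b3.1]
      have b5 : c < -445 / 1000 := by linarith [b3.2]
      have f3 : ff t φ 3 ≤ 0 := by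
        apply ff_np
        norm_num
        have e : (4 : ℝ) * φ = 2 * (2 * φ) := by ring
        rw [e, Real.cos_two_mul, Real.cos_two_mul, ← hc]
        have : 198 / 1000 ≤ c ^ 2 := by nlinarith
        have : c ^ 2 ≤ 309 / 1000 := by nlinarith
        nlinarith
      have f4 : ff t φ 4 ≤ 0 := by
        apply ff_np
        norm_num
        have e : (5 : ℝ) * φ = 3 * φ + 2 * φ := by ring
        have e5 : Real.cos (5 * φ) = 16 * c ^ 5 - 20 * c ^ 3 + 5 * c := by
          rw [e, Real.cos_add, Real.cos_two_mul, Real.cos_three_mul, Real.sin_two_mul, Real.sin_three_mul, ← hc]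
          have hsq : Real.sin φ ^ 2 = 1 - c ^ 2 := by rw [hc, Real.sin_sq]
          linear_combination (-(6 * c) + 8 * c * (Real.sin φ ^ 2 + (1 - c ^ 2))) * hsq
        rw [e5]
        have p1 : 198 / 1000 ≤ c ^ 2 := by nlinarith
        have p2 : c ^ 2 ≤ 309 / 1000 := by nlinarith
        have : c * (16 * (c ^ 2) ^ 2 - 20 * c ^ 2 + 5) ≤ 0 ∨ c * (16 * (c ^ 2) ^ 2 - 20 * c ^ 2 + 5) ≤ 1 / 10 := by
          right
          have : -(1 / 10) ≤ 16 * (c ^ 2) ^ 2 - 20 * c ^ 2 + 5 ∨ True := Or.inr trivial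
          nlinarith
        rcases this with h | h <;> nlinarith
      apply sumbd (ff t φ) t ht hs (ff_le t φ ht) 5 (fun m => if m = 2 then 1 / 9 else 0)
      · intro m hm
        interval_cases m
        · simpa using f0
        · simpa using f1
        · have := ff_le' t φ ht 2
          norm_num at this ⊢
          exact this
        · simpa using f3
        · simpa using f4
      · decide +kernel

lemma minor (t φ : ℝ) (ht : 0 < t) (ht2 : t ≤ 31 / 10000) (h1 : 2 * t ≤ |φ|) (h2 : |φ| ≤ Real.pi) :
    ‖ev PP (Complex.exp (-(t - Complex.I * φ)))‖ ≤ Real.exp ((316 / 1000) / t) := by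
  have hq : ‖Complex.exp (-(t - Complex.I * φ))‖ < 1 := by
    apply norm_exp_lt_one; simpa using ht
  obtain ⟨hs, hn⟩ := PP_norm _ hq
  have e : (fun m : ℕ => (((-1) ^ m * Complex.exp (-(t - Complex.I * φ)) ^ (m + 1)) / (1 - (-1) ^ m * Complex.exp (-(t - Complex.I * φ)) ^ (m + 1))).re / (m + 1)) = ff t |φ| := by
    funext m
    rw [TT_eq, ff]
    have : Real.cos ((m + 1) * |φ|) = Real.cos ((m + 1) * φ) := by
      rcases abs_cases φ with ⟨h, _⟩ | ⟨h, _⟩ <;> rw [h]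
      rw [mul_neg, Real.cos_neg]
    rw [this]
  rw [hn]
  rw [e] at hs ⊢
  apply Real.exp_le_exp.2
  by_cases h : |φ| ≤ 1 / 10
  · exact minor1 t |φ| ht ht2 h1 h hs
  · exact minor2 t |φ| ht ht2 (by linarith) h2 hs

lemma sqrt_re_nonneg (z : ℂ) : 0 ≤ (z ^ (1 / 2 : ℂ)).re := by
  by_cases hz : z = 0
  · rw [hz, Complex.zero_cpow (by norm_num)]; simp
  · rw [Complex.cpow_def_of_ne_zero hz, Complex.exp_re]
    apply mul_nonneg (Real.exp_pos _).le
    apply Real.cos_nonneg_of_neg_pi_div_two_le_of_le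
    all_goals
      have e : (Complex.log z * (1 / 2)).im = z.arg / 2 := by
        have : Complex.log z * (1 / 2) = ((1 / 2 : ℝ) : ℂ) * Complex.log z := by push_cast; ring
        rw [this, Complex.im_ofReal_mul, Complex.log_im]; ring
      rw [e]
      linarith [Complex.neg_pi_lt_arg z, Complex.arg_le_pi z]

lemma sqrt_facts (x : ℝ) : ∃ p q : ℝ, ((1 - Complex.I * x) ^ (1 / 2 : ℂ))⁻¹ = p + q * Complex.I ∧ ((1 - Complex.I * x) ^ (1 / 2 : ℂ)) ^ 2 = 1 - Complex.I * x ∧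
    1 - x ^ 2 / 2 ≤ p ∧ p ≤ 1 ∧ |q| ≤ |x| / 2 ∧ 0 ≤ p ∧ ‖((1 - Complex.I * x) ^ (1 / 2 : ℂ))⁻¹‖ ≤ 1 := by
  have hb2 : ((1 - Complex.I * x) ^ (1 / 2 : ℂ)) ^ 2 = 1 - Complex.I * x := by
    have := Complex.cpow_nat_inv_pow (1 - Complex.I * x) (n := 2) (by norm_num)
    rw [one_div]; exact_mod_cast this
  have hre := sqrt_re_nonneg (1 - Complex.I * x)
  set b := (1 - Complex.I * x) ^ (1 / 2 : ℂ) with hb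
  have e1 : b.re ^ 2 - b.im ^ 2 = 1 := by
    have := congrArg Complex.re hb2
    simp [sq] at this
    linarith
  have e2 : 2 * b.re * b.im = -x := by
    have := congrArg Complex.im hb2
    simp [sq] at this
    linarith
  have hp : 1 ≤ b.re := by nlinarith [sq_nonneg b.im]
  have hm : Complex.normSq b = b.re ^ 2 + b.im ^ 2 := by rw [Complex.normSq_apply]; ring
  have hm1 : 1 ≤ Complex.normSq b := by rw [hm]; nlinarith [sq_nonneg b.im]
  have hq : |b.im| ≤ |x| / 2 := by
    have : |x| = 2 * b.re * |b.im| := by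
      rw [← abs_neg x, ← e2, abs_mul, abs_of_pos (by linarith)]
    rw [this]; nlinarith [abs_nonneg b.im]
  have hq2 : b.im ^ 2 ≤ x ^ 2 / 4 := by
    rw [← sq_abs, ← sq_abs x]; nlinarith [abs_nonneg b.im]
  refine ⟨b.re / Complex.normSq b, -b.im / Complex.normSq b, ?_, hb2, ?_, ?_, ?_, ?_, ?_⟩
  · apply Complex.ext
    · rw [Complex.inv_re]; simp
    · rw [Complex.inv_im]; simp
  · rw [le_div_iff₀ (by linarith)]
    by_cases h : 1 - x ^ 2 / 2 ≤ 0
    · nlinarith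
    · push Not at h
      rw [hm]; nlinarith [mul_nonneg (sq_nonneg x) (sq_nonneg b.im), sq_nonneg x]
  · rw [div_le_one (by linarith), hm]; nlinarith [sq_nonneg b.im]
  · rw [abs_div, abs_neg, abs_of_pos (by linarith : 0 < Complex.normSq b)]
    exact (div_le_self (abs_nonneg _) hm1).trans hq
  · positivity
  · rw [norm_inv]
    apply inv_le_one_of_one_le₀
    exact hp.trans (Complex.re_le_norm b)

noncomputable def JJ (Λ x : ℝ) : ℂ := ((1 - Complex.I * x) ^ (1 / 2 : ℂ))⁻¹ * Complex.exp (Λ * (2 - x ^ 2 / (1 - Complex.I * x)))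

lemma JJ_exp (Λ x : ℝ) : (Λ * (2 - x ^ 2 / (1 - Complex.I * x)) : ℂ) = ((2 * Λ - Λ * (x ^ 2 / (1 + x ^ 2)) : ℝ) : ℂ) + ((-(Λ * x ^ 3 / (1 + x ^ 2)) : ℝ) : ℂ) * Complex.I := by
  have h1 : (1 - Complex.I * x) ≠ 0 := by
    intro h
    have := congrArg Complex.re h
    simp at this
  have h2 : (1 + (x : ℂ) ^ 2) ≠ 0 := by
    have : (1 + x ^ 2) ≠ 0 := by positivity
    exact_mod_cast this
  have h3 : (x : ℂ) ^ 2 / (1 - Complex.I * x) = x ^ 2 * (1 + Complex.I * x) / (1 + x ^ 2) := by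
    rw [div_eq_div_iff h1 h2]
    linear_combination ((x : ℂ) ^ 4) * Complex.I_sq
  rw [h3]
  push_cast
  field_simp
  ring

lemma JJ_norm (Λ x : ℝ) : ‖JJ Λ x‖ ≤ Real.exp (2 * Λ - Λ * (x ^ 2 / (1 + x ^ 2))) := by
  obtain ⟨p, q, -, -, -, -, -, -, h⟩ := sqrt_facts x
  rw [JJ, norm_mul, Complex.norm_exp, JJ_exp]
  have : (((2 * Λ - Λ * (x ^ 2 / (1 + x ^ 2)) : ℝ) : ℂ) + ((-(Λ * x ^ 3 / (1 + x ^ 2)) : ℝ) : ℂ) * Complex.I).re = 2 * Λ - Λ * (x ^ 2 / (1 + x ^ 2)) := by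
    rw [Complex.add_re, Complex.re_ofReal_mul, Complex.ofReal_re, Complex.I_re, mul_zero, add_zero]
  rw [this]
  exact mul_le_of_le_one_left (Real.exp_pos _).le h

lemma poly_exp (y : ℝ) (hy : 0 ≤ y) : (y + y ^ 2 + y ^ 3) ≤ 20 * Real.exp (y / 2) := by
  have h := Real.sum_le_exp_of_nonneg (x := y / 2) (by positivity) 5
  simp [Finset.sum_range_succ, Nat.factorial] at h
  have : (y + y ^ 2 + y ^ 3) ≤ 20 * (1 + y / 2 + (y / 2) ^ 2 / 2 + (y / 2) ^ 3 / 6 + (y / 2) ^ 4 / 24) := by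
    nlinarith [sq_nonneg (y * (y - 56 / 10)), sq_nonneg y, sq_nonneg (y ^ 2)]
  linarith

lemma JJ_re (Λ x : ℝ) (hΛ : 1 ≤ Λ) (hx : |x| ≤ 2) :
    Real.exp (2 * Λ) * (Real.exp (-Λ * x ^ 2) - 10 / Λ * Real.exp (-(4 / 10 * Λ) * x ^ 2) - 2 * Real.exp (-Λ / 10)) ≤ (JJ Λ x).re := by
  have hΛ0 : 0 < Λ := by linarith
  by_cases hx3 : |x| ≤ 1 / 3
  · obtain ⟨p, q, hpq, -, h1, h2, h3, h4, -⟩ := sqrt_facts x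
    set ψ := -(Λ * x ^ 3 / (1 + x ^ 2)) with hψ
    have hre : (JJ Λ x).re = Real.exp (2 * Λ) * (Real.exp (-(Λ * (x ^ 2 / (1 + x ^ 2)))) * (p * Real.cos ψ - q * Real.sin ψ)) := by
      rw [JJ, hpq, JJ_exp, Complex.exp_add, Complex.exp_mul_I, ← Complex.ofReal_exp, ← Complex.ofReal_cos, ← Complex.ofReal_sin, ← hψ, sub_eq_add_neg (2 * Λ), Real.exp_add]
      simp only [Complex.mul_re, Complex.mul_im, Complex.add_re, Complex.add_im, Complex.ofReal_re, Complex.ofReal_im, Complex.I_re, Complex.I_im]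
      ring
    rw [hre]
    apply mul_le_mul_of_nonneg_left _ (Real.exp_pos _).le
    have hx2 : x ^ 2 ≤ 1 / 9 := by rw [← sq_abs]; nlinarith [abs_nonneg x]
    have hψa : |ψ| ≤ Λ * |x| ^ 3 := by
      rw [hψ, abs_neg, abs_div, abs_mul, abs_of_pos hΛ0, abs_pow, abs_of_pos (by positivity : 0 < 1 + x ^ 2)]
      apply div_le_self (by positivity)
      nlinarith [sq_nonneg x]
    set y := Λ * x ^ 2 with hy
    have hy0 : 0 ≤ y := by positivity
    set Q := (y + y ^ 2 + y ^ 3) / (2 * Λ) with hQ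
    have hQe : Q = x ^ 2 / 2 + Λ * x ^ 4 / 2 + Λ ^ 2 * x ^ 6 / 2 := by
      rw [hQ, hy]; field_simp
    have hbr : 1 - Q ≤ p * Real.cos ψ - q * Real.sin ψ := by
      have c1 := Real.one_sub_sq_div_two_le_cos (x := ψ)
      have c2 : q * Real.sin ψ ≤ |x| / 2 * (Λ * |x| ^ 3) := by
        refine (le_abs_self _).trans ?_
        rw [abs_mul]
        exact mul_le_mul h3 ((Real.abs_sin_le_abs).trans hψa) (abs_nonneg _) (by positivity)
      have c3 : ψ ^ 2 ≤ Λ ^ 2 * x ^ 6 := by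
        rw [← sq_abs]
        have : |ψ| ^ 2 ≤ (Λ * |x| ^ 3) ^ 2 := pow_le_pow_left₀ (abs_nonneg _) hψa 2
        refine this.trans (le_of_eq ?_)
        rw [mul_pow, ← pow_mul]
        congr 1
        have : |x| ^ 6 = (|x| ^ 2) ^ 3 := by ring
        norm_num
        rw [this, sq_abs]; ring
      have c4 : |x| / 2 * (Λ * |x| ^ 3) = Λ * x ^ 4 / 2 := by
        have : |x| ^ 4 = x ^ 4 := by
          have : |x| ^ 4 = (|x| ^ 2) ^ 2 := by ring
          rw [this, sq_abs]; ring
        rw [← this]; ring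
      have c5 : p * (1 - ψ ^ 2 / 2) ≤ p * Real.cos ψ := mul_le_mul_of_nonneg_left c1 h4
      have c6 : p * ψ ^ 2 ≤ ψ ^ 2 := mul_le_of_le_one_left (sq_nonneg _) h2
      rw [hQe]; nlinarith
    have hw1 : Real.exp (-Λ * x ^ 2) ≤ Real.exp (-(Λ * (x ^ 2 / (1 + x ^ 2)))) := by
      apply Real.exp_le_exp.2
      have : x ^ 2 / (1 + x ^ 2) ≤ x ^ 2 := div_le_self (sq_nonneg _) (by nlinarith [sq_nonneg x])
      nlinarith
    have hw2 : Real.exp (-(Λ * (x ^ 2 / (1 + x ^ 2)))) ≤ Real.exp (-(9 / 10) * y) := by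
      apply Real.exp_le_exp.2
      have : 9 / 10 * x ^ 2 ≤ x ^ 2 / (1 + x ^ 2) := by
        rw [le_div_iff₀ (by positivity)]; nlinarith [sq_nonneg x]
      rw [hy]; nlinarith
    set w := Real.exp (-(Λ * (x ^ 2 / (1 + x ^ 2)))) with hw
    have hw0 : 0 < w := Real.exp_pos _
    have hQ2 : Q ≤ 10 / Λ * Real.exp (y / 2) := by
      rw [hQ, div_mul_eq_mul_div, div_le_div_iff₀ (by positivity) hΛ0]
      nlinarith [poly_exp y hy0]
    have hQ0 : 0 ≤ Q := by positivity
    have hwQ : w * Q ≤ 10 / Λ * Real.exp (-(4 / 10 * Λ) * x ^ 2) := by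
      calc w * Q ≤ Real.exp (-(9 / 10) * y) * (10 / Λ * Real.exp (y / 2)) := mul_le_mul hw2 hQ2 hQ0 (Real.exp_pos _).le
        _ = 10 / Λ * Real.exp (-(4 / 10 * Λ) * x ^ 2) := by
          rw [mul_left_comm, ← Real.exp_add, hy]; congr 2; ring
    have : w * (1 - Q) ≤ w * (p * Real.cos ψ - q * Real.sin ψ) := mul_le_mul_of_nonneg_left hbr hw0.le
    have := Real.exp_pos (-Λ / 10)
    nlinarith
  · push Not at hx3
    have hx2 : 1 / 9 ≤ x ^ 2 := by rw [← sq_abs]; nlinarith [abs_nonneg x]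
    have a1 : Real.exp (-Λ * x ^ 2) ≤ Real.exp (-Λ / 10) := by
      apply Real.exp_le_exp.2; nlinarith
    have a2 : Real.exp (2 * Λ - Λ * (x ^ 2 / (1 + x ^ 2))) ≤ Real.exp (2 * Λ) * Real.exp (-Λ / 10) := by
      rw [← Real.exp_add]
      apply Real.exp_le_exp.2
      have : 1 / 10 ≤ x ^ 2 / (1 + x ^ 2) := by
        rw [le_div_iff₀ (by positivity)]; linarith
      nlinarith
    have a3 := (Complex.abs_re_le_norm (JJ Λ x)).trans (JJ_norm Λ x)
    have a4 := (abs_le.1 a3).1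
    have a5 : 0 ≤ 10 / Λ * Real.exp (-(4 / 10 * Λ) * x ^ 2) := by positivity
    have a6 := Real.exp_pos (2 * Λ)
    nlinarith [Real.exp_pos (-Λ / 10)]

lemma cpow_half_real_mul (r : ℝ) (hr : 0 < r) (z : ℂ) (hz : z ≠ 0) : ((r : ℂ) * z) ^ (1 / 2 : ℂ) = (√r : ℂ) * z ^ (1 / 2 : ℂ) := by
  have hr' : (r : ℂ) ≠ 0 := by exact_mod_cast hr.ne'
  rw [Complex.cpow_def_of_ne_zero (mul_ne_zero hr' hz), Complex.cpow_def_of_ne_zero hz, Complex.log_ofReal_mul hr hz, add_mul, Complex.exp_add]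
  congr 1
  rw [Real.sqrt_eq_rpow, Real.rpow_def_of_pos hr]
  push_cast
  rfl

lemma sinh_eq_eps (z : ℂ) : Complex.sinh z = Complex.exp z * (1 - Complex.exp (-2 * z)) / 2 := by
  have : Complex.exp (-z) = Complex.exp z * Complex.exp (-2 * z) := by rw [← Complex.exp_add]; congr 1; ring
  rw [Complex.sinh, this]; ring

lemma s_ne (t x : ℝ) (ht : 0 < t) : (t * (1 - Complex.I * x) : ℂ) ≠ 0 := by
  intro h
  have := congrArg Complex.re h
  simp at this
  linarith

/-- the exact main term -/
lemma main_exact (S : ℝ) (t x Λ : ℝ) (n : ℕ) (ht : 0 < t) (h1 : 25 * Real.pi ^ 2 / 648 = Λ * t) (h2 : ((n : ℝ) - 1 / 8) * t = Λ)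
    (s : ℂ) (hs : s = t * (1 - Complex.I * x)) (hε : 1 - Complex.exp (-2 * (Real.pi ^ 2 / (9 * s))) ≠ 0) :
    ((2 * s / Real.pi) ^ (1 / 2 : ℂ) / (√2 : ℂ) * Complex.exp (Real.pi ^ 2 / (8 * s) - s / 8)) *
      (Real.pi * (4 * (S : ℂ) * Complex.exp (2 * Real.pi ^ 2 / (81 * s)) / (9 * s * Complex.sinh (Real.pi ^ 2 / (9 * s))))) * Complex.exp (n * s)
    = ((8 * Real.pi * S / 9 / √(Real.pi * t) : ℝ) : ℂ) * JJ Λ x * (1 - Complex.exp (-2 * (Real.pi ^ 2 / (9 * s))))⁻¹ := by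
  have hpi := Real.pi_pos
  have hs0 : s ≠ 0 := by rw [hs]; exact s_ne t x ht
  have hb0 : (1 - Complex.I * x : ℂ) ≠ 0 := by
    intro h; exact s_ne t x ht (by rw [h, mul_zero])
  obtain ⟨-, -, -, hb2, -⟩ := sqrt_facts x
  have e1 : (2 * s / Real.pi) ^ (1 / 2 : ℂ) = (√(2 * (t / Real.pi)) : ℂ) * (1 - Complex.I * x) ^ (1 / 2 : ℂ) := by
    rw [← cpow_half_real_mul _ (by positivity) _ hb0, hs]
    congr 1; push_cast; ring
  rw [e1, sinh_eq_eps, JJ]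
  set b := (1 - Complex.I * x : ℂ) ^ (1 / 2 : ℂ) with hb
  have hbne : b ≠ 0 := by
    intro h; rw [h] at hb2; apply hb0; rw [← hb2]; simp
  rw [Real.sqrt_mul (by norm_num)]
  have h22 : (√2 : ℂ) ≠ 0 := by
    have : √2 ≠ 0 := by positivity
    exact_mod_cast this
  have e2 : √(t / Real.pi) = t / √(Real.pi * t) := by
    rw [eq_div_iff (by positivity), ← Real.sqrt_mul (by positivity)]
    rw [show t / Real.pi * (Real.pi * t) = t ^ 2 by field_simp]
    exact Real.sqrt_sq ht.le
  rw [e2]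
  have hpt : (√(Real.pi * t) : ℂ) ≠ 0 := by
    have : √(Real.pi * t) ≠ 0 := by positivity
    exact_mod_cast this
  have htc : (t : ℂ) ≠ 0 := by exact_mod_cast ht.ne'
  have e3 : Complex.exp (Λ * (2 - x ^ 2 / (1 - Complex.I * x))) * Complex.exp (Real.pi ^ 2 / (9 * s)) = Complex.exp (Real.pi ^ 2 / (8 * s) - s / 8) * Complex.exp (2 * Real.pi ^ 2 / (81 * s)) * Complex.exp (n * s) := by
    rw [← Complex.exp_add, ← Complex.exp_add, ← Complex.exp_add]
    congr 1
    have h1c : (25 * Real.pi ^ 2 / 648 : ℂ) = Λ * t := by exact_mod_cast h1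
    have h2c : ((n : ℂ) - 1 / 8) * t = Λ := by
      have : (((n : ℝ) - 1 / 8) * t : ℝ) = Λ := h2
      rw [← this]; push_cast; ring
    have q1 : (Real.pi ^ 2 / (8 * s) - s / 8 + 2 * Real.pi ^ 2 / (81 * s) + n * s : ℂ) - Real.pi ^ 2 / (9 * s) = (25 * Real.pi ^ 2 / 648) / s + (n - 1 / 8) * s := by
      field_simp; ring
    have q2 : (25 * Real.pi ^ 2 / 648) / s = (Λ / (1 - Complex.I * x) : ℂ) := by
      rw [h1c, hs]; field_simp
    have q3 : (n - 1 / 8) * s = (Λ * (1 - Complex.I * x) : ℂ) := by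
      rw [hs, ← h2c]; ring
    have q4 : (Λ * (2 - x ^ 2 / (1 - Complex.I * x)) : ℂ) = Λ / (1 - Complex.I * x) + Λ * (1 - Complex.I * x) := by
      rw [← sub_eq_zero]
      have : (Λ * (2 - x ^ 2 / (1 - Complex.I * x)) : ℂ) - (Λ / (1 - Complex.I * x) + Λ * (1 - Complex.I * x)) = Λ * (2 * (1 - Complex.I * x) - x ^ 2 - 1 - (1 - Complex.I * x) ^ 2) / (1 - Complex.I * x) := by
        generalize (1 - Complex.I * x : ℂ) = w at hb0
        field_simp
        ring
      rw [this, show (2 * (1 - Complex.I * x) - x ^ 2 - 1 - (1 - Complex.I * x) ^ 2 : ℂ) = 0 by linear_combination (-(x : ℂ) ^ 2) * Complex.I_sq]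
      simp
    rw [q4, ← q2, ← q3]
    linear_combination -q1
  have hE := Complex.exp_ne_zero (Real.pi ^ 2 / (9 * s))
  generalize Complex.exp (Real.pi ^ 2 / (9 * s)) = E1 at *
  generalize Complex.exp (Λ * (2 - x ^ 2 / (1 - Complex.I * x))) = E2 at *
  generalize Complex.exp (Real.pi ^ 2 / (8 * s) - s / 8) = E3 at *
  generalize Complex.exp (2 * Real.pi ^ 2 / (81 * s)) = E4 at *
  generalize Complex.exp (n * s) = E5 at *
  generalize Complex.exp (-2 * (Real.pi ^ 2 / (9 * s))) = E6 at *
  have hs2 : s = t * b ^ 2 := by rw [hb2, hs]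
  rw [hs2]
  have e4 : E2 = E3 * E4 * E5 / E1 := by rw [eq_div_iff hE, e3]
  rw [e4]
  push_cast
  field_simp
  ring

/-- value of the integrand on the circle -/
noncomputable def FC (ρ σ n : ℕ) (t φ : ℝ) : ℂ :=
  ev (PP * LL ρ σ) (Complex.exp (-(t - Complex.I * φ))) * Complex.exp (n * (t - Complex.I * φ))

lemma inv_one_add_bd (u : ℂ) (e : ℝ) (h : ‖u‖ ≤ e) (he : e ≤ 1 / 2) : ‖(1 + u)⁻¹ - 1‖ ≤ 2 * e := by
  have h1 : 1 / 2 ≤ ‖1 + u‖ := by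
    have := norm_sub_le (1 + u) u
    simp at this
    linarith
  have h0 : 1 + u ≠ 0 := by intro h; rw [h] at h1; simp at h1; linarith
  have : (1 + u)⁻¹ - 1 = -u / (1 + u) := by field_simp; ring
  rw [this, norm_div, norm_neg, div_le_iff₀ (by linarith)]
  nlinarith [norm_nonneg u]

lemma one_div_re_bds (t φ : ℝ) (ht : 0 < t) (h : |φ| ≤ 2 * t) :
    1 / (5 * t) ≤ (1 / (t - Complex.I * φ : ℂ)).re ∧ (1 / (t - Complex.I * φ : ℂ)).re ≤ 1 / t := by
  have e : (1 / (t - Complex.I * φ : ℂ)).re = t / (t ^ 2 + φ ^ 2) := by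
    rw [one_div, Complex.inv_re, Complex.normSq_apply]
    simp
    ring
  have h2 : φ ^ 2 ≤ 4 * t ^ 2 := by rw [← sq_abs]; nlinarith [abs_nonneg φ]
  rw [e]
  constructor
  · rw [div_le_div_iff₀ (by positivity) (by positivity)]; nlinarith
  · rw [div_le_div_iff₀ (by positivity) (by positivity)]; nlinarith [sq_nonneg φ]

lemma exp_neg_124 : Real.exp (-(15 / 100 * 124)) ≤ 1 / 100 := by
  have h := Real.add_one_le_exp (15 / 100 * 124 / 2 : ℝ)
  have h2 : Real.exp (15 / 100 * 124 : ℝ) = Real.exp (15 / 100 * 124 / 2 : ℝ) ^ 2 := by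
    rw [← Real.exp_nat_mul]; congr 1; norm_num
  rw [Real.exp_neg, inv_le_comm₀ (Real.exp_pos _) (by norm_num), h2]
  nlinarith

set_option maxHeartbeats 1600000 in
lemma major_pt (α β γ ρ σ n : ℕ) (h : α + β + γ ≤ 10) (S : ℝ) (hS : S = Real.sin (α * Real.pi / 9) * Real.sin (β * Real.pi / 9) * Real.sin (γ * Real.pi / 9)) (hS0 : 0 ≤ S)
    (hLL : ∀ s : ℂ, 0 < s.re → HasSum (fun k : ℕ => (-1 : ℂ) ^ k * (Complex.exp (-2 * (k + 1) ^ 2 * s) * HH α β γ ((k + 1) * s))) (ev (LL ρ σ) (Complex.exp (-s))))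
    (t Λ φ : ℝ) (ht : 0 < t) (ht2 : t ≤ 31 / 10000) (h1 : 25 * Real.pi ^ 2 / 648 = Λ * t) (h2 : ((n : ℝ) - 1 / 8) * t = Λ) (h3 : 124 ≤ Λ) (hφ : |φ| ≤ 2 * t) :
    (8 * Real.pi * S / 9 / √(Real.pi * t)) * (Real.exp (2 * Λ) * (Real.exp (-Λ * (φ / t) ^ 2) - 10 / Λ * Real.exp (-(4 / 10 * Λ) * (φ / t) ^ 2) - 2 * Real.exp (-Λ / 10) - Real.exp (-Λ)))
      - 60 * Real.exp (136 / 100 * Λ) ≤ (FC ρ σ n t φ).re := by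
  have hpi := Real.pi_pos
  set s : ℂ := t - Complex.I * φ with hs
  set x := φ / t with hx
  have hsx : s = t * (1 - Complex.I * x) := by
    have : (t : ℂ) ≠ 0 := by exact_mod_cast ht.ne'
    rw [hs, hx]; push_cast; field_simp
  have hre : s.re = t := by rw [hs]; simp
  have him : s.im = -φ := by rw [hs]; simp
  have hsre : 0 < s.re := by rw [hre]; exact ht
  obtain ⟨hR1, hR2⟩ := one_div_re_bds t φ ht hφ
  rw [← hs] at hR1 hR2
  set R := (1 / s).re with hR
  have hRt : 1 ≤ R := by
    refine le_trans ?_ hR1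
    rw [le_div_iff₀ (by positivity)]; linarith
  have hxa : |x| ≤ 2 := by
    rw [hx, abs_div, abs_of_pos ht, div_le_iff₀ ht]; exact hφ
  have hpiR1 : 648 / 125 * Λ ≤ Real.pi ^ 2 * R := by
    have : 648 / 125 * Λ = Real.pi ^ 2 * (1 / (5 * t)) := by
      field_simp; linarith
    rw [this]; exact mul_le_mul_of_nonneg_left hR1 (by positivity)
  have hpiR2 : Real.pi ^ 2 * R ≤ 648 / 25 * Λ := by
    have : 648 / 25 * Λ = Real.pi ^ 2 * (1 / t) := by
      field_simp; linarith
    rw [this]; exact mul_le_mul_of_nonneg_left hR2 (by positivity)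
  obtain ⟨δ, hδ, hP⟩ := PP_modular s hsre (by rw [← hR]; exact hRt)
  rw [← hR] at hδ
  have hE := L_est α β γ h s hsre (by rw [hre, him, abs_neg]; exact hφ) (by rw [← hR]; exact hRt) _ (hLL s hsre)
  rw [← hR, hre] at hE
  set ε := Complex.exp (-2 * (Real.pi ^ 2 / (9 * s))) with hε
  have hs0 : s ≠ 0 := by rw [hsx]; exact s_ne t x ht
  have hq : Real.exp (-Λ) * Real.exp (-(15 / 100 * 124)) ≤ Real.exp (-Λ) / 100 := by
    have := mul_le_mul_of_nonneg_left exp_neg_124 (Real.exp_pos (-Λ)).le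
    linarith
  have hεn : ‖ε‖ ≤ Real.exp (-Λ) / 100 := by
    refine le_trans ?_ hq
    rw [hε, Complex.norm_exp, ← Real.exp_add]
    apply Real.exp_le_exp.2
    have : (-2 * (Real.pi ^ 2 / (9 * s)) : ℂ) = ((-2 * Real.pi ^ 2 / 9 : ℝ) : ℂ) * (1 / s) := by
      push_cast; field_simp
    rw [this, Complex.re_ofReal_mul, ← hR]
    linarith
  have hδn : ‖δ‖ ≤ 4 * (Real.exp (-Λ) / 100) := by
    refine hδ.trans ?_
    apply mul_le_mul_of_nonneg_left _ (by norm_num)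
    refine le_trans ?_ hq
    rw [← Real.exp_add]
    apply Real.exp_le_exp.2
    linarith
  have heΛ : Real.exp (-Λ) ≤ 1 := by rw [Real.exp_le_one_iff]; linarith
  have heΛ0 := Real.exp_pos (-Λ)
  set u := δ - ε - ε * δ with hu
  have hun : ‖u‖ ≤ Real.exp (-Λ) / 4 := by
    have a1 : ‖u‖ ≤ ‖δ‖ + ‖ε‖ + ‖ε‖ * ‖δ‖ := by
      rw [hu, ← norm_mul]
      exact (norm_sub_le _ _).trans (by linarith [norm_sub_le δ ε])
    have a2 : ‖ε‖ * ‖δ‖ ≤ ‖ε‖ * 1 := mul_le_mul_of_nonneg_left (by linarith) (norm_nonneg _)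
    linarith
  have hinv := inv_one_add_bd u _ hun (by linarith)
  have h1u : 1 + u = (1 - ε) * (1 + δ) := by rw [hu]; ring
  have hεne : 1 - ε ≠ 0 := by
    intro h
    have : ε = 1 := by linear_combination -h
    rw [this] at hεn; simp at hεn; linarith
  have hδh : 1 / 2 ≤ ‖1 + δ‖ := by
    have := norm_sub_le (1 + δ) δ
    simp at this
    linarith
  have hδne : 1 + δ ≠ 0 := by
    intro h; rw [h] at hδh; simp at hδh; linarith
  set M := (2 * s / Real.pi) ^ (1 / 2 : ℂ) / (√2 : ℂ) * Complex.exp (Real.pi ^ 2 / (8 * s) - s / 8) with hM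
  set L := ev (LL ρ σ) (Complex.exp (-s)) with hL
  have hmain := main_exact S t x Λ n ht h1 h2 s hsx hεne
  rw [← hM, ← hε] at hmain
  have hrho : rhoL α β γ s = 4 * (S : ℂ) * Complex.exp (2 * Real.pi ^ 2 / (81 * s)) / (9 * s * Complex.sinh (Real.pi ^ 2 / (9 * s))) := by
    rw [rhoL, hS]
  rw [← hrho] at hmain
  set K := 8 * Real.pi * S / 9 / √(Real.pi * t) with hK
  have hK0 : 0 ≤ K := by positivity
  have hq1 : ‖Complex.exp (-s)‖ < 1 := norm_exp_lt_one s hsre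
  have hF : FC ρ σ n t φ = K * JJ Λ x + K * JJ Λ x * ((1 + u)⁻¹ - 1) + M * (L - Real.pi * rhoL α β γ s) * Complex.exp (n * s) / (1 + δ) := by
    have e1 : FC ρ σ n t φ = ev PP (Complex.exp (-s)) * L * Complex.exp (n * s) := by
      rw [FC, ← hs, ev_mul (CV_PP _ hq1) (CV_LL _ _ _ hq1)]
    have e2 : ev PP (Complex.exp (-s)) = M / (1 + δ) := by rw [eq_div_iff hδne, hP]
    have e3 : K * JJ Λ x = M * (Real.pi * rhoL α β γ s) * Complex.exp (n * s) * (1 - ε) := by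
      rw [hmain]; field_simp
    rw [e1, e2, h1u, e3]
    field_simp
    ring
  have hMn : ‖M * (L - Real.pi * rhoL α β γ s) * Complex.exp (n * s) / (1 + δ)‖ ≤ 60 * Real.exp (136 / 100 * Λ) := by
    have hc : ‖(2 * s / Real.pi : ℂ) ^ (1 / 2 : ℂ)‖ = √(2 * ‖s‖ / Real.pi) := by
      have q : ((2 * s / Real.pi : ℂ) ^ (1 / 2 : ℂ)) ^ 2 = 2 * s / Real.pi := by
        have := Complex.cpow_nat_inv_pow (2 * s / Real.pi) (n := 2) (by norm_num)
        rw [one_div]; exact_mod_cast this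
      have q2 := congrArg norm q
      rw [norm_pow] at q2
      rw [← Real.sqrt_sq (norm_nonneg ((2 * s / Real.pi : ℂ) ^ (1 / 2 : ℂ))), q2]
      congr 1
      simp [abs_of_pos hpi]
    have hsn : ‖s‖ ≤ 5 / 2 * t := by
      have e : ‖s‖ ^ 2 = t ^ 2 + φ ^ 2 := by
        rw [← Complex.normSq_eq_norm_sq, Complex.normSq_apply, hre, him]; ring
      have : φ ^ 2 ≤ 4 * t ^ 2 := by rw [← sq_abs]; nlinarith [abs_nonneg φ]
      nlinarith [norm_nonneg s]
    have hsq : √(2 * ‖s‖ / Real.pi) / √2 * √(Real.pi / t) ≤ 8 / 5 := by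
      rw [← Real.sqrt_div (by positivity), ← Real.sqrt_mul (by positivity)]
      apply Real.sqrt_le_iff.2 ⟨by norm_num, ?_⟩
      have : 2 * ‖s‖ / Real.pi / 2 * (Real.pi / t) = ‖s‖ / t := by field_simp
      rw [this, div_le_iff₀ ht]
      linarith
    have hex : Real.exp (25 * t) ≤ 110 / 100 := by
      have := Real.exp_bound_div_one_sub_of_interval (x := 25 * t) (by positivity) (by linarith)
      refine this.trans ?_
      rw [div_le_iff₀ (by linarith)]
      linarith
    have hexpM : ‖Complex.exp (Real.pi ^ 2 / (8 * s) - s / 8)‖ * ‖Complex.exp (n * s)‖ = Real.exp (Real.pi ^ 2 * R / 8 + Λ) := by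
      rw [← norm_mul, ← Complex.exp_add, Complex.norm_exp]
      congr 1
      have : (Real.pi ^ 2 / (8 * s) - s / 8 + n * s : ℂ) = ((Real.pi ^ 2 / 8 : ℝ) : ℂ) * (1 / s) + ((n - 1 / 8 : ℝ) : ℂ) * s := by
        push_cast; field_simp; ring
      rw [this, Complex.add_re, Complex.re_ofReal_mul, Complex.re_ofReal_mul, hre, ← hR, h2]; ring
    rw [norm_div, norm_mul, norm_mul, hM, norm_mul, norm_div, hc, Complex.norm_real, Real.norm_of_nonneg (Real.sqrt_nonneg 2)]
    rw [div_le_iff₀ (by linarith)]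
    set D := ‖L - Real.pi * rhoL α β γ s‖ with hD
    calc √(2 * ‖s‖ / Real.pi) / √2 * ‖Complex.exp (Real.pi ^ 2 / (8 * s) - s / 8)‖ * D * ‖Complex.exp (n * s)‖
        = √(2 * ‖s‖ / Real.pi) / √2 * Real.exp (Real.pi ^ 2 * R / 8 + Λ) * D := by rw [← hexpM]; ring
      _ ≤ √(2 * ‖s‖ / Real.pi) / √2 * Real.exp (Real.pi ^ 2 * R / 8 + Λ) * (16 * Real.exp (25 * t) * Real.exp (-(Real.pi ^ 2 * R / 9)) * √(Real.pi / t)) :=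
          mul_le_mul_of_nonneg_left hE (by positivity)
      _ = (√(2 * ‖s‖ / Real.pi) / √2 * √(Real.pi / t)) * (16 * Real.exp (25 * t)) * Real.exp (Real.pi ^ 2 * R / 72 + Λ) := by
          rw [show Real.pi ^ 2 * R / 72 + Λ = (Real.pi ^ 2 * R / 8 + Λ) + (-(Real.pi ^ 2 * R / 9)) by ring, Real.exp_add (Real.pi ^ 2 * R / 8 + Λ)]
          ring
      _ ≤ (8 / 5) * (16 * (110 / 100)) * Real.exp (136 / 100 * Λ) := by
          apply mul_le_mul _ _ (Real.exp_pos _).le (by norm_num)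
          · exact mul_le_mul hsq (by linarith) (by positivity) (by norm_num)
          · apply Real.exp_le_exp.2; linarith
      _ ≤ 60 * Real.exp (136 / 100 * Λ) * (1 / 2) := by nlinarith [Real.exp_pos (136 / 100 * Λ)]
      _ ≤ 60 * Real.exp (136 / 100 * Λ) * ‖1 + δ‖ := mul_le_mul_of_nonneg_left hδh (by positivity)
  have hJn : ‖JJ Λ x‖ ≤ Real.exp (2 * Λ) := by
    refine (JJ_norm Λ x).trans (Real.exp_le_exp.2 ?_)
    have : 0 ≤ Λ * (x ^ 2 / (1 + x ^ 2)) := by positivity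
    linarith
  have hmid : ‖K * JJ Λ x * ((1 + u)⁻¹ - 1)‖ ≤ K * (Real.exp (2 * Λ) * Real.exp (-Λ)) := by
    rw [norm_mul, norm_mul, Complex.norm_real, Real.norm_of_nonneg hK0, mul_assoc]
    apply mul_le_mul_of_nonneg_left _ hK0
    exact mul_le_mul hJn (by linarith) (norm_nonneg _) (Real.exp_pos _).le
  have hJ := JJ_re Λ x (by linarith) hxa
  have c1 := (abs_le.1 ((Complex.abs_re_le_norm _).trans hmid)).1
  have c2 := (abs_le.1 ((Complex.abs_re_le_norm _).trans hMn)).1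
  have c3 := mul_le_mul_of_nonneg_left hJ hK0
  rw [hF, Complex.add_re, Complex.add_re, Complex.re_ofReal_mul]
  linarith

lemma pi_sq_lo : 985 / 100 ≤ Real.pi ^ 2 := by nlinarith [Real.pi_gt_d2]
lemma pi_sq_hi : Real.pi ^ 2 ≤ 987 / 100 := by nlinarith [Real.pi_lt_d4, Real.pi_pos]

lemma inv_one_sub_exp (y : ℝ) (hy : 0 < y) : (1 - Real.exp (-y))⁻¹ ≤ 1 + 1 / y := by
  have h := Real.add_one_le_exp y
  have h1 : Real.exp (-y) ≤ (y + 1)⁻¹ := by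
    rw [Real.exp_neg]
    exact inv_anti₀ (by linarith) h
  have h2 : y / (y + 1) ≤ 1 - Real.exp (-y) := by
    have : y / (y + 1) = 1 - (y + 1)⁻¹ := by field_simp; ring
    linarith
  have h3 : 1 + 1 / y = (y / (y + 1))⁻¹ := by field_simp
  rw [h3]
  exact inv_anti₀ (by positivity) h2

lemma minor_pt (ρ σ n : ℕ) (t Λ φ : ℝ) (ht : 0 < t) (ht2 : t ≤ 31 / 10000) (h1 : 25 * Real.pi ^ 2 / 648 = Λ * t) (h2 : ((n : ℝ) - 1 / 8) * t = Λ) (h3 : 124 ≤ Λ)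
    (hφ : 2 * t ≤ |φ|) (hφ2 : |φ| ≤ Real.pi) :
    ‖FC ρ σ n t φ‖ ≤ 4 * Λ ^ 2 * Real.exp (1832 / 1000 * Λ) := by
  have hm := minor t φ ht ht2 hφ hφ2
  have hnq : ‖Complex.exp (-(t - Complex.I * φ))‖ = Real.exp (-t) := by
    rw [Complex.norm_exp]; simp
  have hq1 : ‖Complex.exp (-(t - Complex.I * φ))‖ < 1 := by
    rw [hnq, Real.exp_lt_one_iff]; linarith
  have hL := LL_norm ρ σ _ hq1
  rw [hnq, ← Real.exp_nat_mul] at hL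
  have hn : ‖Complex.exp (n * (t - Complex.I * φ))‖ = Real.exp (n * t) := by
    rw [Complex.norm_exp]; simp
  have hit : 1 / t ≤ 2632 / 1000 * Λ := by
    rw [div_le_iff₀ ht]
    nlinarith [pi_sq_lo]
  have hit1 : 300 ≤ 1 / t := by rw [le_div_iff₀ ht]; linarith
  have b1 := inv_one_sub_exp t ht
  have b2 := inv_one_sub_exp (18 * t) (by linarith)
  have e18 : ((18 : ℕ) : ℝ) * -t = -(18 * t) := by push_cast; ring
  rw [e18] at hL
  have b1' : (1 - Real.exp (-t))⁻¹ ≤ 2645 / 1000 * Λ := by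
    have : (1 : ℝ) ≤ 13 / 1000 * Λ := by linarith
    linarith
  have b2' : (1 - Real.exp (-(18 * t)))⁻¹ ≤ 17 / 100 * Λ := by
    have e : 1 / (18 * t) = 1 / t / 18 := by field_simp
    rw [e] at b2
    linarith
  have p2 : 0 ≤ (1 - Real.exp (-(18 * t)))⁻¹ := by
    rw [inv_nonneg, sub_nonneg, Real.exp_le_one_iff]; linarith
  have b3 : (1 - Real.exp (-t))⁻¹ * (1 - Real.exp (-(18 * t)))⁻¹ ≤ (2645 / 1000 * Λ) * (17 / 100 * Λ) :=
    mul_le_mul b1' b2' p2 (by positivity)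
  have hL' : ‖ev (LL ρ σ) (Complex.exp (-(t - Complex.I * φ)))‖ ≤ 4 * Λ ^ 2 := by
    refine hL.trans ?_
    nlinarith
  rw [FC, ev_mul (CV_PP _ hq1) (CV_LL _ _ _ hq1), norm_mul, norm_mul, hn]
  calc _ ≤ Real.exp (316 / 1000 / t) * (4 * Λ ^ 2) * Real.exp (n * t) := by
        apply mul_le_mul_of_nonneg_right _ (Real.exp_pos _).le
        exact mul_le_mul hm hL' (norm_nonneg _) (Real.exp_pos _).le
    _ = 4 * Λ ^ 2 * Real.exp (316 / 1000 / t + n * t) := by rw [Real.exp_add]; ring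
    _ ≤ _ := by
        apply mul_le_mul_of_nonneg_left _ (by positivity)
        apply Real.exp_le_exp.2
        have e : 316 / 1000 / t = 316 / 1000 * (1 / t) := by ring
        rw [e]
        linarith

lemma gauss_lo (a B : ℝ) (ha : 0 < a) (hB : 0 < B) :
    √(Real.pi / a) - Real.exp (-(a * B ^ 2 / 2)) * √(Real.pi / (a / 2)) ≤ ∫ x in (-B)..B, Real.exp (-a * x ^ 2) := by
  have i1 := integrable_exp_neg_mul_sq ha
  have i2 : MeasureTheory.Integrable (fun x : ℝ => Real.exp (-(a * B ^ 2 / 2)) * Real.exp (-(a / 2) * x ^ 2)) :=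
    (integrable_exp_neg_mul_sq (by positivity : 0 < a / 2)).const_mul _
  have i3 := i1.sub i2
  have e1 : √(Real.pi / a) - Real.exp (-(a * B ^ 2 / 2)) * √(Real.pi / (a / 2)) =
      ∫ x : ℝ, ((fun x : ℝ => Real.exp (-a * x ^ 2)) - fun x : ℝ => Real.exp (-(a * B ^ 2 / 2)) * Real.exp (-(a / 2) * x ^ 2)) x := by
    simp only [Pi.sub_apply]
    rw [MeasureTheory.integral_sub i1 i2, MeasureTheory.integral_const_mul, integral_gaussian, integral_gaussian]
  rw [e1, intervalIntegral.integral_of_le (by linarith), ← MeasureTheory.integral_add_compl (measurableSet_Ioc (a := -B) (b := B)) i3]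
  have c1 : ∫ x in (Set.Ioc (-B) B)ᶜ, ((fun x : ℝ => Real.exp (-a * x ^ 2)) - fun x : ℝ => Real.exp (-(a * B ^ 2 / 2)) * Real.exp (-(a / 2) * x ^ 2)) x ≤ 0 := by
    apply MeasureTheory.setIntegral_nonpos measurableSet_Ioc.compl
    intro x hx
    simp only [Pi.sub_apply, ← Real.exp_add, sub_nonpos]
    apply Real.exp_le_exp.2
    have : B ^ 2 ≤ x ^ 2 := by
      simp only [Set.mem_compl_iff, Set.mem_Ioc, not_and_or, not_lt, not_le] at hx
      rcases hx with hx | hx <;> nlinarith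
    nlinarith
  have c2 : ∫ x in (Set.Ioc (-B) B), ((fun x : ℝ => Real.exp (-a * x ^ 2)) - fun x : ℝ => Real.exp (-(a * B ^ 2 / 2)) * Real.exp (-(a / 2) * x ^ 2)) x ≤ ∫ x in Set.Ioc (-B) B, Real.exp (-a * x ^ 2) := by
    apply MeasureTheory.setIntegral_mono i3.integrableOn i1.integrableOn
    intro x
    simp only [Pi.sub_apply]
    have : 0 ≤ Real.exp (-(a * B ^ 2 / 2)) * Real.exp (-(a / 2) * x ^ 2) := by positivity
    linarith
  linarith

lemma gauss_hi (a B : ℝ) (ha : 0 < a) (hB : 0 < B) : ∫ x in (-B)..B, Real.exp (-a * x ^ 2) ≤ √(Real.pi / a) := by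
  rw [intervalIntegral.integral_of_le (by linarith)]
  refine (MeasureTheory.setIntegral_le_integral (integrable_exp_neg_mul_sq ha) (Filter.Eventually.of_forall fun x => (Real.exp_pos _).le)).trans ?_
  rw [integral_gaussian]

lemma gauss_scaled (t Λ : ℝ) (ht : 0 < t) (hΛ : 124 ≤ Λ) :
    t * √(Real.pi / Λ) * (99 / 100) ≤ (∫ φ in (-(2 * t))..(2 * t), Real.exp (-Λ * (φ / t) ^ 2)) ∧
    (∫ φ in (-(2 * t))..(2 * t), Real.exp (-(4 / 10 * Λ) * (φ / t) ^ 2)) ≤ 16 / 10 * (t * √(Real.pi / Λ)) := by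
  have hpi := Real.pi_pos
  have hΛ0 : 0 < Λ := by linarith
  have e0 : ∀ c : ℝ, (fun φ : ℝ => Real.exp (-c * (φ / t) ^ 2)) = fun φ => Real.exp (-(c / t ^ 2) * φ ^ 2) := by
    intro c; funext φ; congr 1; rw [div_pow]; ring
  have e1 : √(Real.pi / (Λ / t ^ 2)) = t * √(Real.pi / Λ) := by
    rw [show Real.pi / (Λ / t ^ 2) = t ^ 2 * (Real.pi / Λ) by field_simp, Real.sqrt_mul (by positivity), Real.sqrt_sq ht.le]
  constructor
  · have := gauss_lo (Λ / t ^ 2) (2 * t) (by positivity) (by positivity)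
    rw [e0 Λ]
    refine le_trans ?_ this
    have e2 : √(Real.pi / (Λ / t ^ 2 / 2)) = √2 * (t * √(Real.pi / Λ)) := by
      rw [← e1, ← Real.sqrt_mul (by norm_num)]; congr 1; field_simp
    have e3 : Λ / t ^ 2 * (2 * t) ^ 2 / 2 = 2 * Λ := by field_simp
    rw [e1, e2, e3]
    have h2 : √2 ≤ 3 / 2 := by apply Real.sqrt_le_iff.2; norm_num
    have h3 : Real.exp (-(2 * Λ)) ≤ 1 / 200 := by
      rw [Real.exp_neg, inv_le_comm₀ (Real.exp_pos _) (by norm_num)]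
      have := Real.add_one_le_exp (2 * Λ)
      linarith
    have h4 : Real.exp (-(2 * Λ)) * √2 ≤ 1 / 200 * (3 / 2) := mul_le_mul h3 h2 (Real.sqrt_nonneg _) (by norm_num)
    have hG : 0 ≤ t * √(Real.pi / Λ) := by positivity
    nlinarith
  · have := gauss_hi (4 / 10 * Λ / t ^ 2) (2 * t) (by positivity) (by positivity)
    rw [e0]
    refine this.trans ?_
    have e2 : √(Real.pi / (4 / 10 * Λ / t ^ 2)) = √(5 / 2) * (t * √(Real.pi / Λ)) := by
      rw [← e1, ← Real.sqrt_mul (by norm_num)]; congr 1; field_simp; norm_num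
    rw [e2]
    apply mul_le_mul_of_nonneg_right _ (by positivity)
    apply Real.sqrt_le_iff.2; norm_num

lemma exp_v1 (Λ : ℝ) (h : 124 ≤ Λ) : 120 * Λ * Real.exp (-Λ / 10) ≤ 1 := by
  have h1 : (2 : ℝ) ≤ Real.exp 1 := by linarith [Real.exp_one_gt_d9]
  have h12 : (2 : ℝ) ^ 12 ≤ Real.exp 12 := by
    have : Real.exp 12 = Real.exp 1 ^ 12 := by rw [← Real.exp_nat_mul]; norm_num
    rw [this]; exact pow_le_pow_left₀ (by norm_num) h1 12
  have h12' : (27 / 10 : ℝ) ^ 12 ≤ Real.exp 12 := by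
    have : Real.exp 12 = Real.exp 1 ^ 12 := by rw [← Real.exp_nat_mul]; norm_num
    rw [this]; exact pow_le_pow_left₀ (by norm_num) (by linarith [Real.exp_one_gt_d9]) 12
  have h2 := Real.add_one_le_exp (Λ / 10 - 12)
  have h3 : Real.exp (Λ / 10) = Real.exp 12 * Real.exp (Λ / 10 - 12) := by rw [← Real.exp_add]; congr 1; ring
  have h4 : 120 * Λ ≤ Real.exp (Λ / 10) := by
    rw [h3]
    have : (100000 : ℝ) ≤ Real.exp 12 := by refine le_trans ?_ h12'; norm_num
    have := mul_le_mul this h2 (by linarith) (Real.exp_pos _).le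
    linarith
  rw [neg_div, Real.exp_neg, mul_inv_le_iff₀ (Real.exp_pos _)]
  linarith

lemma exp_v2 (Λ : ℝ) (h : 124 ≤ Λ) : 225 * Λ ^ 3 * Real.exp (1832 / 1000 * Λ) < Real.exp (2 * Λ) := by
  have h7 : (1096 : ℝ) ≤ Real.exp 7 := by
    have : Real.exp 7 = Real.exp 1 ^ 7 := by rw [← Real.exp_nat_mul]; norm_num
    rw [this]
    have := pow_le_pow_left₀ (by norm_num) (le_of_lt Real.exp_one_gt_d9) 7
    refine le_trans ?_ this; norm_num
  have h2 := Real.add_one_le_exp (56 / 1000 * Λ - 7)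
  have h3 : Real.exp (56 / 1000 * Λ) = Real.exp 7 * Real.exp (56 / 1000 * Λ - 7) := by rw [← Real.exp_add]; congr 1; ring
  have h4 : 61 / 10 * Λ ≤ Real.exp (56 / 1000 * Λ) := by
    rw [h3]
    have := mul_le_mul h7 h2 (by linarith) (Real.exp_pos _).le
    linarith
  have h5 := pow_le_pow_left₀ (by positivity) h4 3
  have h6 : Real.exp (2 * Λ) = Real.exp (56 / 1000 * Λ) ^ 3 * Real.exp (1832 / 1000 * Λ) := by
    rw [← Real.exp_nat_mul, ← Real.exp_add]; congr 1; push_cast; ring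
  rw [h6]
  apply mul_lt_mul_of_pos_right _ (Real.exp_pos _)
  refine lt_of_lt_of_le ?_ h5
  have : 0 < Λ ^ 3 := by positivity
  nlinarith

set_option maxHeartbeats 2000000 in
lemma coeff_large (α β γ ρ σ n : ℕ) (h : α + β + γ ≤ 10) (S : ℝ) (hS : S = Real.sin (α * Real.pi / 9) * Real.sin (β * Real.pi / 9) * Real.sin (γ * Real.pi / 9)) (hS0 : 98 / 1000 ≤ S)
    (hLL : ∀ s : ℂ, 0 < s.re → HasSum (fun k : ℕ => (-1 : ℂ) ^ k * (Complex.exp (-2 * (k + 1) ^ 2 * s) * HH α β γ ((k + 1) * s))) (ev (LL ρ σ) (Complex.exp (-s))))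
    (hn : 40960 ≤ n) : 1 ≤ PowerSeries.coeff n (PP * LL ρ σ) := by
  have hpi := Real.pi_pos
  have hnR : (40960 : ℝ) ≤ n := by exact_mod_cast hn
  obtain ⟨ν, hν⟩ : ∃ ν : ℝ, ν = (n : ℝ) - 1 / 8 := ⟨_, rfl⟩
  have hν0 : 0 < ν := by linarith
  obtain ⟨Λ, hΛ⟩ : ∃ Λ : ℝ, Λ = √(25 * Real.pi ^ 2 / 648 * ν) := ⟨_, rfl⟩
  have hΛ2 : Λ ^ 2 = 25 * Real.pi ^ 2 / 648 * ν := by rw [hΛ]; exact Real.sq_sqrt (by positivity)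
  have hΛ124 : 124 ≤ Λ := by
    rw [hΛ]; apply Real.le_sqrt_of_sq_le; nlinarith [pi_sq_lo]
  have hΛ0 : 0 < Λ := by linarith
  obtain ⟨t, htd⟩ : ∃ t : ℝ, t = Λ / ν := ⟨_, rfl⟩
  have ht : 0 < t := by rw [htd]; positivity
  have h2 : ((n : ℝ) - 1 / 8) * t = Λ := by rw [← hν, htd]; field_simp
  have h1 : 25 * Real.pi ^ 2 / 648 = Λ * t := by
    rw [htd, ← mul_div_assoc, ← sq, hΛ2]; field_simp
  have ht2 : t ≤ 31 / 10000 := by nlinarith [pi_sq_hi]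
  have hCV : CV (PP * LL ρ σ) (Real.exp (-t)) := by
    have : ‖((Real.exp (-t) : ℝ) : ℂ)‖ < 1 := by
      rw [Complex.norm_real, Real.norm_of_nonneg (Real.exp_pos _).le, Real.exp_lt_one_iff]; linarith
    exact CV_mul (CV_PP _ this) (CV_LL _ _ _ this)
  obtain ⟨hinteg, hval⟩ := coeff_integral (PP * LL ρ σ) t hCV n
  change IntervalIntegrable (FC ρ σ n t) _ _ _ at hinteg
  change ∫ φ in (-Real.pi)..Real.pi, FC ρ σ n t φ = _ at hval
  set d := PowerSeries.coeff n (PP * LL ρ σ) with hd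
  set f : ℝ → ℝ := fun φ => (FC ρ σ n t φ).re with hf
  have hintf : IntervalIntegrable f MeasureTheory.volume (-Real.pi) Real.pi := by
    constructor
    · exact hinteg.1.re
    · exact hinteg.2.re
  have hvalf : ∫ φ in (-Real.pi)..Real.pi, f φ = 2 * Real.pi * (d : ℝ) := by
    have e := Complex.reCLM.intervalIntegral_comp_comm hinteg
    rw [hval] at e
    have e2 : Complex.reCLM (2 * Real.pi * ((d : ℤ) : ℂ)) = 2 * Real.pi * (d : ℝ) := by
      rw [show (2 * Real.pi * ((d : ℤ) : ℂ) : ℂ) = ((2 * Real.pi * (d : ℝ) : ℝ) : ℂ) by push_cast; ring]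
      exact Complex.ofReal_re _
    rw [e2] at e
    exact e
  have hpi3 := Real.pi_gt_three
  have i1 : IntervalIntegrable f MeasureTheory.volume (-Real.pi) (-(2 * t)) := hintf.mono_set (by
    rw [Set.uIcc_of_le (by linarith), Set.uIcc_of_le (by linarith)]; exact Set.Icc_subset_Icc le_rfl (by linarith))
  have i2 : IntervalIntegrable f MeasureTheory.volume (-(2 * t)) (2 * t) := hintf.mono_set (by
    rw [Set.uIcc_of_le (by linarith), Set.uIcc_of_le (by linarith)]; exact Set.Icc_subset_Icc (by linarith) (by linarith))
  have i3 : IntervalIntegrable f MeasureTheory.volume (2 * t) Real.pi := hintf.mono_set (by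
    rw [Set.uIcc_of_le (by linarith), Set.uIcc_of_le (by linarith)]; exact Set.Icc_subset_Icc (by linarith) le_rfl)
  have hsplit : ∫ φ in (-Real.pi)..Real.pi, f φ = (∫ φ in (-Real.pi)..(-(2 * t)), f φ) + (∫ φ in (-(2 * t))..(2 * t), f φ) + ∫ φ in (2 * t)..Real.pi, f φ := by
    rw [intervalIntegral.integral_add_adjacent_intervals i1 i2, intervalIntegral.integral_add_adjacent_intervals (i1.trans i2) i3]
  set m := 4 * Λ ^ 2 * Real.exp (1832 / 1000 * Λ) with hm
  have hm0 : 0 < m := by positivity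
  have hmin : ∀ φ : ℝ, 2 * t ≤ |φ| → |φ| ≤ Real.pi → ‖f φ‖ ≤ m := fun φ ha hb =>
    (Complex.abs_re_le_norm _).trans (minor_pt ρ σ n t Λ φ ht ht2 h1 h2 hΛ124 ha hb)
  have j1 : -(m * Real.pi) ≤ ∫ φ in (-Real.pi)..(-(2 * t)), f φ := by
    have := intervalIntegral.norm_integral_le_of_norm_le_const (f := f) (C := m) (a := -Real.pi) (b := -(2 * t)) (fun φ hφ => by
      rw [Set.uIoc_of_le (by linarith)] at hφ
      have e : |φ| = -φ := abs_of_neg (by linarith [hφ.2])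
      exact hmin φ (by rw [e]; linarith [hφ.2]) (by rw [e]; linarith [hφ.1]))
    rw [abs_of_nonneg (by linarith)] at this
    have k := (abs_le.1 this).1
    nlinarith
  have j3 : -(m * Real.pi) ≤ ∫ φ in (2 * t)..Real.pi, f φ := by
    have := intervalIntegral.norm_integral_le_of_norm_le_const (f := f) (C := m) (a := 2 * t) (b := Real.pi) (fun φ hφ => by
      rw [Set.uIoc_of_le (by linarith)] at hφ
      have e : |φ| = φ := abs_of_pos (by linarith [hφ.1])
      exact hmin φ (by rw [e]; linarith [hφ.1]) (by rw [e]; linarith [hφ.2]))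
    rw [abs_of_nonneg (by linarith)] at this
    have k := (abs_le.1 this).1
    nlinarith
  set K := 8 * Real.pi * S / 9 / √(Real.pi * t) with hK
  have hS1 : 0 < S := by linarith
  have hK0 : 0 < K := by positivity
  set G := t * √(Real.pi / Λ) with hG
  have hG0 : 0 < G := by positivity
  set I1 := ∫ φ in (-(2 * t))..(2 * t), Real.exp (-Λ * (φ / t) ^ 2) with hI1
  set I2 := ∫ φ in (-(2 * t))..(2 * t), Real.exp (-(4 / 10 * Λ) * (φ / t) ^ 2) with hI2
  obtain ⟨g1, g2⟩ := gauss_scaled t Λ ht hΛ124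
  rw [← hI1, ← hG] at g1
  rw [← hI2, ← hG] at g2
  have c1 : ∀ c : ℝ, IntervalIntegrable (fun φ : ℝ => Real.exp (-c * (φ / t) ^ 2)) MeasureTheory.volume (-(2 * t)) (2 * t) := by
    intro c
    apply Continuous.intervalIntegrable
    fun_prop
  set w := 2 * Real.exp (-Λ / 10) + Real.exp (-Λ) with hw
  have j2 : K * (Real.exp (2 * Λ) * (I1 - 10 / Λ * I2 - 4 * t * w)) - 4 * t * (60 * Real.exp (136 / 100 * Λ)) ≤ ∫ φ in (-(2 * t))..(2 * t), f φ := by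
    have e : K * (Real.exp (2 * Λ) * (I1 - 10 / Λ * I2 - 4 * t * w)) - 4 * t * (60 * Real.exp (136 / 100 * Λ)) =
        ∫ φ in (-(2 * t))..(2 * t), (K * Real.exp (2 * Λ) * (Real.exp (-Λ * (φ / t) ^ 2)) - K * Real.exp (2 * Λ) * (10 / Λ) * Real.exp (-(4 / 10 * Λ) * (φ / t) ^ 2) - (K * Real.exp (2 * Λ) * w + 60 * Real.exp (136 / 100 * Λ))) := by
      rw [intervalIntegral.integral_sub (((c1 _).const_mul _).sub ((c1 _).const_mul _)) intervalIntegrable_const, intervalIntegral.integral_sub ((c1 _).const_mul _) ((c1 _).const_mul _),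
        intervalIntegral.integral_const_mul, intervalIntegral.integral_const_mul, intervalIntegral.integral_const, ← hI1, ← hI2, smul_eq_mul]
      ring
    rw [e]
    apply intervalIntegral.integral_mono_on (by linarith) ((((c1 _).const_mul _).sub ((c1 _).const_mul _)).sub intervalIntegrable_const) i2
    intro φ hφ
    have := major_pt α β γ ρ σ n h S hS hS1.le hLL t Λ φ ht ht2 h1 h2 hΛ124 (abs_le.2 ⟨hφ.1, hφ.2⟩)
    refine le_trans (le_of_eq ?_) this
    rw [← hK, hw]; ring
  have hwG : 4 * t * w ≤ 1 / 10 * G := by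
    have w1 : Real.exp (-Λ) ≤ Real.exp (-Λ / 10) := Real.exp_le_exp.2 (by linarith)
    have w2 := exp_v1 Λ hΛ124
    have w3 : 1 / Λ ≤ √(Real.pi / Λ) := by
      apply Real.le_sqrt_of_sq_le
      rw [div_pow, div_le_div_iff₀ (by positivity) hΛ0]
      nlinarith
    have w4 : Real.exp (-Λ / 10) ≤ 1 / 120 * (1 / Λ) := by
      rw [← div_eq_mul_one_div, le_div_iff₀ hΛ0]; linarith
    have w5 : 4 * w ≤ 1 / 10 * √(Real.pi / Λ) := by rw [hw]; linarith
    rw [hG]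
    nlinarith
  have hI2G : 10 / Λ * I2 ≤ 13 / 100 * G := by
    have : 10 / Λ ≤ 10 / 124 := div_le_div_of_nonneg_left (by norm_num) (by norm_num) hΛ124
    have k1 : 10 / Λ * I2 ≤ 10 / Λ * (16 / 10 * G) := mul_le_mul_of_nonneg_left g2 (by positivity)
    have k2 : 10 / Λ * (16 / 10 * G) ≤ 10 / 124 * (16 / 10 * G) := mul_le_mul_of_nonneg_right this (by positivity)
    linarith
  have hKG : 16 / 100 / Λ ≤ K * G := by
    have e1 : K * G = 8 * Real.pi * S / 9 * √(t / Λ) := by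
      have : √(Real.pi / Λ) * t = √(Real.pi * t) * √(t / Λ) := by
        rw [← Real.sqrt_mul (by positivity), show Real.pi * t * (t / Λ) = Real.pi / Λ * t ^ 2 by ring, Real.sqrt_mul (by positivity), Real.sqrt_sq ht.le]
      have hne : √(Real.pi * t) ≠ 0 := by positivity
      rw [hK, hG, mul_comm t, this]; field_simp
    have e2 : 6 / 10 / Λ ≤ √(t / Λ) := by
      apply Real.le_sqrt_of_sq_le
      rw [div_pow, div_le_div_iff₀ (by positivity) hΛ0]
      nlinarith [pi_sq_lo]
    rw [e1]
    have e3 : 27 / 100 ≤ 8 * Real.pi * S / 9 := by nlinarith [Real.pi_gt_d2]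
    have := mul_le_mul e3 e2 (by positivity) (by positivity)
    refine le_trans ?_ this
    rw [show (27 / 100 * (6 / 10 / Λ) : ℝ) = 162 / 1000 / Λ by ring]
    exact div_le_div_of_nonneg_right (by norm_num) hΛ0.le
  have hmainlo : 12 / 100 / Λ * Real.exp (2 * Λ) ≤ K * (Real.exp (2 * Λ) * (I1 - 10 / Λ * I2 - 4 * t * w)) := by
    have a1 : 75 / 100 * G ≤ I1 - 10 / Λ * I2 - 4 * t * w := by linarith
    have a2 := mul_le_mul_of_nonneg_left a1 hK0.le
    have a3 : 12 / 100 / Λ ≤ K * (75 / 100 * G) := by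
      have : 12 / 100 / Λ = 75 / 100 * (16 / 100 / Λ) := by ring
      rw [this]; linarith
    have a4 := mul_le_mul_of_nonneg_right (a3.trans a2) (Real.exp_pos (2 * Λ)).le
    linarith
  have hsmall : 4 * t * (60 * Real.exp (136 / 100 * Λ)) ≤ Λ ^ 2 * Real.exp (1832 / 1000 * Λ) := by
    have : Real.exp (136 / 100 * Λ) ≤ Real.exp (1832 / 1000 * Λ) := Real.exp_le_exp.2 (by linarith)
    have p := Real.exp_pos (136 / 100 * Λ)
    calc 4 * t * (60 * Real.exp (136 / 100 * Λ)) ≤ 1 * Real.exp (136 / 100 * Λ) := by nlinarith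
      _ ≤ Λ ^ 2 * Real.exp (1832 / 1000 * Λ) := mul_le_mul (by nlinarith) this p.le (by positivity)
  have hfin : 27 * Λ ^ 2 * Real.exp (1832 / 1000 * Λ) < 12 / 100 / Λ * Real.exp (2 * Λ) := by
    have := exp_v2 Λ hΛ124
    have e : 12 / 100 / Λ * Real.exp (2 * Λ) = 12 / 100 * Real.exp (2 * Λ) / Λ := by ring
    rw [e, lt_div_iff₀ hΛ0]
    nlinarith
  have hmpi : 2 * (m * Real.pi) ≤ 26 * Λ ^ 2 * Real.exp (1832 / 1000 * Λ) := by
    have : 0 < Λ ^ 2 * Real.exp (1832 / 1000 * Λ) := by positivity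
    rw [hm]; nlinarith [Real.pi_lt_d2]
  have hpos : 0 < 2 * Real.pi * (d : ℝ) := by
    rw [← hvalf, hsplit]; linarith
  have : (0 : ℝ) < d := by
    by_contra hc
    push Not at hc
    nlinarith
  have : 0 < d := by exact_mod_cast this
  omega

lemma sin_pi9 : 338 / 1000 ≤ Real.sin (Real.pi / 9) := by
  have h1 := Real.pi_gt_d4
  have h2 := Real.pi_lt_d4
  have h := Real.sin_gt_sub_cube (x := Real.pi / 9) (by positivity)
  have h3 : (Real.pi / 9) ^ 3 ≤ (3491 / 10000) ^ 3 := pow_le_pow_left₀ (by positivity) (by linarith) 3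
  norm_num at h3
  linarith

lemma sin_pi3 : 866 / 1000 ≤ Real.sin (Real.pi / 3) := by
  rw [Real.sin_pi_div_three]
  have : (1732 / 1000 : ℝ) ≤ √3 := by apply Real.le_sqrt_of_sq_le; norm_num
  linarith

lemma sin_2pi3 : 866 / 1000 ≤ Real.sin (6 * Real.pi / 9) := by
  have : 6 * Real.pi / 9 = Real.pi - Real.pi / 3 := by ring
  rw [this, Real.sin_pi_sub]; exact sin_pi3

lemma sin_2pi9 : 338 / 1000 ≤ Real.sin (2 * Real.pi / 9) := by
  have hpi := Real.pi_pos
  refine sin_pi9.trans ?_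
  apply Real.sin_le_sin_of_le_of_le_pi_div_two <;> linarith

lemma three_mul_le (a b c : ℝ) (ha : 338 / 1000 ≤ a) (hb : 338 / 1000 ≤ b) (hc : 866 / 1000 ≤ c) : 98 / 1000 ≤ a * b * c := by
  have h1 := mul_le_mul ha hb (by norm_num) (by linarith)
  have h2 := mul_le_mul h1 hc (by norm_num) (by positivity)
  refine le_trans ?_ h2
  norm_num

lemma coeff_pos_a (n : ℕ) (hn : 36 ≤ n) : 1 ≤ PowerSeries.coeff n (PP * LL 0 3) := by
  rcases lt_or_ge n 40960 with h | h
  · exact coeff_small 0 3 chk_a n hn h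
  · refine coeff_large 1 3 6 0 3 n (by norm_num) _ rfl ?_ (fun s hs => LL_a s hs) h
    apply three_mul_le
    · rw [Nat.cast_one, one_mul]; exact sin_pi9
    · rw [show ((3 : ℕ) : ℝ) * Real.pi / 9 = Real.pi / 3 by push_cast; ring]; linarith [sin_pi3]
    · exact_mod_cast sin_2pi3

lemma coeff_pos_b (n : ℕ) (hn : 36 ≤ n) : 1 ≤ PowerSeries.coeff n (PP * LL 1 2) := by
  rcases lt_or_ge n 40960 with h | h
  · exact coeff_small 1 2 chk_b n hn h
  · refine coeff_large 1 1 6 1 2 n (by norm_num) _ rfl ?_ (fun s hs => LL_b s hs) h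
    apply three_mul_le
    · rw [Nat.cast_one, one_mul]; exact sin_pi9
    · rw [Nat.cast_one, one_mul]; exact sin_pi9
    · exact_mod_cast sin_2pi3

lemma coeff_pos_c (n : ℕ) (hn : 36 ≤ n) : 1 ≤ PowerSeries.coeff n (PP * LL 2 4) := by
  rcases lt_or_ge n 40960 with h | h
  · exact coeff_small 2 4 chk_c n hn h
  · refine coeff_large 1 2 3 2 4 n (by norm_num) _ rfl ?_ (fun s hs => LL_c s hs) h
    apply three_mul_le
    · rw [Nat.cast_one, one_mul]; exact sin_pi9
    · exact_mod_cast sin_2pi9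
    · rw [show ((3 : ℕ) : ℝ) * Real.pi / 9 = Real.pi / 3 by push_cast; ring]; exact sin_pi3

theorem N2_mod9_inequalities (n : ℕ) (hn : 36 ≤ n) :
    N2 3 9 n < N2 0 9 n ∧ (N2 4 9 n < N2 2 9 n ∧ N2 2 9 n < N2 1 9 n) := by
  have ha := coeff_pos_a n hn
  have hb := coeff_pos_b n hn
  have hc := coeff_pos_c n hn
  have da := N2_diff n (by omega) 0 3 (by norm_num) (by norm_num)
  have db := N2_diff n (by omega) 1 2 (by norm_num) (by norm_num)
  have dc := N2_diff n (by omega) 2 4 (by norm_num) (by norm_num)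
  simp only [Nat.cast_ofNat, Nat.cast_zero, Nat.cast_one] at da db dc
  refine ⟨?_, ?_, ?_⟩ <;> omega
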